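/- arXiv:2401.11583 — 10 statements merged into one kernel-verified Lean document; each statement's English description precedes it below -/
import Mathlib

section
/- Let F be a finite field of even cardinality (i.e., of characteristic 2). Then the special linear group SL_2(F) is realizable (there exists a ring R with unit group R^× isomorphic to SL_2(F)) if and only if F has exactly 2 elements. -/
universe u

namespace SL2Aux

/-- Ring-theoretic part: if all units commuting with `h` have order dividing `2^n+1`
then `h ^ 3 = 1`. -/
theorem cube_eq_one {R : Type*} [Ring R] (n : ℕ) (hn : n ≠ 0) (h : Rˣ)
    (H : ∀ v : Rˣ, Commute v h → v ^ (2 ^ n + 1) = 1) : h ^ 3 = 1 := by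
  rcases subsingleton_or_nontrivial R with hs | hnt
  · exact Subsingleton.elim _ _
  obtain ⟨m, rfl⟩ : ∃ m, n = m + 1 := ⟨n - 1, by omega⟩
  have hneg : (-1 : Rˣ) = 1 := by
    have := H (-1) (by simp)
    rw [pow_succ, Even.neg_one_pow (by simp [Nat.even_pow])] at this
    simpa using this
  have h2 : (2 : R) = 0 := by
    have h1 : (-1 : R) = 1 := by simpa using congrArg Units.val hneg
    have h3 : (2 : R) = 1 + 1 := by norm_num
    rw [h3]; nth_rewrite 1 [← h1]; simp
  have : CharP R 2 := CharTwo.of_one_ne_zero_of_two_eq_zero one_ne_zero h2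
  have add_self : ∀ x : R, x + x = 0 := CharTwo.add_self_eq_zero
  set q := 2 ^ (m + 1) with hq
  have hq2 : 2 ≤ q := by rw [hq, pow_succ]; have := Nat.one_le_two_pow (n := m); omega
  have hh : (h : R) ^ (q + 1) = 1 := by
    have := H h (Commute.refl _)
    simpa using congrArg Units.val this
  set y : R := 1 + h with hy
  have frob : y ^ q = 1 + (h : R) ^ q := by
    rw [hy, hq, add_pow_char_pow_of_commute 2 _ (Commute.one_left _), one_pow]
  have yqq : y ^ (q * q) = y := by
    have e1 : q * q = 2 ^ ((m + 1) + (m + 1)) := by rw [hq, ← pow_add]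
    rw [e1, hy, add_pow_char_pow_of_commute 2 _ (Commute.one_left _), one_pow, ← e1]
    congr 1
    obtain ⟨k, hk⟩ : ∃ k, q = k + 1 := ⟨q - 1, by omega⟩
    have : q * q = (q + 1) * k + 1 := by rw [hk]; ring
    rw [this, pow_succ, pow_mul, hh, one_pow, one_mul]
  obtain ⟨N, hN⟩ : ∃ N, q * q = N + 3 := ⟨q * q - 3, by have := Nat.mul_le_mul hq2 hq2; omega⟩
  rw [hN] at yqq
  set e := y ^ (N + 2) with he
  set w := y ^ (N + 1) with hw
  have yw : y * w = e := by rw [he, hw, ← pow_succ']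
  have ye : y * e = y := by rw [he, ← pow_succ', yqq]
  have ey : e * y = y := by rw [he, ← pow_succ, yqq]
  have wy : w * y = e := by rw [he, hw, ← pow_succ]
  have ew : e * w = w := by
    rw [hw, pow_succ', ← mul_assoc, ey]
  have we : w * e = w := by
    rw [hw, pow_succ, mul_assoc, ye]
  have ee : e * e = e := by
    nth_rewrite 1 [← wy]; rw [mul_assoc, ye, wy]
  have uv : (y + 1 + e) * (w + 1 + e) = 1 := by
    have : (y + 1 + e) * (w + 1 + e) =
        1 + (y + y) + (w + w) + (e + e) + (e + e) := by
      simp only [mul_add, add_mul, yw, ye, ew, ee, mul_one, one_mul]; abel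
    simp [this, add_self]
  have vu : (w + 1 + e) * (y + 1 + e) = 1 := by
    have : (w + 1 + e) * (y + 1 + e) =
        1 + (y + y) + (w + w) + (e + e) + (e + e) := by
      simp only [mul_add, add_mul, wy, ey, we, ee, mul_one, one_mul]; abel
    simp [this, add_self]
  have cy : Commute y (h : R) := (Commute.one_left _).add_left (Commute.refl _)
  have ce : Commute e (h : R) := cy.pow_left _
  have hu := H ⟨y + 1 + e, w + 1 + e, uv, vu⟩ (by
    apply Units.ext
    exact ((cy.add_left (Commute.one_left _)).add_left ce))
  have hu' : (y + 1 + e) ^ (q + 1) = 1 := by simpa using congrArg Units.val hu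
  have ue : (y + 1 + e) * e = y := by
    have : (y + 1 + e) * e = y + (e + e) := by
      simp only [add_mul, ye, ee, one_mul]; abel
    simp [this, add_self]
  have eu : e * (y + 1 + e) = y := by
    have : e * (y + 1 + e) = y + (e + e) := by
      simp only [mul_add, ey, ee, mul_one]; abel
    simp [this, add_self]
  have cc : Commute (y + 1 + e) e := by rw [Commute, SemiconjBy, ue, eu]
  have yq1 : y ^ (q + 1) = e := by
    have := cc.mul_pow (q + 1)
    rw [ue, hu', one_mul, IsIdempotentElem.pow_succ_eq q ee] at this
    exact this
  have yq2 : y ^ q * (y * y) = y := by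
    rw [← mul_assoc, ← pow_succ, yq1, ey]
  have yy : y * y = 1 + (h : R) * h := by
    have : y * y = 1 + (h : R) * h + (h + h) := by
      rw [hy]; simp only [mul_add, add_mul, mul_one, one_mul]; abel
    simp [this, add_self]
  have key : (h : R) * h + (h : R) ^ q = 0 := by
    have hqh : (h : R) ^ q * (h * h) = h := by
      rw [← mul_assoc, ← pow_succ, hh, one_mul]
    rw [frob, yy, hy] at yq2
    simp only [mul_add, add_mul, mul_one, one_mul, hqh] at yq2
    have : 1 + (h : R) + ((h : R) * h + (h : R) ^ q) = 1 + h + 0 := by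
      rw [add_zero]; refine Eq.trans ?_ yq2; abel
    exact add_left_cancel this
  have h3 : (h : R) * h = (h : R) ^ q := by
    rw [← sub_eq_zero, CharTwo.sub_eq_add, key]
  apply Units.ext
  push_cast
  rw [pow_succ, pow_two, h3, ← pow_succ, hh]

/-- Existence of a suitable trace. -/
theorem exists_trace (F : Type*) [Field F] [Fintype F] [CharP F 2]
    (hc : 2 < Fintype.card F) :
    ∃ t : F, t ≠ 1 ∧ ∀ a : F, a ^ 2 + t * a + 1 ≠ 0 := by
  classical
  have hsq : Function.Surjective (fun x : F => x ^ 2) := by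
    apply Finite.surjective_of_injective
    intro a b hab
    exact CharTwo.sq_injective hab
  let f : F →+ F :=
    { toFun := fun z => z ^ 2 + z
      map_zero' := by simp
      map_add' := fun a b => by rw [CharTwo.add_sq]; ring }
  have hker : 2 ≤ Nat.card f.ker := by
    have : ({0, 1} : Set F) ⊆ (f.ker : Set F) := by
      rintro x (rfl | rfl)
      · simp
      · simp [AddMonoidHom.mem_ker, f, CharTwo.add_self_eq_zero]
    have h2 := Set.ncard_le_ncard this (Set.toFinite _)
    rw [Set.ncard_pair zero_ne_one] at h2
    exact h2
  have hcard : Nat.card f.ker * Nat.card f.range = Fintype.card F := by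
    rw [← Nat.card_eq_fintype_card, ← AddSubgroup.card_mul_index f.ker, AddSubgroup.index_ker]
  obtain ⟨c, hc1, hcr⟩ : ∃ c : F, c ≠ 1 ∧ c ∉ f.range := by
    by_contra! hcon
    have hsub : (Set.univ : Set F) ⊆ insert 1 (f.range : Set F) := by
      intro x _
      by_cases hx : x = 1
      · left; exact hx
      · right; exact hcon x hx
    have h1 := Set.ncard_le_ncard hsub (Set.toFinite _)
    have h2 := Set.ncard_insert_le (1 : F) (f.range : Set F)
    rw [Set.ncard_univ, Nat.card_eq_fintype_card] at h1
    have h3 : (f.range : Set F).ncard = Nat.card f.range := rfl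
    have h4 := Nat.mul_le_mul_right (Nat.card f.range) hker
    omega
  have hc0 : c ≠ 0 := by rintro rfl; exact hcr (zero_mem _)
  obtain ⟨s, hs⟩ := hsq c
  simp only at hs
  have hs0 : s ≠ 0 := by rintro rfl; simp at hs; exact hc0 hs.symm
  refine ⟨s⁻¹, ?_, ?_⟩
  · intro h; rw [inv_eq_one] at h; subst h; simp at hs; exact hc1 hs.symm
  · intro a ha
    apply hcr
    refine ⟨s * a, ?_⟩
    show (s * a) ^ 2 + s * a = c
    rw [← hs, ← sub_eq_zero, CharTwo.sub_eq_add]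
    have : s ^ 2 * (a ^ 2 + s⁻¹ * a + 1) = 0 := by rw [ha, mul_zero]
    rw [← this]; field_simp

open Matrix in
theorem exists_elt (F : Type*) [Field F] [Fintype F] [CharP F 2]
    (hc : 2 < Fintype.card F) :
    ∃ A : Matrix.SpecialLinearGroup (Fin 2) F, A ^ 3 ≠ 1 ∧
      ∀ B, Commute B A → B ^ (Fintype.card F + 1) = 1 := by
  classical
  obtain ⟨t, ht1, hirr⟩ := exists_trace F hc
  obtain ⟨n, -, hcard⟩ := FiniteField.card F 2
  have two : (2 : F) = 0 := CharTwo.two_eq_zero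
  set q := Fintype.card F with hq
  let M : Matrix (Fin 2) (Fin 2) F := !![0, 1; 1, t]
  have hM2 : M * M = t • M + 1 := by
    ext i j; fin_cases i <;> fin_cases j <;> simp [M, Matrix.mul_apply, Fin.sum_univ_two] <;> ring
  have hself : ∀ x : F, x + x = 0 := CharTwo.add_self_eq_zero
  have : CharP (Matrix (Fin 2) (Fin 2) F) 2 := inferInstance
  have hform : ∀ k : ℕ, ∃ s : F, M ^ (2 ^ k) = t ^ (2 ^ k - 1) • M + s • (1 : Matrix (Fin 2) (Fin 2) F) := by
    intro k
    induction k with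
    | zero => exact ⟨0, by simp⟩
    | succ k ih =>
      obtain ⟨s, hs⟩ := ih
      refine ⟨(t ^ (2 ^ k - 1)) ^ 2 + s ^ 2, ?_⟩
      obtain ⟨j, hj⟩ : ∃ j, 2 ^ k = j + 1 := ⟨2 ^ k - 1, by have := Nat.one_le_two_pow (n := k); omega⟩
      have e : 2 ^ (k + 1) - 1 = 2 * j + 1 := by rw [pow_succ]; omega
      have e' : 2 ^ k - 1 = j := by omega
      rw [pow_succ 2 k, pow_mul, hs, pow_two, mul_comm (2 ^ k) 2, e']
      have e'' : 2 * 2 ^ k - 1 = 2 * j + 1 := by omega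
      rw [e'']
      simp only [mul_add, add_mul, smul_mul_smul, hM2, mul_one, one_mul, smul_add, smul_smul]
      ext a b
      simp only [Matrix.add_apply, Matrix.smul_apply, smul_eq_mul]
      linear_combination (t ^ j * s * M a b) * two
  obtain ⟨s, hs⟩ := hform n
  rw [← hcard] at hs
  have ht0 : t ≠ 0 := by
    rintro rfl
    exact hirr 1 (by simp [hself])
  rw [FiniteField.pow_card_sub_one_eq_one t ht0, one_smul] at hs
  -- Frobenius on combinations
  have hfrob : ∀ x z : F, ∀ P : Matrix (Fin 2) (Fin 2) F, 
      (x • (1 : Matrix (Fin 2) (Fin 2) F) + z • P) ^ q = x • 1 + z • P ^ q := by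
    intro x z P
    have hcom : Commute (x • (1 : Matrix (Fin 2) (Fin 2) F)) (z • P) :=
      ((Commute.one_left P).smul_left x).smul_right z
    have := add_pow_char_pow_of_commute 2 n hcom
    rw [← hcard] at this
    rw [this, smul_pow, smul_pow, one_pow, FiniteField.pow_card, FiniteField.pow_card]
  have hs2 : s ^ 2 = t * s := by
    have h1 : M ^ q * M ^ q = t • M ^ q + 1 := by
      rw [← (Commute.refl M).mul_pow, hM2]
      have := hfrob 1 t M
      rw [one_smul, add_comm] at this
      rw [this, add_comm]
    rw [hs] at h1
    have h2 := congrFun (congrFun h1 0) 0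
    simp [M, Matrix.mul_apply, Fin.sum_univ_two, -mul_eq_mul_right_iff] at h2
    linear_combination h2
  have hst : s = t := by
    have : s * (s - t) = 0 := by linear_combination hs2
    rcases mul_eq_zero.mp this with h0 | h0
    · exfalso
      rw [h0, zero_smul, add_zero] at hs
      have hdeg := FiniteField.X_pow_card_sub_X_natDegree_eq F (p := q) (by omega)
      have hmon : (Polynomial.X ^ q - Polynomial.X : Polynomial F).Monic := by
        apply Polynomial.monic_X_pow_sub
        rw [Polynomial.degree_X]; exact_mod_cast (by omega : 1 < q)
      have hp := Polynomial.prod_multiset_X_sub_C_of_monic_of_roots_card_eq hmon (by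
        rw [FiniteField.roots_X_pow_card_sub_X, hdeg]; rfl)
      rw [FiniteField.roots_X_pow_card_sub_X] at hp
      have hp' : ∏ a : F, (Polynomial.X - Polynomial.C a) = Polynomial.X ^ q - Polynomial.X := hp
      let D : Polynomial F →* F :=
        (Matrix.detMonoidHom).comp (Polynomial.aeval M : Polynomial F →ₐ[F] _).toMonoidHom
      have h1 := congrArg D hp'
      rw [map_prod] at h1
      have h2 : D (Polynomial.X ^ q - Polynomial.X) = 0 := by
        simp [D, hs]
      rw [h2, Finset.prod_eq_zero_iff] at h1
      obtain ⟨a, -, ha⟩ := h1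
      apply hirr a
      simp [D, M, Matrix.det_fin_two, Matrix.algebraMap_matrix_apply] at ha
      linear_combination ha + (t * a + 1) * two
    · exact sub_eq_zero.mp h0
  subst hst
  let A : Matrix.SpecialLinearGroup (Fin 2) F := ⟨M, by
    simp [M, Matrix.det_fin_two_of]
    rw [← sub_eq_zero]; linear_combination -two⟩
  refine ⟨A, ?_, ?_⟩
  · intro h3
    have h4 : M ^ 3 = 1 := congrArg Subtype.val h3
    rw [pow_succ, pow_two, hM2] at h4
    have h5 := congrFun (congrFun h4 0) 1
    simp [M, Matrix.mul_apply, Fin.sum_univ_two] at h5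
    have : (s + 1) ^ 2 = 0 := by linear_combination h5 + s * two
    have := pow_eq_zero_iff (two_ne_zero) |>.mp this
    exact ht1 (by linear_combination this - two)
  · intro B hB
    have hB' : B.1 * M = M * B.1 := congrArg Subtype.val hB.eq
    have hdet := B.2
    rw [Matrix.det_fin_two] at hdet
    have h00 := congrFun (congrFun hB' 0) 0
    have h01 := congrFun (congrFun hB' 0) 1
    simp [M, Matrix.mul_apply, Fin.sum_univ_two] at h00 h01
    have hBf : B.1 = B.1 0 0 • (1 : Matrix (Fin 2) (Fin 2) F) + B.1 0 1 • M := by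
      ext i j; fin_cases i <;> fin_cases j <;> simp [M]
      · exact h00.symm
      · linear_combination -h01
    apply Subtype.ext
    rw [Matrix.SpecialLinearGroup.coe_pow, pow_succ]
    have hpow : B.1 ^ q = B.1 0 0 • (1 : Matrix (Fin 2) (Fin 2) F) + B.1 0 1 • M ^ q := by
      nth_rewrite 1 [hBf]; exact hfrob _ _ _
    change B.1 ^ q * B.1 = 1
    rw [hpow, hs]
    have h11 : B.1 1 1 = B.1 0 0 + B.1 0 1 * s := by linear_combination -h01
    have h10 : B.1 1 0 = B.1 0 1 := h00.symm
    rw [h11, h10] at hdet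
    ext i j; fin_cases i <;> fin_cases j <;>
      simp [M, Matrix.mul_apply, Fin.sum_univ_two, h10, h11]
    all_goals grind

end SL2Aux

/-- Let `F` be a finite field of even cardinality. Then `SL₂(F)` is realizable
(there is a unital ring `R` with `Rˣ ≅ SL₂(F)`) if and only if `F` has exactly
2 elements. -/
theorem sl2_even_realizable_iff (F : Type*) [Field F] [Fintype F]
    (hF : Even (Fintype.card F)) :
    (∃ (R : Type u) (_ : Ring R),
        Nonempty (Rˣ ≃* Matrix.SpecialLinearGroup (Fin 2) F)) ↔
      Fintype.card F = 2 := by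
  classical
  constructor
  · rintro ⟨R, _, ⟨φ⟩⟩
    by_contra hne
    have hrc : ringChar F = 2 :=
      FiniteField.even_card_iff_char_two.mpr (Nat.even_iff.mp hF)
    have : CharP F 2 := ringChar.of_eq hrc
    have hlt : 2 < Fintype.card F := by
      have := Fintype.one_lt_card (α := F)
      omega
    obtain ⟨A, hA3, hA⟩ := SL2Aux.exists_elt F hlt
    obtain ⟨n, -, hcard⟩ := FiniteField.card F 2
    apply hA3
    have := SL2Aux.cube_eq_one (n : ℕ) n.ne_zero (φ.symm A) (by
      intro v hv
      apply φ.injective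
      rw [map_pow, map_one, ← hcard]
      apply hA
      have := hv.map φ
      simpa using this)
    have := congrArg φ this
    simpa using this
  · intro h2
    let K := ULift.{u} (ZMod 2)
    have hK : Fintype.card K = 2 := by simp [K]
    have : Fact (Nat.Prime 2) := ⟨Nat.prime_two⟩
    let σ : K ≃+* F := ULift.ringEquiv.trans (ZMod.ringEquivOfPrime F Nat.prime_two h2)
    refine ⟨Matrix (Fin 2) (Fin 2) K, inferInstance, ⟨?_⟩⟩
    refine (Units.mapEquiv (σ.mapMatrix (m := Fin 2)).toMulEquiv).trans ?_
    refine (MulEquiv.ofBijective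
      (Matrix.SpecialLinearGroup.toGL : Matrix.SpecialLinearGroup (Fin 2) F →* _) ⟨?_, ?_⟩).symm
    · exact Matrix.SpecialLinearGroup.toGL_injective
    · intro g
      have hu : Fintype.card Fˣ = 1 := by rw [Fintype.card_units, h2]
      have : Subsingleton Fˣ := Fintype.card_le_one_iff_subsingleton.mp hu.le
      refine ⟨⟨g.1, ?_⟩, ?_⟩
      · have : Matrix.GeneralLinearGroup.det g = 1 := Subsingleton.elim _ _
        exact congrArg Units.val this
      · apply Units.ext; rfl
end

section
/- Let F be a finite field whose cardinality q is odd and satisfies q ≡ 1 (mod 8) or q ≡ -1 (mod 8). Then SL_2(F) is not realizable: there is no unital ring R with R^× isomorphic to SL_2(F). -/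
universe u

open Matrix in
/-- The only solutions of `g ^ 2 = 1` in `SL₂(F)` are `1` and `-1`. -/
lemma sl2_involution {F : Type*} [Field F] (h2 : (2 : F) ≠ 0)
    (g : Matrix.SpecialLinearGroup (Fin 2) F) (hg : g * g = 1) : g = 1 ∨ g = -1 := by
  have hd := g.det_coe
  have hm : g.1 * g.1 = 1 := congrArg Subtype.val hg
  rw [Matrix.det_fin_two] at hd
  have h00 := congrFun (congrFun hm 0) 0
  have h01 := congrFun (congrFun hm 0) 1
  have h10 := congrFun (congrFun hm 1) 0
  have h11 := congrFun (congrFun hm 1) 1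
  simp only [Matrix.mul_apply, Fin.sum_univ_two, Matrix.one_apply] at h00 h01 h10 h11
  simp at h00 h01 h10 h11
  generalize hp : g.1 0 0 = p at *
  generalize hq : g.1 0 1 = q at *
  generalize hr : g.1 1 0 = r at *
  generalize hs : g.1 1 1 = s at *
  have hps : p + s ≠ 0 := by
    intro h
    apply h2
    linear_combination p * h - h00 - hd
  have hq0 : q = 0 := by
    have : q * (p + s) = 0 := by linear_combination h01
    exact (mul_eq_zero.mp this).resolve_right hps
  have hr0 : r = 0 := by
    have : r * (p + s) = 0 := by linear_combination h10
    exact (mul_eq_zero.mp this).resolve_right hps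
  subst hq0 hr0
  have hp1 : p * p = 1 := by linear_combination h00
  rcases mul_self_eq_one_iff.mp hp1 with h | h
  · left
    have : s = 1 := by rw [h] at hd; linear_combination hd
    ext i j
    fin_cases i <;> fin_cases j <;> simp [hp, hq, hr, hs, h, this]
  · right
    have : s = -1 := by rw [h] at hd; linear_combination -hd
    ext i j
    fin_cases i <;> fin_cases j <;> simp [hp, hq, hr, hs, h, this]

/-- If `2` is a square, `SL₂(F)` contains `x, y` with `x⁴ = -1`, `y x = x⁻¹ y`, whose common
centralizer is `{1, -1}`. -/
lemma sl2_exists_quaternion {F : Type*} [Field F] [Finite F] (h2 : (2 : F) ≠ 0)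
    (hsq : IsSquare (2 : F)) :
    ∃ x y : Matrix.SpecialLinearGroup (Fin 2) F, x * x * (x * x) = -1 ∧ x * y * x = y ∧
      ∀ g : Matrix.SpecialLinearGroup (Fin 2) F, g * x = x * g → g * y = y * g →
        g = 1 ∨ g = -1 := by
  obtain ⟨t, ht⟩ := hsq
  obtain ⟨A, B, hAB⟩ : ∃ A B : F, A ^ 2 + B ^ 2 = -1 := by
    cases nonempty_fintype F
    have hchar : Fintype.card F % 2 = 1 := by
      apply FiniteField.odd_card_of_char_ne_two
      intro hc
      have : CharP F 2 := by rw [← hc]; exact ringChar.charP F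
      exact h2 (by exact_mod_cast CharP.cast_eq_zero F 2)
    have hd1 : (Polynomial.X ^ 2 : Polynomial F).degree = 2 := by simp
    have hd2 : (Polynomial.X ^ 2 - Polynomial.C (-1) : Polynomial F).degree = 2 :=
      Polynomial.degree_X_pow_sub_C (by norm_num) _
    obtain ⟨a, b, hab⟩ := FiniteField.exists_root_sum_quadratic hd1 hd2 hchar
    simp at hab
    exact ⟨a, b, by linear_combination hab⟩
  refine ⟨⟨!![t, -1; 1, 0], by simp [Matrix.det_fin_two]⟩,
    ⟨!![A - B, t * B; t * A, B - A], ?_⟩, ?_, ?_, ?_⟩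
  · rw [Matrix.det_fin_two_of]
    linear_combination -hAB + A * B * ht
  · apply Subtype.ext
    change !![t, -1; 1, 0] * !![t, -1; 1, 0] * (!![t, -1; 1, 0] * !![t, -1; 1, 0]) =
      -(1 : Matrix (Fin 2) (Fin 2) F)
    ext i j
    fin_cases i <;> fin_cases j <;> simp [Matrix.mul_apply, Fin.sum_univ_two] <;> grind
  · apply Subtype.ext
    change !![t, -1; 1, 0] * !![A - B, t * B; t * A, B - A] * !![t, -1; 1, 0] =
      !![A - B, t * B; t * A, B - A]
    ext i j
    fin_cases i <;> fin_cases j <;> simp [Matrix.mul_apply, Fin.sum_univ_two] <;> grind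
  · intro g hx hy
    have hx' : g.1 * !![t, -1; 1, 0] = !![t, -1; 1, 0] * g.1 := congrArg Subtype.val hx
    have hy' : g.1 * !![A - B, t * B; t * A, B - A] = !![A - B, t * B; t * A, B - A] * g.1 :=
      congrArg Subtype.val hy
    apply sl2_involution h2
    have hd := g.det_coe
    rw [Matrix.det_fin_two] at hd
    have x01 := congrFun (congrFun hx' 0) 1
    have x11 := congrFun (congrFun hx' 1) 1
    have y01 := congrFun (congrFun hy' 0) 1
    have y10 := congrFun (congrFun hy' 1) 0
    simp [Matrix.mul_apply, Fin.sum_univ_two] at x01 x11 y01 y10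
    apply Subtype.ext
    change g.1 * g.1 = 1
    generalize hp : g.1 0 0 = p at *
    generalize hq : g.1 0 1 = q at *
    generalize hr : g.1 1 0 = r at *
    generalize hs : g.1 1 1 = s at *
    have hs' : s = p + t * q := by linear_combination x01
    have hr' : r = -q := by linear_combination -x11
    subst hs' hr'
    have e1 : 2 * (q * A) = 0 := by linear_combination -y01 + q * B * ht
    have e2 : 2 * (q * B) = 0 := by linear_combination y10 + q * A * ht
    have e1' := (mul_eq_zero.mp e1).resolve_left h2
    have e2' := (mul_eq_zero.mp e2).resolve_left h2
    have hq0 : q = 0 := by linear_combination q * hAB - A * e1' - B * e2'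
    subst hq0
    ext i j
    fin_cases i <;> fin_cases j <;> simp [Matrix.mul_apply, Fin.sum_univ_two, hp, hq, hr, hs] <;>
      linear_combination hd

/-- Let `F` be a finite field of odd cardinality `q` with `q ≡ ±1 (mod 8)`.
Then `SL₂(F)` is not realizable: no unital ring has unit group isomorphic to it. -/
theorem sl2_pm_one_mod_eight_not_realizable (F : Type*) [Field F] [Fintype F]
    (hodd : Odd (Fintype.card F))
    (h8 : (Fintype.card F : ZMod 8) = 1 ∨ (Fintype.card F : ZMod 8) = -1) :
    ∀ (R : Type u) [Ring R],
      ¬ Nonempty (Rˣ ≃* Matrix.SpecialLinearGroup (Fin 2) F) := by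
  rintro R _ ⟨f⟩
  have hmod : Fintype.card F % 8 = 1 ∨ Fintype.card F % 8 = 7 := by
    rcases h8 with h | h
    · left
      have : ((Fintype.card F : ℕ) : ZMod 8) = ((1 : ℕ) : ZMod 8) := by simpa using h
      exact (ZMod.natCast_eq_natCast_iff' _ _ _).mp this
    · right
      have : ((Fintype.card F : ℕ) : ZMod 8) = ((7 : ℕ) : ZMod 8) := by rw [h]; decide
      exact (ZMod.natCast_eq_natCast_iff' _ _ _).mp this
  have hsq : IsSquare (2 : F) := by
    rw [FiniteField.isSquare_two_iff]; omega
  have h2 : (2 : F) ≠ 0 := by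
    apply Ring.two_ne_zero
    intro hc
    have := FiniteField.even_card_iff_char_two.mp hc
    omega
  obtain ⟨x, y, hx, hxy, hcen⟩ := sl2_exists_quaternion h2 hsq
  -- transfer to units of `R`
  obtain ⟨z, hz⟩ : ∃ z : Rˣ, f z = -1 := f.surjective _
  obtain ⟨X, rfl⟩ := f.surjective x
  obtain ⟨Y, rfl⟩ := f.surjective y
  have hX : X * X * (X * X) = z := f.injective (by simp only [map_mul, hx, hz])
  have hXY : X * Y * X = Y := f.injective (by simp only [map_mul, hxy])
  have hz1 : z ≠ 1 := by
    intro h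
    rw [h, map_one] at hz
    have := congrArg (fun g : Matrix.SpecialLinearGroup (Fin 2) F => g.1 0 0) hz
    simp at this
    apply h2
    linear_combination this
  have hzz : z * z = 1 := f.injective (by simp [hz])
  have hinv : ∀ g : Rˣ, g * g = 1 → g = 1 ∨ g = z := by
    intro g hg
    have := sl2_involution h2 (f g) (by rw [← map_mul, hg, map_one])
    rcases this with h | h
    · left; exact f.injective (by rw [h, map_one])
    · right; exact f.injective (by rw [h, hz])
  have hcen' : ∀ g : Rˣ, g * X = X * g → g * Y = Y * g → g = 1 ∨ g = z := by
    intro g h1 h3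
    rcases hcen (f g) (by simp only [← map_mul, h1]) (by simp only [← map_mul, h3]) with h | h
    · left; exact f.injective (by rw [h, map_one])
    · right; exact f.injective (by rw [h, hz])
  by_cases hm : (-1 : R) = 1
  · -- characteristic two
    have h2R : (2 : R) = 0 := by
      have : (2 : R) = 1 - (-1) := by norm_num
      rw [this, hm, sub_self]
    have hinvR : ∀ w : R, w * w = 0 → w = 0 ∨ w = z - 1 := by
      intro w hw
      have h1 : (1 + w) * (1 + w) = 1 := by
        have : (1 + w) * (1 + w) = 1 + 2 * w + w * w := by noncomm_ring
        rw [this, h2R, hw]; simp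
      rcases hinv ⟨1 + w, 1 + w, h1, h1⟩ (Units.ext h1) with h | h
      · left
        have := congrArg Units.val h
        simpa using this
      · right
        have : 1 + w = z := congrArg Units.val h
        rw [← this]; abel
    obtain ⟨v, hv⟩ : ∃ v : R, v = 1 + X := ⟨_, rfl⟩
    have hX4 : (X : R) * X * (X * X) = z := congrArg Units.val hX
    have hzz' : (z : R) * z = 1 := congrArg Units.val hzz
    have hn : v ^ 4 = z - 1 := by
      have e : v ^ 4 = (X : R) * X * (X * X) - 1 +
          2 * (1 + 2 * (X : R) + 3 * X ^ 2 + 2 * X ^ 3) := by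
        rw [hv]; noncomm_ring
      rw [e, h2R, hX4]; simp
    have hn0 : v ^ 4 ≠ 0 := by
      rw [hn]
      intro h
      exact hz1 (Units.ext (sub_eq_zero.mp h))
    have hv8 : v ^ 8 = 0 := by
      have : v ^ 8 = (v ^ 4) * (v ^ 4) := by rw [← pow_add]
      rw [this, hn]
      have : ((z : R) - 1) * (z - 1) = z * z - 1 + 2 * (1 - z) := by noncomm_ring
      rw [this, hzz', h2R]; simp
    -- cancelling the unit `1 + v`
    have hcancel : ∀ k, v ^ k = v ^ (k + 1) → v ^ k = 0 := by
      intro k hk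
      have h1 : v ^ k * X = 0 := by
        have : (X : R) = v - 1 := by rw [hv]; abel
        rw [this, mul_sub, mul_one, ← pow_succ, ← hk, sub_self]
      exact (Units.mul_left_eq_zero X).mp h1
    have hv5 : v ^ 5 = 0 := by
      rcases hinvR (v ^ 5) (by rw [← pow_add]; exact pow_eq_zero_of_le (by norm_num) hv8) with h | h
      · exact h
      · exact absurd (hcancel 4 (by rw [h, hn])) hn0
    rcases hinvR (v ^ 3) (by rw [← pow_add]; exact pow_eq_zero_of_le (by norm_num) hv5) with h | h
    · exact hn0 (pow_eq_zero_of_le (by norm_num) h)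
    · exact hn0 (pow_eq_zero_of_le (by norm_num) (hcancel 3 (by rw [h, hn])))
  · -- `-1 ≠ 1`, so `z = -1`
    have hzm : z = -1 := by
      rcases hinv (-1) (by simp) with h | h
      · exact absurd (congrArg Units.val h) (by simpa using hm)
      · exact h.symm
    subst hzm
    have h2R : (2 : R) ≠ 0 := by
      intro h
      apply hm
      have : (1 : R) + 1 = 0 := by rw [one_add_one_eq_two]; exact h
      exact neg_eq_of_add_eq_zero_left this
    have hX4 : (X : R) * X * (X * X) = -1 := congrArg Units.val hX
    have hXYR : (X : R) * Y * X = Y := congrArg Units.val hXY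
    obtain ⟨a, ha⟩ : ∃ a : R, a = X := ⟨_, rfl⟩
    rw [← ha] at hX4 hXYR
    have ha4 : a ^ 4 = -1 := by rw [← hX4]; noncomm_ring
    -- `X⁻¹ = -a³`, `s = X + X⁻¹ = a - a³`
    obtain ⟨s, hs⟩ : ∃ s : R, s = a - a ^ 3 := ⟨_, rfl⟩
    have hss : s * s = 2 := by
      have : s * s = a ^ 2 - 2 * a ^ 4 + a ^ 4 * a ^ 2 := by rw [hs]; noncomm_ring
      rw [this, ha4]; simp
    have h1 : (1 + s) * (s - 1) = 1 := by
      have : (1 + s) * (s - 1) = s * s - 1 := by noncomm_ring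
      rw [this, hss]; norm_num
    have h1' : (s - 1) * (1 + s) = 1 := by
      have : (s - 1) * (1 + s) = s * s - 1 := by noncomm_ring
      rw [this, hss]; norm_num
    have hsX : (1 + s) * (X : R) = X * (1 + s) := by
      rw [← ha, hs]; noncomm_ring
    have hsY : (1 + s) * (Y : R) = Y * (1 + s) := by
      have e1 : (Y : R) * a = -(a ^ 3 * Y) := by
        have : a ^ 3 * (a * Y * a) = a ^ 4 * (Y * a) := by noncomm_ring
        rw [hXYR, ha4] at this
        rw [this]; simp
      have e2 : a * (Y : R) = -(Y * a ^ 3) := by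
        have : (a * Y * a) * a ^ 3 = a * Y * a ^ 4 := by noncomm_ring
        rw [hXYR, ha4] at this
        rw [this]; simp
      have : s * (Y : R) = Y * s := by
        rw [hs, sub_mul, mul_sub, e1, e2]; abel
      rw [add_mul, mul_add, this, one_mul, mul_one]
    rcases hcen' ⟨1 + s, s - 1, h1, h1'⟩ (Units.ext hsX) (Units.ext hsY) with h | h
    · have : s = 0 := by simpa using congrArg Units.val h
      apply h2R
      rw [← hss, this, mul_zero]
    · have : 1 + s = -1 := congrArg Units.val h
      have hs2 : s = -2 := by
        have : s = (1 + s) - 1 := by abel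
        rw [this, ‹1 + s = -1›]; norm_num
      apply h2R
      rw [hs2] at hss
      have e : (2 : R) = (-2) * (-2) - 2 := by norm_num
      rw [e, hss, sub_self]
end

section
/- Let F be a finite field whose cardinality q is odd and satisfies q ≡ 3 (mod 8) or q ≡ -3 (mod 8). Then SL_2(F) is not the group of units of any finite ring: there is no finite unital ring R with R^× isomorphic to SL_2(F). -/
universe u

/-- Endgame in characteristic dividing `4`. -/
theorem aux_four {R : Type u} [Ring R] (z i j w : R) (zu iu ju wu : Rˣ)
    (hz : (zu : R) = z) (hi : (iu : R) = i) (hj : (ju : R) = j) (hw : (wu : R) = w)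
    (huniq : ∀ v : Rˣ, (v : R) * v = 1 → (v : R) = 1 ∨ (v : R) = z)
    (hz1 : z ≠ 1) (hzz : z * z = 1) (hcomm : ∀ v : Rˣ, z * v = v * z)
    (hjj : j * j = z) (hwww : w * w * w = 1)
    (hwi : w * i = j * w) (hwj : w * j = i * j * w)
    (h4 : (4 : R) = 0) (hc : (2 : R) = 0 ∨ z = -1) : False := by
  obtain ⟨t, ht⟩ : ∃ t, t = z - 1 := ⟨_, rfl⟩
  have hzt : z = 1 + t := by rw [ht]; abel
  have ht0 : t ≠ 0 := fun h => hz1 (by rw [hzt, h, add_zero])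
  have htc : ∀ v : Rˣ, t * v = v * t := fun v => by
    rw [ht, sub_mul, mul_sub, hcomm v]; simp
  have h2t : (2 : R) * t = 0 := by
    rcases hc with h | h
    · rw [h, zero_mul]
    · rw [ht, h]; calc (2 : R) * (-1 - 1) = -4 := by norm_num
        _ = 0 := by rw [h4, neg_zero]
  have htt : t * t = 0 := by
    have : t * t = -(2 * t) := by
      have : (1 + t) * (1 + t) = 1 := by rw [← hzt, hzz]
      have h3 : t * t + 2 * t = (1 + t) * (1 + t) - 1 := by noncomm_ring
      rw [this, sub_self] at h3
      exact eq_neg_of_add_eq_zero_left h3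
    rw [this, h2t, neg_zero]
  have htu : ∀ v : Rˣ, t * v = t := fun v => by
    have hsq : (t * v) * (t * v) = 0 := by
      calc (t * v) * (t * v) = (t * v) * (v * t) := by rw [htc v]
        _ = t * ((v * v : Rˣ) : R) * t := by rw [Units.val_mul]; simp only [mul_assoc]
        _ = 0 := by rw [htc, mul_assoc, htt, mul_zero]
    have h2 : t * v + t * v = 0 := by
      rw [← two_mul, ← mul_assoc, h2t, zero_mul]
    have hs : (1 + t * v) * (1 + t * v) = 1 := by
      calc (1 + t * v) * (1 + t * v) = 1 + (t * v + t * v) + (t * v) * (t * v) := by noncomm_ring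
        _ = 1 := by rw [h2, hsq]; simp
    rcases huniq ⟨1 + t * v, 1 + t * v, hs, hs⟩ hs with h | h
    · exfalso
      have h' : t * v = 0 := by simpa using h
      exact ht0 (by simpa using h')
    · have h' : 1 + t * v = 1 + t := by rw [← hzt]; exact h
      exact add_left_cancel h'
  have key : ∀ y : R, y * y = 0 → y = 0 ∨ y = t := fun y hy => by
    have e1 : (1 + y) * (1 - y) = 1 := by
      calc (1 + y) * (1 - y) = 1 - y * y := by noncomm_ring
        _ = 1 := by rw [hy, sub_zero]
    have e2 : (1 - y) * (1 + y) = 1 := by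
      calc (1 - y) * (1 + y) = 1 - y * y := by noncomm_ring
        _ = 1 := by rw [hy, sub_zero]
    have h1 : t * (1 + y) = t := htu ⟨1 + y, 1 - y, e1, e2⟩
    have hty : t * y = 0 := by simpa [mul_add] using h1
    have h2y : y + y = 0 := by
      rw [← two_mul]
      rcases hc with h | h
      · rw [h, zero_mul]
      · have : t = -2 := by rw [ht, h]; norm_num
        rw [this] at hty
        simpa using hty
    have hs : (1 + y) * (1 + y) = 1 := by
      calc (1 + y) * (1 + y) = 1 + (y + y) + y * y := by noncomm_ring
        _ = 1 := by rw [h2y, hy]; simp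
    rcases huniq ⟨1 + y, 1 + y, hs, hs⟩ hs with h | h
    · left; simpa using h
    · right
      have h' : 1 + y = 1 + t := by rw [← hzt]; exact h
      exact add_left_cancel h'
  obtain ⟨f, hf⟩ : ∃ f, f = -(1 + w + w * w) := ⟨_, rfl⟩
  have htw : t * w = t := by rw [← hw]; exact htu wu
  have htf : t * f = t := by
    calc t * f = -(t + t * w + t * w * w) := by rw [hf]; noncomm_ring
      _ = -(2 * t) - t := by rw [htw, htw]; noncomm_ring
      _ = -(2 * t) - 2 * t + t := by noncomm_ring
      _ = t := by rw [h2t]; simp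
  have hfw : f * w = f := by
    calc f * w = -(w + w * w + w * w * w) := by rw [hf]; noncomm_ring
      _ = f := by rw [hwww, hf]; abel
  have hff : f * f = f := by
    calc f * f = -(f + f * w + f * w * w) := by
          conv_lhs => rw [hf]
          rw [hf]; noncomm_ring
      _ = -(4 * f) + f := by rw [hfw, hfw]; noncomm_ring
      _ = f := by rw [h4]; simp
  have hft : f * t = t := by
    have : t * w = w * t := by rw [← hw]; exact htc wu
    rw [← htf]
    conv_rhs => rw [htf]
    have hcm : f * t = t * f := by
      calc f * t = -(t + w * t + w * (w * t)) := by rw [hf]; noncomm_ring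
        _ = -(t + t * w + t * w * w) := by rw [← this, ← mul_assoc, ← this]
        _ = t * f := by rw [hf]; noncomm_ring
    rw [htf, hcm, htf]
  have hg1 : (1 - f) * f = 0 := by rw [sub_mul, one_mul, hff, sub_self]
  have hg2 : f * (1 - f) = 0 := by rw [mul_sub, mul_one, hff, sub_self]
  have hcent : ∀ x, f * x = x * f := fun x => by
    have h1 : f * x * (1 - f) = 0 := by
      have hs : (f * x * (1 - f)) * (f * x * (1 - f)) = 0 := by
        calc (f * x * (1 - f)) * (f * x * (1 - f))
            = f * x * ((1 - f) * f) * (x * (1 - f)) := by simp only [mul_assoc]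
          _ = 0 := by rw [hg1]; simp
      rcases key _ hs with h | h
      · exact h
      · exfalso
        apply ht0
        have : t * f = 0 := by rw [← h, mul_assoc, hg1, mul_zero]
        rw [← htf, this]
    have h2 : (1 - f) * x * f = 0 := by
      have hs : ((1 - f) * x * f) * ((1 - f) * x * f) = 0 := by
        calc ((1 - f) * x * f) * ((1 - f) * x * f)
            = (1 - f) * x * (f * (1 - f)) * (x * f) := by simp only [mul_assoc]
          _ = 0 := by rw [hg2]; simp
      rcases key _ hs with h | h
      · exact h
      · exfalso
        apply ht0
        have : f * t = 0 := by rw [← h, ← mul_assoc, ← mul_assoc, hg2, zero_mul, zero_mul]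
        rw [← hft, this]
    have h3 : f * x - x * f = f * x * (1 - f) - (1 - f) * x * f := by noncomm_ring
    rw [h1, h2, sub_zero] at h3
    exact sub_eq_zero.mp h3
  have conj : ∀ x y, w * x = y * w → f * x = f * y := fun x y h => by
    calc f * x = f * (w * x) := by rw [← mul_assoc, hfw]
      _ = y * (f * w) := by rw [h, ← mul_assoc, hcent y, mul_assoc]
      _ = f * y := by rw [hfw, hcent y]
  have c1 := conj _ _ hwi
  have c2 := conj _ _ hwj
  have hfi : f * i = f := by
    have : (f * i) * ju = f * ju := by rw [hj, mul_assoc, ← c2]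
    exact (Units.mul_left_inj ju).mp this
  have hfz : f * z = f := by
    rw [← hjj, ← mul_assoc, ← c1, hfi, ← c1, hfi]
  apply ht0
  rw [← hft, ht, mul_sub, hfz, mul_one, sub_self]

theorem aux_num (n : ℕ) (h0 : n ≠ 0) (h4 : ¬ 4 ∣ n) :
    ∃ a b : ℕ, n ∣ a ^ 2 + b ^ 2 + 1 := by
  obtain ⟨r, m, s, hr4, hrn⟩ : ∃ r m s : ℤ, r = 4 * s + 1 ∧ r = n * m - 1 := by
    rcases Nat.even_or_odd' n with ⟨k, hk | hk⟩
    · have : k % 2 = 1 := by omega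
      exact ⟨n - 1, 1, k / 2, by omega, by ring⟩
    · refine ⟨n * (2 * n) - 1, 2 * n, 2 * k ^ 2 + 2 * k, ?_, by ring⟩
      subst hk; push_cast; ring
  have hcop : IsCoprime r ((4 * n : ℕ) : ℤ) := by
    push_cast
    apply IsCoprime.mul_right
    · exact ⟨1, -s, by rw [hr4]; ring⟩
    · exact ⟨-1, m, by rw [hrn]; ring⟩
  obtain ⟨p, -, hp, hpr⟩ := Nat.forall_exists_prime_gt_and_zmodEq 0 (by omega) hcop
  have hd := hpr.dvd
  push_cast at hd
  have h4d : (4 : ℤ) ∣ r - p := (Dvd.intro _ rfl).trans hd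
  have hnd : (n : ℤ) ∣ r - p := (Dvd.intro_left _ rfl).trans hd
  have := Fact.mk hp
  obtain ⟨a, b, hab⟩ := Nat.Prime.sq_add_sq (p := p) (by omega)
  refine ⟨a, b, ?_⟩
  rw [hab]
  have : (n : ℤ) ∣ ((p + 1 : ℕ) : ℤ) := by
    have h := (Dvd.intro m rfl : (n : ℤ) ∣ n * m).sub hnd
    have e : (n : ℤ) * m - (r - p) = ((p + 1 : ℕ) : ℤ) := by rw [hrn]; push_cast; ring
    rwa [e] at h
  exact_mod_cast this

theorem aux_ring {R : Type u} [Ring R] [Finite R] (z i j w : Rˣ)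
    (huniq : ∀ v : Rˣ, v * v = 1 → v = 1 ∨ v = z)
    (hz1 : z ≠ 1) (hzz : z * z = 1) (hcomm : ∀ v : Rˣ, z * v = v * z)
    (hii : i * i = z) (hjj : j * j = z) (hij : i * j = z * (j * i)) (hwww : w * w * w = 1)
    (hwi : w * i = j * w) (hwj : w * j = i * j * w) : False := by
  have huniq' : ∀ v : Rˣ, (v : R) * v = 1 → (v : R) = 1 ∨ (v : R) = z := fun v hv => by
    rcases huniq v (Units.ext hv) with h | h <;> simp [h]
  have hmain : (4 : R) = 0 → ((2 : R) = 0 ∨ (z : R) = -1) → False := fun a b =>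
    aux_four (z : R) i j w z i j w rfl rfl rfl rfl huniq'
      (fun h => hz1 (Units.ext h)) (by rw [← Units.val_mul, hzz, Units.val_one])
      (fun v => by exact_mod_cast congrArg Units.val (hcomm v))
      (by exact_mod_cast congrArg Units.val hjj) (by rw [← Units.val_mul, ← Units.val_mul, hwww, Units.val_one])
      (by exact_mod_cast congrArg Units.val hwi) (by exact_mod_cast congrArg Units.val hwj) a b
  by_cases h2 : (2 : R) = 0
  · exact hmain (by rw [show (4 : R) = 2 * 2 by norm_num, h2, zero_mul]) (Or.inl h2)
  have hzm : (z : R) = -1 := by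
    rcases huniq' (-1) (by simp) with h | h
    · exfalso; apply h2
      have h' : (-1 : R) = 1 := by simpa using h
      calc (2 : R) = 1 + 1 := by norm_num
        _ = 1 + -1 := by rw [h']
        _ = 0 := by simp
    · rw [← h]; simp
  obtain ⟨n, hn⟩ := CharP.exists R
  have hn0 : n ≠ 0 := CharP.char_ne_zero_of_finite R n
  have hn2 : ¬ n ∣ 2 := fun h => h2 (by exact_mod_cast (CharP.cast_eq_zero_iff R n 2).mpr h)
  by_cases h4 : 4 ∣ n
  · apply hmain _ (Or.inr hzm)
    obtain ⟨m, rfl⟩ := h4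
    have hs : (1 + ((2 * m : ℕ) : R)) * (1 + ((2 * m : ℕ) : R)) = 1 := by
      have e : (1 + 2 * m) * (1 + 2 * m) = 1 + 4 * m * (1 + m) := by ring
      have e' := congrArg (Nat.cast : ℕ → R) e
      rw [Nat.cast_add 1 (4 * m * (1 + m)), Nat.cast_mul (4 * m),
        CharP.cast_eq_zero R (4 * m)] at e'
      simpa using e'
    rcases huniq' ⟨_, _, hs, hs⟩ hs with h | h
    · exfalso
      have h' : ((2 * m : ℕ) : R) = 0 := by simpa using h
      rw [CharP.cast_eq_zero_iff R (4 * m)] at h'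
      have := Nat.le_of_dvd (by omega) h'
      omega
    · have h' : 1 + ((2 * m : ℕ) : R) = -1 := by rw [← hzm]; exact h
      have h'' : ((2 * m + 2 : ℕ) : R) = 0 := by
        rw [Nat.cast_add]
        calc ((2 * m : ℕ) : R) + (2 : ℕ) = (1 + ((2 * m : ℕ) : R)) + 1 := by
              push_cast; rw [show (2 : R) = 1 + 1 by norm_num]; abel
          _ = 0 := by rw [h']; simp
      rw [CharP.cast_eq_zero_iff R (4 * m)] at h''
      have := Nat.le_of_dvd (by omega) h''
      have hm : m = 1 := by omega
      subst hm
      have := CharP.cast_eq_zero R (4 * 1)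
      simpa using this
  · obtain ⟨a, b, hab⟩ := aux_num n hn0 h4
    have hab' : (a : R) * a + (b : R) * b = -1 := by
      have := (CharP.cast_eq_zero_iff R n _).mpr hab
      push_cast at this
      rw [← sq, ← sq]
      exact eq_neg_of_add_eq_zero_left this
    have Hii : (i : R) * i = -1 := by rw [← hzm, ← hii]; simp
    have Hjj : (j : R) * j = -1 := by rw [← hzm, ← hjj]; simp
    have Hij : (i : R) * j = -(j * i) := by
      have := congrArg Units.val hij
      push_cast at this
      rw [this, hzm]; simp
    have ci : ∀ x : R, x * a = a * x := fun x => (Nat.cast_commute a x).symm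
    have cj : ∀ x : R, x * b = b * x := fun x => (Nat.cast_commute b x).symm
    obtain ⟨x, hx⟩ : ∃ x : R, x = a * i + b * j := ⟨_, rfl⟩
    have hxx : x * x = 1 := by
      calc x * x = a * (i * a) * i + a * (i * b) * j + b * (j * a) * i + b * (j * b) * j := by
            rw [hx]; noncomm_ring
        _ = a * a * (i * i) + a * b * (i * j) + b * a * (j * i) + b * b * (j * j) := by
            rw [ci, cj, ci, cj]; noncomm_ring
        _ = -(a * a + b * b) := by rw [Hii, Hjj, Hij, cj (a : R)]; noncomm_ring
        _ = 1 := by rw [hab', neg_neg]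
    have hxc : ∀ y : R, x * y = y * x := fun y => by
      rcases huniq' ⟨x, x, hxx, hxx⟩ hxx with h | h
      · have h' : x = 1 := h
        rw [h']; simp
      · have h' : x = -1 := by rw [← hzm]; exact h
        rw [h']; simp
    have hb : (2 : R) * b = 0 := by
      have h := hxc i
      have e : x * i - i * x = 2 * b * (j * i) := by
        calc x * i - i * x = a * i * i + b * (j * i) - (i * a) * i - (i * b) * j := by
              rw [hx]; noncomm_ring
          _ = b * (j * i) - b * (i * j) := by rw [ci, cj]; noncomm_ring
          _ = _ := by rw [Hij]; noncomm_ring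
      rw [h, sub_self] at e
      have e' : (2 : R) * b * ((j * i : Rˣ) : R) = 0 := by rw [Units.val_mul]; exact e.symm
      exact (Units.mul_left_eq_zero _).mp e'
    have ha : (2 : R) * a = 0 := by
      have h := hxc j
      have e : x * j - j * x = -(2 * a * (j * i)) := by
        calc x * j - j * x = b * j * j + a * (i * j) - (j * a) * i - (j * b) * j := by
              rw [hx]; noncomm_ring
          _ = a * (i * j) - a * (j * i) := by rw [ci, cj]; noncomm_ring
          _ = _ := by rw [Hij]; noncomm_ring
      rw [h, sub_self] at e
      have e' : (2 : R) * a * ((j * i : Rˣ) : R) = 0 := by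
        rw [Units.val_mul]; exact neg_eq_zero.mp e.symm
      exact (Units.mul_left_eq_zero _).mp e'
    apply h2
    calc (2 : R) = -(2 * -1) := by norm_num
      _ = -(2 * a * a + 2 * b * b) := by rw [← hab']; noncomm_ring
      _ = 0 := by rw [ha, hb]; simp

/-- Let `F` be a finite field of odd cardinality `q` with `q ≡ ±3 (mod 8)`.
Then `SL₂(F)` is not the group of units of any finite unital ring. -/
theorem sl2_pm_three_mod_eight_not_realizable_finite (F : Type*) [Field F] [Fintype F]
    (hodd : Odd (Fintype.card F))
    (h8 : (Fintype.card F : ZMod 8) = 3 ∨ (Fintype.card F : ZMod 8) = -3) :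
    ∀ (R : Type u) [Ring R] [Finite R],
      ¬ Nonempty (Rˣ ≃* Matrix.SpecialLinearGroup (Fin 2) F) := by
  rintro R _ _ ⟨φ⟩
  have h2 : (2 : F) ≠ 0 := by
    apply Ring.two_ne_zero
    intro h
    have := FiniteField.even_card_of_char_two h
    rcases hodd with ⟨k, hk⟩
    omega
  obtain ⟨p, hp⟩ := CharP.exists F
  have : NeZero p := ⟨CharP.char_ne_zero_of_finite F p⟩
  obtain ⟨a', b', hab'⟩ := CharP.sq_add_sq F p (-1)
  obtain ⟨a, b, hab⟩ : ∃ a b : F, a ^ 2 + b ^ 2 = -1 := ⟨a', b', by simpa using hab'⟩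
  obtain ⟨h, hh⟩ : ∃ h : F, 2 * h = -1 := ⟨-1 / 2, by field_simp⟩
  let z : Matrix.SpecialLinearGroup (Fin 2) F := ⟨!![-1, 0; 0, -1], by simp [Matrix.det_fin_two]⟩
  let i : Matrix.SpecialLinearGroup (Fin 2) F := ⟨!![0, 1; -1, 0], by simp [Matrix.det_fin_two]⟩
  let j : Matrix.SpecialLinearGroup (Fin 2) F := ⟨!![a, b; b, -a], by
    simp [Matrix.det_fin_two]; linear_combination -hab⟩
  let w : Matrix.SpecialLinearGroup (Fin 2) F :=
    ⟨!![h * (1 + a + b), h * (1 + b - a); h * (-1 + b - a), h * (1 - a - b)], by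
      simp [Matrix.det_fin_two]
      linear_combination (-2 * h ^ 2) * hab + (2 * h - 1) * hh⟩
  have hzz : z * z = 1 := by
    apply Subtype.ext
    simp only [Matrix.SpecialLinearGroup.coe_mul]
    ext r s; fin_cases r <;> fin_cases s <;> simp [z, Matrix.mul_apply, Fin.sum_univ_two]
  have hz1 : z ≠ 1 := fun e => by
    have e0 := congrArg (fun A : Matrix.SpecialLinearGroup (Fin 2) F => A.1 0 0) e
    simp [z] at e0
    apply h2
    linear_combination -e0
  have hcomm : ∀ v, z * v = v * z := fun v => by
    apply Subtype.ext
    simp only [Matrix.SpecialLinearGroup.coe_mul]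
    ext r s; fin_cases r <;> fin_cases s <;> simp [z, Matrix.mul_apply, Fin.sum_univ_two]
  have hii : i * i = z := by
    apply Subtype.ext
    simp only [Matrix.SpecialLinearGroup.coe_mul]
    ext r s; fin_cases r <;> fin_cases s <;> simp [z, i, Matrix.mul_apply, Fin.sum_univ_two]
  have hjj : j * j = z := by
    apply Subtype.ext
    simp only [Matrix.SpecialLinearGroup.coe_mul]
    ext r s; fin_cases r <;> fin_cases s <;> simp [z, j, Matrix.mul_apply, Fin.sum_univ_two] <;>
      first
      | ring1
      | linear_combination hab
  have hij : i * j = z * (j * i) := by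
    apply Subtype.ext
    simp only [Matrix.SpecialLinearGroup.coe_mul]
    ext r s; fin_cases r <;> fin_cases s <;>
      simp [z, i, j, Matrix.mul_apply, Fin.sum_univ_two]
  have hwi : w * i = j * w := by
    apply Subtype.ext
    simp only [Matrix.SpecialLinearGroup.coe_mul]
    ext r s; fin_cases r <;> fin_cases s <;>
      simp [w, i, j, Matrix.mul_apply, Fin.sum_univ_two] <;>
      first
      | linear_combination h * hab
      | linear_combination -h * hab
  have hwj : w * j = i * j * w := by
    apply Subtype.ext
    simp only [Matrix.SpecialLinearGroup.coe_mul]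
    ext r s; fin_cases r <;> fin_cases s <;>
      simp [w, i, j, Matrix.mul_apply, Fin.sum_univ_two] <;>
      first
      | ring1
      | linear_combination h * hab
      | linear_combination -h * hab
      | linear_combination (2 * h) * hab
      | linear_combination (-2 * h) * hab
  have D : h * (1 + a + b) * (h * (1 - a - b)) - h * (1 + b - a) * (h * (-1 + b - a)) = 1 := by
    linear_combination (-2 * h ^ 2) * hab + (2 * h - 1) * hh
  have hww : w * w = w⁻¹ := by
    apply Subtype.ext
    simp only [Matrix.SpecialLinearGroup.coe_mul, Matrix.SpecialLinearGroup.coe_inv]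
    ext r s; fin_cases r <;> fin_cases s <;>
      simp [w, Matrix.mul_apply, Fin.sum_univ_two, Matrix.adjugate_fin_two] <;>
      first
      | linear_combination (h * (1 + a + b) - 1) * hh - D
      | linear_combination (h * (1 - a - b) - 1) * hh - D
      | linear_combination (h * (1 + b - a)) * hh
      | linear_combination (h * (-1 + b - a)) * hh
  have hwww : w * w * w = 1 := by
    rw [hww, inv_mul_cancel]
  have huniq : ∀ v : Matrix.SpecialLinearGroup (Fin 2) F, v * v = 1 → v = 1 ∨ v = z := by
    intro v hv
    have hinv : v⁻¹ = v := inv_eq_of_mul_eq_one_left hv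
    have hadj : v.1.adjugate = v.1 := by
      rw [← Matrix.SpecialLinearGroup.coe_inv, hinv]
    have hdet := v.2
    rw [Matrix.adjugate_fin_two] at hadj
    rw [Matrix.det_fin_two] at hdet
    have e00 := congrFun (congrFun hadj 0) 0
    have e01 := congrFun (congrFun hadj 0) 1
    have e10 := congrFun (congrFun hadj 1) 0
    simp at e00 e01 e10
    have f01 : v.1 0 1 = 0 := by
      apply (mul_eq_zero.mp (?_ : (2 : F) * _ = 0)).resolve_left h2
      linear_combination -e01
    have f10 : v.1 1 0 = 0 := by
      apply (mul_eq_zero.mp (?_ : (2 : F) * _ = 0)).resolve_left h2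
      linear_combination -e10
    have f : (v.1 0 0 - 1) * (v.1 0 0 + 1) = 0 := by
      rw [f01] at hdet
      linear_combination hdet - v.1 0 0 * e00
    rcases mul_eq_zero.mp f with g | g
    · left
      have g1 : v.1 0 0 = 1 := by linear_combination g
      have g2 : v.1 1 1 = 1 := by linear_combination g + e00
      ext r s; fin_cases r <;> fin_cases s <;> simp [f01, f10, g1, g2]
    · right
      have g1 : v.1 0 0 = -1 := by linear_combination g
      have g2 : v.1 1 1 = -1 := by linear_combination g + e00
      ext r s; fin_cases r <;> fin_cases s <;> simp [z, f01, f10, g1, g2]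
  let ψ := φ.symm
  refine aux_ring (ψ z) (ψ i) (ψ j) (ψ w) ?_ ?_ ?_ ?_ ?_ ?_ ?_ ?_ ?_ ?_
  · intro v hv
    obtain ⟨v, rfl⟩ := ψ.surjective v
    rw [← map_mul, map_eq_one_iff _ ψ.injective] at hv
    rcases huniq v hv with e | e
    · left; rw [e, map_one]
    · right; rw [e]
  · intro e
    exact hz1 ((map_eq_one_iff _ ψ.injective).mp e)
  · rw [← map_mul, hzz, map_one]
  · intro v
    obtain ⟨v, rfl⟩ := ψ.surjective v
    rw [← map_mul, hcomm, map_mul]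
  · rw [← map_mul, hii]
  · rw [← map_mul, hjj]
  · rw [← map_mul, ← map_mul, ← map_mul, hij]
  · rw [← map_mul, ← map_mul, hwww, map_one]
  · rw [← map_mul, ← map_mul, hwi]
  · rw [← map_mul, ← map_mul, ← map_mul, hwj]
end

section
/- For a positive integer n, the holomorph Hol(Z_n) is the group of units of some finite unital ring if and only if n divides 12. -/
/-- The holomorph `Hol(Z_n) = Z_n ⋊ Aut(Z_n) ≅ AGL₁(Z_n)` of the additive cyclic
group `Z_n`, realized concretely as pairs `(a, b)` with `a : ZMod n` and
`b : (ZMod n)ˣ`, with multiplication `(a, b) * (c, d) = (a + b * c, b * d)`. -/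
@[ext] structure Hol (n : ℕ) where
  a : ZMod n
  b : (ZMod n)ˣ

namespace Hol

variable {n : ℕ}

instance instGroup : Group (Hol n) where
  mul x y := ⟨x.a + (x.b : ZMod n) * y.a, x.b * y.b⟩
  one := ⟨0, 1⟩
  inv x := ⟨-(((x.b⁻¹ : (ZMod n)ˣ) : ZMod n) * x.a), x.b⁻¹⟩
  mul_assoc x y z := by
    refine Hol.ext ?_ ?_
    · show x.a + (x.b : ZMod n) * y.a + ((x.b * y.b : (ZMod n)ˣ) : ZMod n) * z.a
        = x.a + (x.b : ZMod n) * (y.a + (y.b : ZMod n) * z.a)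
      push_cast
      ring
    · exact mul_assoc x.b y.b z.b
  one_mul x := by
    refine Hol.ext ?_ ?_
    · show (0 : ZMod n) + ((1 : (ZMod n)ˣ) : ZMod n) * x.a = x.a
      simp
    · exact one_mul x.b
  mul_one x := by
    refine Hol.ext ?_ ?_
    · show x.a + (x.b : ZMod n) * 0 = x.a
      simp
    · exact mul_one x.b
  inv_mul_cancel x := by
    refine Hol.ext ?_ ?_
    · show -(((x.b⁻¹ : (ZMod n)ˣ) : ZMod n) * x.a) + ((x.b⁻¹ : (ZMod n)ˣ) : ZMod n) * x.a = 0
      simp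
    · exact inv_mul_cancel x.b

@[simp] lemma mul_a (x y : Hol n) : (x * y).a = x.a + (x.b : ZMod n) * y.a := rfl
@[simp] lemma mul_b (x y : Hol n) : (x * y).b = x.b * y.b := rfl
@[simp] lemma one_a : (1 : Hol n).a = 0 := rfl
@[simp] lemma one_b : (1 : Hol n).b = 1 := rfl

/-- The translation subgroup `Z_n × {1}` of `Hol(Z_n)`, the image of the canonical
embedding of `Z_n`. -/
def trans (n : ℕ) : Subgroup (Hol n) where
  carrier := {x | x.b = 1}
  one_mem' := rfl
  mul_mem' := by
    intro x y hx hy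
    show (x * y).b = 1
    simp only [mul_b]
    rw [show x.b = 1 from hx, show y.b = 1 from hy, mul_one]
  inv_mem' := by
    intro x hx
    show x.b⁻¹ = 1
    rw [show x.b = 1 from hx, inv_one]

@[simp] lemma mem_trans (x : Hol n) : x ∈ trans n ↔ x.b = 1 := Iff.rfl

end Hol

section CommPart

variable {S : Type*} [CommRing S]

lemma aux_idem [Finite S] (x : S) (m : ℕ) (hm : 0 < m) :
    ∃ K, 0 < K ∧ m ∣ K ∧ x ^ K * x ^ K = x ^ K := by
  obtain ⟨i, j, hij, h⟩ := Finite.exists_ne_map_eq_of_infinite (fun k : ℕ => x ^ k)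
  wlog hlt : i < j generalizing i j
  · exact this j i hij.symm h.symm (by omega)
  obtain ⟨d, rfl⟩ := Nat.exists_eq_add_of_lt hlt
  have key : ∀ k l, x ^ (i + k + l * (d + 1)) = x ^ (i + k) := by
    intro k l
    induction l with
    | zero => simp
    | succ l ih =>
      have : x ^ (i + k + (l + 1) * (d + 1)) = x ^ (i + d + 1) * x ^ (k + l * (d + 1)) := by
        rw [← pow_add]; congr 1; ring
      have h' : x ^ i = x ^ (i + d + 1) := h
      rw [this, ← h', ← pow_add, ← ih]
      congr 1; ring
  refine ⟨(i + 1) * m * (d + 1), by positivity, ⟨(i + 1) * (d + 1), by ring⟩, ?_⟩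
  have hle : i ≤ (i + 1) * m * (d + 1) := by nlinarith [Nat.zero_le (i * m * d), Nat.zero_le (m * d), Nat.zero_le (i * (m - 1)), Nat.mul_le_mul_left i hm]
  obtain ⟨k, hk⟩ := Nat.exists_eq_add_of_le hle
  have := key k ((i + 1) * m)
  rw [← hk] at this
  rw [← pow_add]
  exact this

/-- Splitting off the part where `1 + x` is invertible. -/
lemma aux_split [Finite S] (σ : S →+* S) (hσ : ∀ v w : S, v * w = 1 → σ v = w)
    (x y : S) (hxy : x * y = 1) :
    ∃ e : S, e * e = e ∧ (x ^ 2 + x + 1) * e = 0 ∧ IsNilpotent ((1 + x) * (1 - e)) := by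
  obtain ⟨m, hm, hym⟩ : ∃ m, 0 < m ∧ y ^ m = 1 := by
    have hf : IsOfFinOrder (⟨y, x, by rw [mul_comm, hxy], hxy⟩ : Sˣ) := isOfFinOrder_of_finite _
    obtain ⟨m, hm, h⟩ := isOfFinOrder_iff_pow_eq_one.1 hf
    exact ⟨m, hm, by simpa using congrArg Units.val h⟩
  obtain ⟨K, hK, ⟨l, hl⟩, he⟩ := aux_idem (1 + x) m hm
  have hyK : y ^ K = 1 := by rw [hl, pow_mul, hym, one_pow]
  have h1 : σ (1 + x) = y * (1 + x) := by
    rw [map_add, map_one, hσ x y hxy]; linear_combination -hxy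
  obtain ⟨e, hedef⟩ : ∃ e, e = (1 + x) ^ K := ⟨_, rfl⟩
  rw [← hedef] at he
  have hσe : σ e = e := by
    rw [hedef, map_pow, h1, mul_pow, hyK, one_mul]
  obtain ⟨k, rfl⟩ : ∃ k, K = k + 1 := ⟨K - 1, by omega⟩
  have hv : ((1 + x) * e + (1 - e)) * ((1 + x) ^ k * e + (1 - e)) = 1 := by
    have : (1 + x) * (1 + x) ^ k = e := by rw [hedef]; ring
    linear_combination (e * e) * this + (e + 2 - (1 + x) - (1 + x) ^ k) * he
  have hs := hσ _ _ hv
  rw [← hs, map_add, map_mul, map_sub, map_one, h1, hσe] at hv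
  refine ⟨e, he, ?_, ⟨k + 1, ?_⟩⟩
  · have h2 : y * (1 + x) ^ 2 * e = e := by
      linear_combination hv - (y * (1 + x) ^ 2 + 1 - (1 + x) - y * (1 + x)) * he
    linear_combination x * h2 - (1 + x) ^ 2 * e * hxy
  · rw [mul_pow, ← hedef, pow_succ]
    linear_combination - (1 - e) ^ k * he

lemma aux_nil (σ : S →+* S) (hσ : ∀ v w : S, v * w = 1 → σ v = w)
    (a : S) (ha : IsNilpotent a) : 2 * a ^ 2 = 0 ∧ 3 * a ^ 4 = 0 := by
  obtain ⟨w, hw⟩ := isUnit_iff_exists_inv.1 ha.isUnit_one_add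
  have hσa : σ a = w - 1 := by
    have := hσ _ _ hw
    rw [map_add, map_one] at this
    linear_combination this
  have e1 : (1 + a ^ 2) * (1 + (w - 1) ^ 2) = 1 := by
    have hn : IsNilpotent (a ^ 2) := ha.pow_of_pos (by norm_num)
    obtain ⟨z, hz⟩ := isUnit_iff_exists_inv.1 hn.isUnit_one_add
    have := hσ _ _ hz
    rw [map_add, map_one, map_pow, hσa] at this
    rw [this, hz]
  have e2 : (1 + a ^ 3) * (1 + (w - 1) ^ 3) = 1 := by
    have hn : IsNilpotent (a ^ 3) := ha.pow_of_pos (by norm_num)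
    obtain ⟨z, hz⟩ := isUnit_iff_exists_inv.1 hn.isUnit_one_add
    have := hσ _ _ hz
    rw [map_add, map_one, map_pow, hσa] at this
    rw [this, hz]
  have hwa : (1 + a) * (w - 1) = - a := by linear_combination hw
  have hu : IsUnit (1 + (a + a ^ 2)) := by
    apply IsNilpotent.isUnit_one_add
    have : a + a ^ 2 = a * (1 + a) := by ring
    rw [this]
    exact (Commute.all _ _).isNilpotent_mul_right ha
  constructor
  · have h : (2 * a ^ 2) * (1 + (a + a ^ 2)) = 0 := by
      have hq : ((1 + a) * (w - 1)) ^ 2 = a ^ 2 := by rw [hwa]; ring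
      linear_combination (1 + a) ^ 2 * e1 - (1 + a ^ 2) * hq
    exact (hu.mul_left_eq_zero).1 h
  · have h : (3 * a ^ 4) * (1 + a) = 0 := by
      have hq : ((1 + a) * (w - 1)) ^ 3 = - a ^ 3 := by rw [hwa]; ring
      linear_combination (1 + a) ^ 3 * e2 - (1 + a ^ 3) * hq
    exact (ha.isUnit_one_add.mul_left_eq_zero).1 h

lemma aux_comm [Finite S] (σ : S →+* S) (hσ : ∀ v w : S, v * w = 1 → σ v = w)
    (hc : ∀ v w : S, v * v = 1 → w * w = 1 → v = 1 ∨ w = 1 ∨ v = w)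
    (x y : S) (hxy : x * y = 1) : x ^ 12 = 1 := by
  have h24 : (24 : S) = 0 := by
    obtain ⟨e, he, h3, hn⟩ := aux_split σ hσ 1 1 (by ring)
    have := (aux_nil σ hσ _ hn).1
    linear_combination 3 * this + 8 * h3 - 24 * he
  have h12 : (12 : S) = 0 := by
    rcases hc 5 7 (by linear_combination h24) (by linear_combination 2 * h24) with h | h | h
    · linear_combination 3 * h
    · linear_combination 2 * h
    · linear_combination -6 * h
  obtain ⟨e, he, h3, hn⟩ := aux_split σ hσ x y hxy
  have hn' : IsNilpotent (-((1 + x) * (1 - e))) := hn.neg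
  obtain ⟨n1, n2⟩ := aux_nil σ hσ _ hn'
  obtain ⟨a, ha⟩ : ∃ a, a = -((1 + x) * (1 - e)) := ⟨_, rfl⟩
  rw [← ha] at n1 n2
  have n4 : a ^ 4 = 0 := by linear_combination n2 - a ^ 2 * n1
  have ha12 : (1 + a) ^ 12 = 1 := by
    have : (1 + a) ^ 12 = 1 + 12 * a + 2 * a ^ 2 * (33 + 110 * a) + a ^ 4 * (495 + 792 * a +
      924 * a ^ 2 + 792 * a ^ 3 + 495 * a ^ 4 + 220 * a ^ 5 + 66 * a ^ 6 + 12 * a ^ 7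
      + a ^ 8) := by ring
    rw [this, n1, n4, h12]; ring
  have hx3 : x ^ 3 * e = e := by linear_combination (x - 1) * h3
  have hx12 : x ^ 12 * e = e := by
    linear_combination (x ^ 9 + x ^ 6 + x ^ 3 + 1) * hx3
  have hf : ∀ k : ℕ, (1 + a) ^ k * (1 - e) = (-x) ^ k * (1 - e) := by
    intro k
    induction k with
    | zero => simp
    | succ k ih =>
      have : (1 + a) * (1 - e) = (- x) * (1 - e) := by
        rw [ha]; linear_combination -(1 + x) * he
      rw [pow_succ', mul_assoc, ih, pow_succ']
      linear_combination (-x) ^ k * this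
  have := hf 12
  rw [ha12] at this
  linear_combination hx12 - this

end CommPart

lemma aux_dvd {R : Type*} [Ring R] [Finite R] (n : ℕ) (hn : 0 < n) (E : Rˣ ≃* Hol n) :
    n ∣ 12 := by
  haveI : NeZero n := ⟨hn.ne'⟩
  obtain ⟨t, ht⟩ : ∃ t, t = E.symm ⟨1, 1⟩ := ⟨_, rfl⟩
  obtain ⟨s, hs⟩ : ∃ s, s = E.symm ⟨0, -1⟩ := ⟨_, rfl⟩
  have Et : E t = ⟨1, 1⟩ := by rw [ht, E.apply_symm_apply]
  have Es : E s = ⟨0, -1⟩ := by rw [hs, E.apply_symm_apply]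
  -- units commuting with t
  have hb : ∀ v : Rˣ, v * t = t * v → (E v).b = 1 := by
    intro v hv
    have := congrArg (fun z => (E z).a) hv
    simp only [map_mul, Et, Hol.mul_a] at this
    ext
    simp at this
    have h2 : (((E v).b : (ZMod n)ˣ) : ZMod n) = 1 := by linear_combination this
    simpa using h2
  have hinv : ∀ v : Rˣ, v * t = t * v → s * v * s⁻¹ = v⁻¹ := by
    intro v hv
    have hvb := hb v hv
    rw [mul_inv_eq_iff_eq_mul, eq_inv_mul_iff_mul_eq]
    apply E.injective
    ext <;> simp [Es, hvb]
  have htR : ∀ v : Rˣ, Commute (v : R) (t : R) → v * t = t * v := fun v h => Units.ext h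
  let σ₀ : R →+* R := MulSemiringAction.toRingHom (ConjAct Rˣ) R (ConjAct.toConjAct s)
  have hσ₀ : ∀ x : R, σ₀ x = s * x * (s⁻¹ : Rˣ) := fun x => by
    simp [σ₀, ConjAct.units_smul_def]
  let S : Subring R := Subring.closure {(t : R)}
  have htS : (t : R) ∈ S := Subring.subset_closure rfl
  have hcom : ∀ x ∈ S, Commute x (t : R) := by
    intro x hx
    have : S ≤ Subring.centralizer {(t : R)} := by
      rw [Subring.closure_le]
      rintro _ rfl
      show (t : R) ∈ Subring.centralizer {(t : R)}
      rw [Subring.mem_centralizer_iff]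
      rintro _ rfl
      rfl
    have := this hx
    rw [Subring.mem_centralizer_iff] at this
    exact (this _ rfl).symm
  letI : CommRing S := Subring.closureCommRingOfComm (by
    rintro _ rfl _ rfl; rfl)
  have htinv : ((t⁻¹ : Rˣ) : R) ∈ S := by
    obtain ⟨m, hm, h⟩ := isOfFinOrder_iff_pow_eq_one.1 (isOfFinOrder_of_finite t)
    have : t⁻¹ = t ^ (m - 1) := by
      rw [inv_eq_iff_mul_eq_one, ← pow_succ', Nat.sub_add_cancel hm, h]
    rw [this, Units.val_pow_eq_pow_val]
    exact pow_mem htS _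
  have hmap : ∀ x ∈ S, σ₀ x ∈ S := by
    have : S ≤ S.comap σ₀ := by
      rw [Subring.closure_le]
      rintro _ rfl
      show σ₀ t ∈ S
      rw [hσ₀, ← Units.val_mul, ← Units.val_mul, hinv t rfl]
      exact htinv
    exact this
  let σ : S →+* S := σ₀.restrict S S hmap
  let toU : ∀ v w : S, v * w = 1 → Rˣ := fun v w h =>
    ⟨v, w, congrArg Subtype.val h, congrArg Subtype.val ((mul_comm w v).trans h)⟩
  have hU : ∀ v w h, toU v w h * t = t * toU v w h := fun v w h =>
    htR _ (hcom _ v.2)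
  have hσ : ∀ v w : S, v * w = 1 → σ v = w := by
    intro v w h
    apply Subtype.ext
    have := congrArg Units.val (hinv _ (hU v w h))
    show σ₀ v = w
    rw [hσ₀]
    exact this
  have hsq : ∀ (v : S) (h : v * v = 1), (E (toU v v h)).a.val = 0 ∨
      2 * (E (toU v v h)).a.val = n := by
    intro v h
    have h1 : toU v v h * toU v v h = 1 := Units.ext (congrArg Subtype.val h)
    have h2 := congrArg (fun z => (E z).a) h1
    simp [hb _ (hU v v h)] at h2
    have h3 : ((2 * (E (toU v v h)).a.val : ℕ) : ZMod n) = 0 := by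
      push_cast; rw [ZMod.natCast_zmod_val]; linear_combination h2
    rw [ZMod.natCast_eq_zero_iff] at h3
    have h4 := ZMod.val_lt (E (toU v v h)).a
    obtain ⟨k, hk⟩ := h3
    have : k < 2 := by
      by_contra hk2
      nlinarith [not_lt.1 hk2]
    interval_cases k <;> omega
  have hinj : ∀ (v w : S) (h : v * v = 1) (h' : w * w = 1),
      (E (toU v v h)).a.val = (E (toU w w h')).a.val → v = w := by
    intro v w h h' hval
    have : toU v v h = toU w w h' := by
      apply E.injective
      refine Hol.ext (ZMod.val_injective n hval) ?_
      rw [hb _ (hU v v h), hb _ (hU w w h')]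
    exact Subtype.ext (congrArg Units.val this)
  have hone : ∀ (v : S) (h : v * v = 1), (E (toU v v h)).a.val = 0 → v = 1 := by
    intro v h h0
    apply hinj v 1 h (one_mul 1)
    rw [h0]
    have : toU 1 1 (one_mul 1) = 1 := Units.ext rfl
    rw [this]
    simp
  have hc : ∀ v w : S, v * v = 1 → w * w = 1 → v = 1 ∨ w = 1 ∨ v = w := by
    intro v w h h'
    rcases hsq v h with h1 | h1
    · exact Or.inl (hone v h h1)
    rcases hsq w h' with h2 | h2
    · exact Or.inr (Or.inl (hone w h' h2))
    · exact Or.inr (Or.inr (hinj v w h h' (by omega)))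
  have key := aux_comm σ hσ hc ⟨t, htS⟩ ⟨_, htinv⟩ (Subtype.ext t.mul_inv)
  have key2 : t ^ 12 = 1 := Units.ext (congrArg Subtype.val key)
  have hpow : ∀ k : ℕ, (⟨1, 1⟩ : Hol n) ^ k = ⟨(k : ZMod n), 1⟩ := by
    intro k
    induction k with
    | zero => ext <;> simp
    | succ k ih => rw [pow_succ, ih]; ext <;> simp
  have h3 := congrArg (fun z => (E z).a) key2
  simp only [map_pow, Et, hpow, map_one, Hol.one_a] at h3
  exact (ZMod.natCast_eq_zero_iff 12 n).1 h3

/-- Realizability by a finite ring. -/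
def FinRealizable (n : ℕ) : Prop :=
  ∃ (R : Type) (_ : Ring R) (_ : Finite R), Nonempty (Rˣ ≃* Hol n)

/-- The Chinese remainder theorem for holomorphs. -/
noncomputable def holProd (m n : ℕ) (h : m.Coprime n) : Hol (m * n) ≃* Hol m × Hol n where
  toFun x :=
    let c := ZMod.chineseRemainder h
    let u := (Units.mapEquiv c.toMulEquiv).trans MulEquiv.prodUnits
    (⟨(c x.a).1, (u x.b).1⟩, ⟨(c x.a).2, (u x.b).2⟩)
  invFun p :=
    let c := ZMod.chineseRemainder h
    let u := (Units.mapEquiv c.toMulEquiv).trans MulEquiv.prodUnits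
    ⟨c.symm (p.1.a, p.2.a), u.symm (p.1.b, p.2.b)⟩
  left_inv x := by
    dsimp only
    rw [Prod.mk.eta, Prod.mk.eta, MulEquiv.symm_apply_apply, RingEquiv.symm_apply_apply]
  right_inv p := by
    dsimp only
    rw [MulEquiv.apply_symm_apply, RingEquiv.apply_symm_apply]
  map_mul' x y := by
    ext <;> simp [MulEquiv.prodUnits]

lemma FinRealizable.mul {m n : ℕ} (h : m.Coprime n) (hm : FinRealizable m)
    (hn : FinRealizable n) : FinRealizable (m * n) := by
  obtain ⟨R, _, _, ⟨e⟩⟩ := hm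
  obtain ⟨R', _, _, ⟨e'⟩⟩ := hn
  exact ⟨R × R', inferInstance, inferInstance,
    ⟨MulEquiv.prodUnits.trans ((e.prodCongr e').trans (holProd m n h).symm)⟩⟩

/-- A criterion for realizability. -/
lemma FinRealizable.of_map {n : ℕ} {R : Type} [Ring R] [Finite R] (f : Hol n → R)
    (h1 : f 1 = 1) (hmul : ∀ x y, f (x * y) = f x * f y) (hinj : ∀ x, f x = 1 → x = 1)
    (hsurj : ∀ x y : R, x * y = 1 → ∃ z, f z = x) : FinRealizable n := by
  let F : Hol n →* R := { toFun := f, map_one' := h1, map_mul' := hmul }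
  refine ⟨R, inferInstance, inferInstance, ⟨(MulEquiv.ofBijective F.toHomUnits ⟨?_, ?_⟩).symm⟩⟩
  · rw [injective_iff_map_eq_one]
    intro a ha
    exact hinj a (congrArg Units.val ha)
  · intro v
    obtain ⟨z, hz⟩ := hsurj v _ v.mul_inv
    exact ⟨z, Units.ext hz⟩

lemma real_one : FinRealizable 1 := by
  refine FinRealizable.of_map (R := PUnit) (fun _ => 1) rfl (fun _ _ => rfl) ?_ ?_
  · intro x _
    ext <;> exact Subsingleton.elim _ _
  · intro x y _
    exact ⟨1, rfl⟩

lemma real_two : FinRealizable 2 := by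
  refine FinRealizable.of_map (R := ZMod 3) (fun x => if x.a = 0 then 1 else -1) ?_ ?_ ?_ ?_
  · decide
  · rintro ⟨a, b⟩ ⟨c, d⟩
    simp only [Hol.mul_a]
    revert a b c d
    decide
  · rintro ⟨a, b⟩ h
    ext
    · have : ∀ a : ZMod 2, (if a = 0 then (1 : ZMod 3) else -1) = 1 → a = 0 := by decide
      exact this a h
    · exact congrArg Units.val (Subsingleton.elim b 1)
  · have : ∀ x y : ZMod 3, x * y = 1 → ∃ a : ZMod 2, (if a = 0 then (1 : ZMod 3) else -1) = x := by
      decide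
    intro x y h
    obtain ⟨a, ha⟩ := this x y h
    exact ⟨⟨a, 1⟩, ha⟩

/-- The embedding of `Hol 3` into 2 by 2 matrices. -/
def map3 (a : ZMod 3) (b : ZMod 3) : Matrix (Fin 2) (Fin 2) (ZMod 2) :=
  (if a = 0 then 1 else if a = 1 then !![0, 1; 1, 1] else !![1, 1; 1, 0]) *
    (if b = 1 then 1 else !![0, 1; 1, 0])

lemma real_three : FinRealizable 3 := by
  refine FinRealizable.of_map (fun x => map3 x.a x.b) ?_ ?_ ?_ ?_
  · decide
  · rintro ⟨a, b⟩ ⟨c, d⟩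
    simp only [Hol.mul_a, Hol.mul_b, Units.val_mul]
    revert a b c d
    decide
  · rintro ⟨a, b⟩ h
    have : ∀ (a : ZMod 3) (b : (ZMod 3)ˣ), map3 a b = 1 → a = 0 ∧ b = 1 := by decide
    exact Hol.ext (this a b h).1 (this a b h).2
  · have : ∀ p q r s : ZMod 2, p * s + q * r = 1 →
        ∃ (a : ZMod 3) (b : (ZMod 3)ˣ), map3 a b = !![p, q; r, s] := by
      decide
    intro x y h
    have hd : x.det * y.det = 1 := by rw [← Matrix.det_mul, h, Matrix.det_one]
    have hx : x.det = 1 := by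
      revert hd
      generalize x.det = p
      generalize y.det = q
      revert p q
      decide
    obtain ⟨a, b, hab⟩ := this (x 0 0) (x 0 1) (x 1 0) (x 1 1) (by
      rw [Matrix.det_fin_two] at hx
      rw [← hx, sub_eq_add_neg, ZMod.neg_eq_self_mod_two])
    exact ⟨⟨a, b⟩, hab.trans (Matrix.eta_fin_two x).symm⟩

/-- Upper triangular 3 by 3 matrices over `ZMod 2` with constant diagonal. -/
@[ext] structure Tri where
  d : ZMod 2
  x : ZMod 2
  y : ZMod 2
  z : ZMod 2

namespace Tri

instance : Zero Tri := ⟨⟨0, 0, 0, 0⟩⟩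
instance : One Tri := ⟨⟨1, 0, 0, 0⟩⟩
instance : Add Tri := ⟨fun p q => ⟨p.d + q.d, p.x + q.x, p.y + q.y, p.z + q.z⟩⟩
instance : Neg Tri := ⟨fun p => ⟨-p.d, -p.x, -p.y, -p.z⟩⟩
instance : Mul Tri := ⟨fun p q => ⟨p.d * q.d, p.d * q.x + p.x * q.d, p.d * q.y + p.y * q.d,
  p.d * q.z + p.z * q.d + p.x * q.y⟩⟩

lemma zero_def : (0 : Tri) = ⟨0, 0, 0, 0⟩ := rfl
lemma one_def : (1 : Tri) = ⟨1, 0, 0, 0⟩ := rfl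
lemma add_def (p q : Tri) : p + q = ⟨p.d + q.d, p.x + q.x, p.y + q.y, p.z + q.z⟩ := rfl
lemma neg_def (p : Tri) : -p = ⟨-p.d, -p.x, -p.y, -p.z⟩ := rfl
lemma mul_def (p q : Tri) : p * q = ⟨p.d * q.d, p.d * q.x + p.x * q.d, p.d * q.y + p.y * q.d,
  p.d * q.z + p.z * q.d + p.x * q.y⟩ := rfl

instance : Ring Tri where
  add_assoc p q r := by ext <;> simp only [add_def] <;> ring
  zero_add p := by ext <;> simp only [add_def, zero_def] <;> ring
  add_zero p := by ext <;> simp only [add_def, zero_def] <;> ring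
  add_comm p q := by ext <;> simp only [add_def] <;> ring
  left_distrib p q r := by ext <;> simp only [add_def, mul_def] <;> ring
  right_distrib p q r := by ext <;> simp only [add_def, mul_def] <;> ring
  zero_mul p := by ext <;> simp only [mul_def, zero_def] <;> ring
  mul_zero p := by ext <;> simp only [mul_def, zero_def] <;> ring
  mul_assoc p q r := by ext <;> simp only [mul_def] <;> ring
  one_mul p := by ext <;> simp only [mul_def, one_def] <;> ring
  mul_one p := by ext <;> simp only [mul_def, one_def] <;> ring
  neg_add_cancel p := by ext <;> simp only [add_def, neg_def, zero_def] <;> ring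
  nsmul := nsmulRec
  zsmul := zsmulRec

instance : Finite Tri :=
  Finite.of_injective (fun p : Tri => (p.d, p.x, p.y, p.z)) (by
    intro p q h
    simp only [Prod.mk.injEq] at h
    exact Tri.ext h.1 h.2.1 h.2.2.1 h.2.2.2)

end Tri

/-- The three coordinates of the embedding of `Hol 4`. -/
def map4 (a b : ZMod 4) : ZMod 2 × ZMod 2 × ZMod 2 :=
  if b = 1 then
    (if a = 0 then (0, 0, 0) else if a = 1 then (1, 1, 0) else if a = 2 then (0, 0, 1)
      else (1, 1, 1))
  else
    (if a = 0 then (1, 0, 0) else if a = 1 then (0, 1, 0) else if a = 2 then (1, 0, 1)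
      else (0, 1, 1))

lemma real_four : FinRealizable 4 := by
  refine FinRealizable.of_map (R := Tri)
    (fun x => ⟨1, (map4 x.a x.b).1, (map4 x.a x.b).2.1, (map4 x.a x.b).2.2⟩) ?_ ?_ ?_ ?_
  · rfl
  · rintro ⟨a, b⟩ ⟨c, d⟩
    simp only [Hol.mul_a, Hol.mul_b, Units.val_mul, Tri.mul_def, Tri.mk.injEq]
    revert a b c d
    decide
  · rintro ⟨a, b⟩ h
    simp only [Tri.one_def, Tri.mk.injEq, true_and] at h
    have : ∀ (a : ZMod 4) (b : (ZMod 4)ˣ), (map4 a b).1 = 0 ∧ (map4 a b).2.1 = 0 ∧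
      (map4 a b).2.2 = 0 → a = 0 ∧ b = 1 := by decide
    exact Hol.ext (this a b h).1 (this a b h).2
  · rintro ⟨d, x, y, z⟩ ⟨d', x', y', z'⟩ h
    simp only [Tri.one_def, Tri.mul_def, Tri.mk.injEq] at h
    have hd : ∀ d d' : ZMod 2, d * d' = 1 → 1 = d := by decide
    have : ∀ x y z : ZMod 2, ∃ (a : ZMod 4) (b : (ZMod 4)ˣ), map4 a b = (x, y, z) := by decide
    obtain ⟨a, b, hab⟩ := this x y z
    exact ⟨⟨a, b⟩, by simp [hab, hd _ _ h.1]⟩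

lemma real_of_dvd (n : ℕ) (h : n ∣ 12) : FinRealizable n := by
  have hn : n ∈ Nat.divisors 12 := by simp [h]
  have hd : Nat.divisors 12 = {1, 2, 3, 4, 6, 12} := by decide
  rw [hd] at hn
  simp only [Finset.mem_insert, Finset.mem_singleton] at hn
  rcases hn with rfl | rfl | rfl | rfl | rfl | rfl
  · exact real_one
  · exact real_two
  · exact real_three
  · exact real_four
  · exact FinRealizable.mul (m := 2) (n := 3) (by norm_num) real_two real_three
  · exact FinRealizable.mul (m := 4) (n := 3) (by norm_num) real_four real_three

universe u

/-- For a positive integer `n`, the holomorph `Hol(Z_n)` is the group of units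
of some finite unital ring if and only if `n` divides 12. -/
theorem hol_realizable_finite_iff (n : ℕ) (hn : 0 < n) :
    (∃ (R : Type u) (_ : Ring R) (_ : Finite R), Nonempty (Rˣ ≃* Hol n)) ↔
      n ∣ 12 := by
  constructor
  · rintro ⟨R, _, _, ⟨E⟩⟩
    exact aux_dvd n hn E
  · intro h
    obtain ⟨R, _, _, ⟨E⟩⟩ := real_of_dvd n h
    exact ⟨ULift.{u} R, inferInstance, inferInstance,
      ⟨(Units.mapEquiv (ULift.ringEquiv (R := R)).toMulEquiv).trans E⟩⟩
end

section
/- Let p be a prime and k a positive integer. The holomorph Hol(Z_{p^k}) is isomorphic to a dihedral group if and only if p^k ∈ {2, 3, 4}. -/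
/-- In a dihedral group, elements with nontrivial square are rotations, so they commute. -/
lemma dihedral_comm_of_sq_ne {m : ℕ} (x y : DihedralGroup m) (hx : x * x ≠ 1) (hy : y * y ≠ 1) :
    x * y = y * x := by
  cases x with
  | sr i => simp at hx
  | r i =>
    cases y with
    | sr j => simp at hy
    | r j => simp [add_comm]

lemma hol_not_dihedral {n m : ℕ} (e : Hol n ≃* DihedralGroup m) (b : (ZMod n)ˣ)
    (h2 : (2 : ZMod n) ≠ 0) (hb : 1 + (b : ZMod n) ≠ 0) : (b : ZMod n) = 1 := by
  have key : (⟨1, 1⟩ : Hol n) * ⟨1, b⟩ = ⟨1, b⟩ * ⟨1, 1⟩ := by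
    apply e.injective
    rw [map_mul, map_mul]
    apply dihedral_comm_of_sq_ne
    · rw [← map_mul, Ne, e.map_eq_one_iff]
      intro h
      have := congrArg Hol.a h
      simp at this
      apply h2
      rw [← this]; norm_num
    · rw [← map_mul, Ne, e.map_eq_one_iff]
      intro h
      have := congrArg Hol.a h
      simp at this
      exact hb this
  have := congrArg Hol.a key
  simp at this
  exact this.symm

/-- The natural homomorphism from the dihedral group to the holomorph. -/
def dihToHol (n : ℕ) : DihedralGroup n →* Hol n where
  toFun x := match x with
    | .r i => ⟨i, 1⟩
    | .sr i => ⟨-i, -1⟩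
  map_one' := rfl
  map_mul' x y := by
    cases x <;> cases y <;> ext <;> simp <;> ring

lemma dihToHol_r {n : ℕ} (i : ZMod n) : dihToHol n (.r i) = ⟨i, 1⟩ := rfl

lemma dihToHol_sr {n : ℕ} (i : ZMod n) : dihToHol n (.sr i) = ⟨-i, -1⟩ := rfl

lemma dihToHol_bij {n : ℕ} (h1 : (-1 : (ZMod n)ˣ) ≠ 1) (h : ∀ u : (ZMod n)ˣ, u = 1 ∨ u = -1) :
    Function.Bijective (dihToHol n) := by
  constructor
  · intro x y hxy
    cases x <;> cases y <;> simp [dihToHol_r, dihToHol_sr, h1, h1.symm] at hxy ⊢ <;> exact hxy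
  · rintro ⟨a, b⟩
    rcases h b with rfl | rfl
    · exact ⟨.r a, rfl⟩
    · exact ⟨.sr (-a), by simp [dihToHol_sr]⟩

lemma hol_two : Nonempty (Hol 2 ≃* DihedralGroup 1) := by
  have h1 : Nat.card (DihedralGroup 1) = 2 := by rw [DihedralGroup.nat_card]
  have e : Hol 2 ≃ ZMod 2 × (ZMod 2)ˣ :=
    ⟨fun x => (x.a, x.b), fun x => ⟨x.1, x.2⟩, fun _ => rfl, fun _ => rfl⟩
  have h2 : Nat.card (Hol 2) = 2 := by
    rw [Nat.card_congr e, Nat.card_prod]; simp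
  have : Fact (Nat.Prime 2) := ⟨Nat.prime_two⟩
  exact ⟨mulEquivOfPrimeCardEq h2 h1⟩

lemma cast_ne_zero_of_lt {n : ℕ} (c : ℕ) (hc : 0 < c) (h : c < n) : (c : ZMod n) ≠ 0 := by
  rw [Ne, ZMod.natCast_eq_zero_iff]
  exact fun hd => absurd (Nat.le_of_dvd hc hd) (by omega)

/-- Let `p` be a prime and `k` a positive integer. The holomorph `Hol(Z_{p^k})`
is isomorphic to a dihedral group if and only if `p ^ k ∈ {2, 3, 4}`. -/
theorem hol_prime_pow_dihedral_iff (p : ℕ) (hp : p.Prime) (k : ℕ) (hk : 0 < k) :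
    (∃ m : ℕ, 0 < m ∧ Nonempty (Hol (p ^ k) ≃* DihedralGroup m)) ↔
      p ^ k = 2 ∨ p ^ k = 3 ∨ p ^ k = 4 := by
  constructor
  · rintro ⟨m, -, ⟨e⟩⟩
    have h1 : 1 < p ^ k := Nat.one_lt_pow hk.ne' hp.one_lt
    by_contra hn
    have h5 : 4 < p ^ k := by omega
    have h2 : (2 : ZMod (p ^ k)) ≠ 0 := by
      exact_mod_cast cast_ne_zero_of_lt (n := p ^ k) 2 (by norm_num) (by omega)
    by_cases hp2 : p = 2
    · have hc : Nat.Coprime 3 (p ^ k) := by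
        subst hp2
        exact Nat.Coprime.pow_right _ (by norm_num)
      have hb := hol_not_dihedral e (ZMod.unitOfCoprime 3 hc) h2 (by
        have := cast_ne_zero_of_lt (n := p ^ k) 4 (by norm_num) (by omega)
        rw [ZMod.coe_unitOfCoprime]
        intro h; apply this; rw [← h]; norm_num)
      rw [ZMod.coe_unitOfCoprime] at hb
      apply h2
      push_cast at hb
      linear_combination hb
    · have hc : Nat.Coprime 2 (p ^ k) :=
        Nat.Coprime.pow_right _ ((Nat.coprime_primes Nat.prime_two hp).2 (Ne.symm hp2))
      have hb := hol_not_dihedral e (ZMod.unitOfCoprime 2 hc) h2 (by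
        have := cast_ne_zero_of_lt (n := p ^ k) 3 (by norm_num) (by omega)
        rw [ZMod.coe_unitOfCoprime]
        intro h; apply this; rw [← h]; norm_num)
      rw [ZMod.coe_unitOfCoprime] at hb
      apply cast_ne_zero_of_lt (n := p ^ k) 1 (by norm_num) (by omega)
      push_cast at hb ⊢
      linear_combination hb
  · rintro (h | h | h)
    · rw [h]; exact ⟨1, one_pos, hol_two⟩
    · rw [h]
      exact ⟨3, by norm_num,
        ⟨(MulEquiv.ofBijective _ (dihToHol_bij (n := 3) (by decide) (by decide))).symm⟩⟩
    · rw [h]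
      exact ⟨4, by norm_num,
        ⟨(MulEquiv.ofBijective _ (dihToHol_bij (n := 4) (by decide) (by decide))).symm⟩⟩
end

section
/- Let F be a finite field of cardinality q, and suppose R is a unital ring whose group of units R^× is isomorphic to SL_2(F). If q is even, then the characteristic of R is 2; if q is odd, then the characteristic of R is 0, 2, 3, 4 or 6. -/
theorem sl2_center_aux {F : Type*} [Field F] (A : Matrix.SpecialLinearGroup (Fin 2) F)
    (hA : A ∈ Subgroup.center (Matrix.SpecialLinearGroup (Fin 2) F)) : A = 1 ∨ A = -1 := by
  rw [Matrix.SpecialLinearGroup.mem_center_iff] at hA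
  obtain ⟨r, hr, hs⟩ := hA
  simp only [Fintype.card_fin] at hr
  rcases mul_self_eq_one_iff.mp ((sq r).symm.trans hr) with h | h
  · left; apply Subtype.ext; rw [← hs, h]; simp
  · right; apply Subtype.ext; rw [← hs, h]
    ext i j; fin_cases i <;> fin_cases j <;> simp [Matrix.scalar_apply]

theorem exists_coprime_aux (n : ℕ) (h5 : 5 ≤ n) (h6 : n ≠ 6) :
    ∃ k, Nat.Coprime k n ∧ 1 < k ∧ k + 1 < n := by
  rcases Nat.even_or_odd' n with ⟨m, hm | hm⟩
  · rcases Nat.even_or_odd' m with ⟨l, hl | hl⟩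
    · refine ⟨m + 1, ?_, by omega, by omega⟩
      rw [hm]
      refine Nat.Coprime.mul_right ?_ (by simp)
      rw [hl, Nat.coprime_two_right, Nat.odd_iff]; omega
    · refine ⟨m + 2, ?_, by omega, by omega⟩
      rw [hm]
      refine Nat.Coprime.mul_right ?_ ?_
      · rw [Nat.coprime_two_right, Nat.odd_iff]; omega
      · simp [Nat.odd_iff]; omega
  · refine ⟨2, ?_, by omega, by omega⟩
    rw [Nat.coprime_two_left, Nat.odd_iff]; omega

/-- Let `F` be a finite field of cardinality `q`, and let `R` be a unital ring
whose unit group is isomorphic to `SL₂(F)`. If `q` is even, the characteristic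
of `R` is 2; if `q` is odd, the characteristic of `R` is 0, 2, 3, 4 or 6. -/
theorem sl2_realizing_ring_char (F : Type*) [Field F] [Fintype F]
    (R : Type*) [Ring R]
    (h : Nonempty (Rˣ ≃* Matrix.SpecialLinearGroup (Fin 2) F)) :
    (Even (Fintype.card F) → ringChar R = 2) ∧
    (Odd (Fintype.card F) →
      ringChar R = 0 ∨ ringChar R = 2 ∨ ringChar R = 3 ∨ ringChar R = 4 ∨
        ringChar R = 6) := by
  obtain ⟨e⟩ := h
  have hc : ∀ u : Rˣ, (∀ v : Rˣ, v * u = u * v) → e u = 1 ∨ e u = -1 := by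
    intro u hu
    apply sl2_center_aux
    rw [Subgroup.mem_center_iff]
    intro g
    have := congrArg e (hu (e.symm g))
    simpa using this
  have hm : e (-1) = 1 ∨ e (-1) = -1 := hc _ (by simp)
  have hnt : Nontrivial R := by
    by_contra hR
    rw [not_nontrivial_iff_subsingleton] at hR
    let A : Matrix.SpecialLinearGroup (Fin 2) F := ⟨!![1, 1; 0, 1], by simp⟩
    have h1 : A = 1 := e.symm.injective (Subsingleton.elim _ _)
    have h2 := congrFun (congrFun (congrArg Subtype.val h1) 0) 1
    simp [A] at h2
  have hn1 : ringChar R ≠ 1 := CharP.ringChar_ne_one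
  constructor
  · intro hq
    have hF : (2 : F) = 0 := by
      have h2 : ringChar F = 2 := by
        by_contra hne
        have := FiniteField.odd_card_of_char_ne_two hne
        have := Nat.even_iff.mp hq
        omega
      have := ringChar.Nat.cast_ringChar (R := F)
      rw [h2] at this
      exact_mod_cast this
    have hneg : (-1 : Matrix.SpecialLinearGroup (Fin 2) F) = 1 := by
      have h1 : (-1 : F) = 1 := by linear_combination -hF
      apply Subtype.ext
      ext i j; fin_cases i <;> fin_cases j <;> simp [h1]
    have h1 : e (-1) = e 1 := by
      rw [map_one]; rcases hm with h | h
      · exact h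
      · rw [h, hneg]
    have h3 : (-1 : R) = 1 := by simpa using congrArg Units.val (e.injective h1)
    have h4 : ((2 : ℕ) : R) = 0 := by
      have := neg_add_cancel (1 : R)
      rw [h3] at this
      push_cast
      rw [← this]; norm_num
    have h5 := (ringChar.spec R 2).mp h4
    exact ((Nat.dvd_prime Nat.prime_two).mp h5).resolve_left hn1
  · intro _
    by_contra hcon
    push Not at hcon
    obtain ⟨h0, h2, h3, h4, h6⟩ := hcon
    obtain ⟨k, hk, hk1, hkn⟩ := exists_coprime_aux (ringChar R) (by omega) h6
    have hne : e (-1) ≠ 1 := by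
      intro hh
      have h1 : e (-1) = e 1 := by rw [hh, map_one]
      have h3 : (-1 : R) = 1 := by simpa using congrArg Units.val (e.injective h1)
      have h4 : ((2 : ℕ) : R) = 0 := by
        have := neg_add_cancel (1 : R)
        rw [h3] at this
        push_cast
        rw [← this]; norm_num
      have := Nat.le_of_dvd (by norm_num) ((ringChar.spec R 2).mp h4)
      omega
    have hm' := hm.resolve_left hne
    have hu : IsUnit ((k : ℕ) : R) := by
      have h := (ZMod.unitOfCoprime k hk).isUnit.map (ZMod.castHom (dvd_refl (ringChar R)) R)
      simpa using h
    obtain ⟨u, hu⟩ := hu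
    have hcu := hc u (fun v => by
      apply Units.ext
      rw [Units.val_mul, Units.val_mul, hu]
      exact (Nat.cast_commute k (v : R)).symm.eq)
    rcases hcu with h | h
    · have h7 : u = 1 := e.injective (by rw [h, map_one])
      rw [h7] at hu
      have h8 : ((k - 1 : ℕ) : R) = 0 := by
        rw [Nat.cast_sub (by omega), ← hu]; simp
      have := Nat.le_of_dvd (by omega) ((ringChar.spec R _).mp h8)
      omega
    · have h7 : u = -1 := e.injective (by rw [h, hm'])
      rw [h7] at hu
      have h8 : ((k + 1 : ℕ) : R) = 0 := by
        rw [Nat.cast_add, ← hu]; simp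
      have := Nat.le_of_dvd (by omega) ((ringChar.spec R _).mp h8)
      omega
end

section
/- Let F be a finite field of cardinality q, and let m ≥ 2 be an integer with gcd(q - 1, m) = 1. Then SL_m(F) is realizable (there exists a unital ring R with R^× isomorphic to SL_m(F)) if and only if q = 2. -/
open Finset in
theorem odd_core {R : Type*} [Ring R] (hfin : Finite Rˣ) (A : Subgroup Rˣ) (p : ℕ) (hp : p.Prime)
    (hodd : Odd p) (hcomm : ∀ a ∈ A, ∀ b ∈ A, a * b = b * a)
    (hcent : ∀ c : Rˣ, (∀ a ∈ A, a * c = c * a) → c ∈ A)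
    (hexp : ∀ a ∈ A, a ^ p = 1)
    (hconj : ∀ a ∈ A, ∀ b ∈ A, a ≠ 1 → b ≠ 1 → ∃ g : Rˣ, g * a * g⁻¹ = b)
    (hrank : ∃ a ∈ A, ∃ b ∈ A, b ≠ 1 ∧ ∀ j : ℕ, a * b ^ j ≠ 1) : False := by
  have h2 : (-1 : R) = 1 := by
    have h1 : (-1 : Rˣ) ∈ A := hcent _ (by intro a _; simp)
    have := hexp _ h1
    rw [hodd.neg_one_pow] at this
    simpa using congrArg Units.val this
  have h20 : (1 : R) + 1 = 0 := by nth_rewrite 1 [← h2]; simp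
  have hpR : (p : R) = 1 := by
    obtain ⟨k, rfl⟩ := hodd
    push_cast
    rw [two_mul, show (k : R) + k = (1 + 1) * k by rw [add_mul, one_mul], h20]; simp
  set s : Rˣ → R := fun a => ∑ i ∈ range p, (a : R) ^ i with hs
  have hcR : ∀ a ∈ A, ∀ b ∈ A, Commute (a : R) (b : R) := by
    intro a ha b hb
    have := congrArg Units.val (hcomm a ha b hb)
    exact this
  have hcs : ∀ a ∈ A, ∀ b ∈ A, Commute (a : R) (s b) := by
    intro a ha b hb
    exact Commute.sum_right _ _ _ fun i _ => (hcR a ha b hb).pow_right i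
  have hss : ∀ a ∈ A, ∀ b ∈ A, Commute (s a) (s b) := by
    intro a ha b hb
    exact Commute.sum_left _ _ _ fun i _ => (hcs a ha b hb).pow_left i
  have hexpR : ∀ a ∈ A, (a : R) ^ p = 1 := by
    intro a ha
    simpa using congrArg Units.val (hexp a ha)
  have has : ∀ a ∈ A, (a : R) * s a = s a := by
    intro a ha
    have h := mul_geom_sum (a : R) p
    rw [hexpR a ha, sub_self, sub_mul, one_mul, sub_eq_zero] at h
    exact h
  have hapow : ∀ a ∈ A, ∀ i : ℕ, (a : R) ^ i * s a = s a := by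
    intro a ha i
    induction i with
    | zero => simp
    | succ k ih => rw [pow_succ, mul_assoc, has a ha, ih]
  have hidem : ∀ a ∈ A, s a * s a = s a := by
    intro a ha
    conv_lhs => lhs; rw [hs]
    simp only
    rw [Finset.sum_mul, Finset.sum_congr rfl fun i _ => hapow a ha i]
    simp [hpR]
  have hs1 : ∀ a ∈ A, s a = 1 → a = 1 := by
    intro a ha h
    have := has a ha
    rw [h, mul_one] at this
    exact Units.ext this
  -- conjugation antichain
  have hanti : ∀ a ∈ A, ∀ c ∈ A, a ≠ 1 → c ≠ 1 →
      (1 - s c) * (1 - s a) = 1 - s c → s c = s a := by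
    intro a ha c hc ha1 hc1 h
    obtain ⟨g, hg⟩ := hconj a ha c hc ha1 hc1
    have hsc : (g : R) * (1 - s a) * (↑g⁻¹ : R) = 1 - s c := by
      have : s c = (g : R) * s a * (↑g⁻¹ : R) := by
        simp only [hs]
        rw [Finset.mul_sum, Finset.sum_mul]
        refine Finset.sum_congr rfl fun i _ => ?_
        rw [← hg, ← Units.val_pow_eq_pow_val, conj_pow]
        simp
      rw [this]
      simp [mul_sub, sub_mul]
    set E : ℕ → R := fun k => (↑(g ^ k) : R) * (1 - s a) * (↑(g ^ k)⁻¹ : R) with hE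
    have hstep : ∀ k, E (k + 1) = (↑(g ^ k) : R) * (1 - s c) * (↑(g ^ k)⁻¹ : R) := by
      intro k
      rw [← hsc]; simp only [hE]
      rw [pow_succ, mul_inv_rev]
      push_cast
      simp only [mul_assoc]
    have hdesc : ∀ k, E (k + 1) * E k = E (k + 1) := by
      intro k
      rw [hstep]
      simp only [hE]
      calc _ = (↑(g ^ k) : R) * ((1 - s c) * ((↑(g ^ k)⁻¹ : R) * (↑(g ^ k) : R)) * (1 - s a)) * (↑(g ^ k)⁻¹ : R) := by
            simp only [mul_assoc]
        _ = _ := by rw [Units.inv_mul, mul_one, h]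
    have hd1 : ∀ k, E (k + 1) * E 1 = E (k + 1) := by
      intro k
      induction k with
      | zero =>
        simp only [zero_add]
        have : E 1 = 1 - s c := by rw [hstep 0]; simp
        rw [this]
        simp only [mul_sub, sub_mul, hidem c hc]; simp
      | succ k ih =>
        rw [← hdesc (k + 1), mul_assoc, ih]
    obtain ⟨n, hn, hgn⟩ := (isOfFinOrder_iff_pow_eq_one (x := g)).1 (isOfFinOrder_of_finite g)
    obtain ⟨k, rfl⟩ : ∃ k, n = k + 1 := ⟨n - 1, by omega⟩
    have h0 := hd1 k
    have hEn : E (k + 1) = 1 - s a := by simp only [hE, hgn]; simp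
    have hE1 : E 1 = 1 - s c := by rw [hstep 0]; simp
    rw [hEn, hE1] at h0
    have hcm : (1 - s a) * (1 - s c) = (1 - s c) * (1 - s a) := by
      have := (hss a ha c hc).eq
      simp only [mul_sub, sub_mul, this]; simp; abel
    rw [hcm, h] at h0
    exact sub_right_injective h0
  -- the twisted element
  have htwist : ∀ a ∈ A, ∀ b ∈ A, ∃ c ∈ A, (c : R) = (1 - s a) * b + s a ∧
      s c = (1 - s a) * s b + s a := by
    intro a ha b hb
    have hm : ∀ x y : R, Commute (s a) x → Commute (s a) y →
        ((1 - s a) * x + s a) * ((1 - s a) * y + s a) = (1 - s a) * (x * y) + s a := by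
      intro x y hx hy
      have e1 : s a * (1 - s a) = 0 := by rw [mul_sub, hidem a ha]; simp
      have e2 : (1 - s a) * s a = 0 := by rw [sub_mul, hidem a ha]; simp
      have e3 : (1 - s a) * (1 - s a) = 1 - s a := by rw [sub_mul, one_mul, e1, sub_zero]
      have hx' : x * (1 - s a) = (1 - s a) * x := by rw [mul_sub, sub_mul, hx.eq]; simp
      have hx'' : (1 - s a) * x * s a = 0 := by rw [mul_assoc, ← hx.eq, ← mul_assoc, e2, zero_mul]
      calc _ = (1 - s a) * (x * (1 - s a)) * y + (1 - s a) * x * s a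
              + s a * (1 - s a) * y + s a * s a := by noncomm_ring
        _ = (1 - s a) * (1 - s a) * (x * y) + s a := by
            rw [hx'', e1, hx', hidem a ha, zero_mul]; simp [mul_assoc]
        _ = _ := by rw [e3]
    have hsb : Commute (s a) (b : R) := (hcs b hb a ha).symm
    have hsb' : Commute (s a) (↑b⁻¹ : R) := (hcs b⁻¹ (A.inv_mem hb) a ha).symm
    let c : Rˣ := ⟨(1 - s a) * b + s a, (1 - s a) * (↑b⁻¹ : R) + s a,
      by rw [hm _ _ hsb hsb']; simp, by rw [hm _ _ hsb' hsb]; simp⟩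
    have hcv : (c : R) = (1 - s a) * b + s a := rfl
    have hcA : c ∈ A := by
      apply hcent
      intro x hx
      apply Units.ext
      rw [Units.val_mul, Units.val_mul, hcv]
      have h1 := hcs x hx a ha
      have h2 := hcR x hx b hb
      exact (((Commute.one_right _).sub_right h1).mul_right h2).add_right h1
    have hpow : ∀ i : ℕ, (c : R) ^ i = (1 - s a) * (b : R) ^ i + s a := by
      intro i
      induction i with
      | zero => simp
      | succ k ih => rw [pow_succ, ih, hcv, hm _ _ (hsb.pow_right k) hsb, ← pow_succ]
    refine ⟨c, hcA, hcv, ?_⟩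
    change ∑ i ∈ range p, (c : R) ^ i = (1 - s a) * (∑ i ∈ range p, (b : R) ^ i) + s a
    rw [Finset.sum_congr rfl fun i _ => hpow i, Finset.sum_add_distrib, Finset.mul_sum]
    simp [hpR]
  have hdich : ∀ a ∈ A, ∀ b ∈ A, a ≠ 1 → b ≠ 1 →
      (1 - s a) * (1 - s b) = 1 - s a ∨ ((1 - s a) * b = 1 - s a ∧ (1 - s a) * (1 - s b) = 0) := by
    intro a ha b hb ha1 hb1
    obtain ⟨c, hc, hcv, hsc⟩ := htwist a ha b hb
    have hec : 1 - s c = (1 - s a) * (1 - s b) := by rw [hsc]; noncomm_ring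
    by_cases hc1 : c = 1
    · right
      constructor
      · rw [hc1] at hcv
        rw [eq_sub_iff_add_eq, ← hcv]; rfl
      · rw [← hec, hc1]; simp [hs, hpR]
    · left
      rw [← hec]
      rw [hanti a ha c hc ha1 hc1]
      rw [hec]
      have e3 : (1 - s a) * (1 - s a) = 1 - s a := by
        simp only [mul_sub, sub_mul, hidem a ha]; simp
      have hcm : (1 - s a) * (1 - s b) = (1 - s b) * (1 - s a) := by
        have := (hss a ha b hb).eq
        simp only [mul_sub, sub_mul, this]; simp; abel
      rw [hcm, mul_assoc, e3]
  have hsymm : ∀ a ∈ A, ∀ b ∈ A, (1 - s a) * (1 - s b) = (1 - s b) * (1 - s a) := by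
    intro a ha b hb
    have := (hss a ha b hb).eq
    simp only [mul_sub, sub_mul, this]; simp; abel
  have hne : ∀ a ∈ A, a ≠ 1 → 1 - s a ≠ 0 := fun a ha ha1 h =>
    ha1 (hs1 a ha (sub_eq_zero.1 h).symm)
  have hdich2 : ∀ a ∈ A, ∀ b ∈ A, a ≠ 1 → b ≠ 1 →
      s a = s b ∨ ((1 - s a) * b = 1 - s a ∧ (1 - s a) * (1 - s b) = 0) := by
    intro a ha b hb ha1 hb1
    rcases hdich a ha b hb ha1 hb1 with h | h
    · exact Or.inl (hanti b hb a ha hb1 ha1 h)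
    · exact Or.inr h
  have hzero : ∀ a ∈ A, ∀ b ∈ A, a ≠ 1 → (1 - s a) * b = 1 - s a →
      (1 - s a) * (1 - s (a * b)) = 1 - s a := by
    intro a ha b hb ha1 h
    have hpw : ∀ i : ℕ, (1 - s a) * (b : R) ^ i = 1 - s a := by
      intro i
      induction i with
      | zero => simp
      | succ k ih => rw [pow_succ, ← mul_assoc, ih, h]
    have hzz : (1 - s a) * s (a * b) = 0 := by
      simp only [hs]
      rw [Finset.mul_sum]
      have : ∀ i ∈ range p, (1 - s a) * ((↑(a * b) : R)) ^ i = (1 - s a) * (a : R) ^ i := by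
        intro i _
        rw [Units.val_mul, (hcR a ha b hb).mul_pow, ((hcR a ha b hb).pow_pow i i).eq, ← mul_assoc, hpw]
      rw [Finset.sum_congr rfl this, ← Finset.mul_sum]
      change (1 - s a) * s a = 0
      rw [sub_mul, hidem a ha]; simp
    rw [mul_sub, hzz]; simp
  have hconst : ∀ a ∈ A, ∀ b ∈ A, a ≠ 1 → b ≠ 1 → s a = s b := by
    intro a ha b hb ha1 hb1
    rcases hdich2 a ha b hb ha1 hb1 with h | ⟨h, h0⟩
    · exact h
    exfalso
    rcases hdich2 b hb a ha hb1 ha1 with h' | ⟨h', h0'⟩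
    · rw [h', hsymm a ha a ha] at h0
      have e3 : (1 - s a) * (1 - s a) = 1 - s a := by
        simp only [mul_sub, sub_mul, hidem a ha]; simp
      exact hne a ha ha1 (e3 ▸ h0)
    have k1 := hzero a ha b hb ha1 h
    have k2 := hzero b hb a ha hb1 h'
    rw [hcomm b hb a ha] at k2
    have hd := A.mul_mem ha hb
    by_cases hd1 : a * b = 1
    · rw [hd1] at k1
      have : s 1 = 1 := by simp [hs, hpR]
      rw [this] at k1
      simp only [sub_self, mul_zero] at k1
      exact hne a ha ha1 k1.symm
    have e1 : s a = s (a * b) := hanti _ hd _ ha hd1 ha1 k1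
    have e2 : s b = s (a * b) := hanti _ hd _ hb hd1 hb1 k2
    have e3 : (1 - s a) * (1 - s a) = 1 - s a := by
      simp only [mul_sub, sub_mul, hidem a ha]; simp
    rw [e2, ← e1, e3] at h0
    exact hne a ha ha1 h0
  obtain ⟨a, ha, b, hb, hb1, hab⟩ := hrank
  have ha1 : a ≠ 1 := by simpa using hab 0
  have key : ∑ j ∈ range p, s (a * b ^ j) = s a := by
    rw [Finset.sum_congr rfl fun j _ =>
      hconst _ (A.mul_mem ha (A.pow_mem hb j)) a ha (hab j) ha1]
    simp [hpR]
  have key2 : ∑ j ∈ range p, s (a * b ^ j) = 1 := by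
    simp only [hs]
    rw [Finset.sum_comm]
    have : ∀ i ∈ range p, ∑ j ∈ range p, ((↑(a * b ^ j) : R)) ^ i
        = if i = 0 then 1 else s a := by
      intro i hi
      have h1 : ∀ j ∈ range p, ((↑(a * b ^ j) : R)) ^ i = (a : R) ^ i * ((↑(b ^ i) : R)) ^ j := by
        intro j _
        push_cast
        rw [((hcR a ha b hb).pow_right j).mul_pow, ← pow_mul, ← pow_mul, mul_comm i j]
      rw [Finset.sum_congr rfl h1, ← Finset.mul_sum]
      change (a : R) ^ i * s (b ^ i) = _
      split_ifs with h0
      · subst h0; simp [hs, hpR]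
      · have hbi : b ^ i ≠ 1 := by
          intro h
          have hd := orderOf_dvd_of_pow_eq_one h
          rw [orderOf_eq_prime (hp := ⟨hp⟩) (hexp b hb) hb1] at hd
          exact absurd (Nat.le_of_dvd (Nat.pos_of_ne_zero h0) hd) (by simpa using hi)
        rw [hconst _ (A.pow_mem hb i) a ha hbi ha1, hapow a ha]
    rw [Finset.sum_congr rfl this]
    obtain ⟨k, hk⟩ := hodd
    have hk1 : p = 2 * k + 1 := hk
    rw [hk1, Finset.sum_range_succ']
    simp only [Nat.add_eq_zero_iff, one_ne_zero, and_false, if_false, if_true, sum_const, card_range]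
    rw [nsmul_eq_mul]
    have : ((2 * k : ℕ) : R) = 0 := by
      have := hpR
      rw [hk1, Nat.cast_add, Nat.cast_one] at this
      simpa using this
    rw [this]; simp
  exact ha1 (hs1 a ha (key.symm.trans key2))

theorem units_core (B : Type*) [CommRing B] [Finite B] (h2 : (2 : B) = 0) (hcyc : IsCyclic Bˣ)
    (hodd : Odd (Nat.card Bˣ)) (f : ℕ) (hf : 2 ≤ f) (hN : Nat.card Bˣ ≡ 1 + 2 ^ f [MOD 2 ^ (f + 1)])
    (hcop : (Nat.card Bˣ).Coprime (2 ^ f - 1)) : False := by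
  classical
  have hred : IsReduced B := by
    rw [isReduced_iff_pow_one_lt 2 one_lt_two]
    intro x hx
    let u : Bˣ := ⟨1 + x, 1 + x, by linear_combination hx + h2 * x, by linear_combination hx + h2 * x⟩
    have hu2 : u ^ 2 = 1 := by
      ext; simp only [u, Units.val_pow_eq_pow_val, Units.val_one]; linear_combination hx + h2 * x
    have hu : u = 1 := by
      have hd : orderOf u ∣ Nat.gcd 2 (Nat.card Bˣ) :=
        Nat.dvd_gcd (orderOf_dvd_of_pow_eq_one hu2) (orderOf_dvd_natCard u)
      rw [Nat.coprime_two_left.2 hodd] at hd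
      exact orderOf_eq_one_iff.1 (Nat.dvd_one.1 hd)
    have := congrArg Units.val hu
    simpa [u] using this
  have : Fintype (MaximalSpectrum B) := Fintype.ofFinite _
  let Q : MaximalSpectrum B → Type _ := fun I => B ⧸ I.asIdeal
  let _ : ∀ I, Field (Q I) := fun I => Ideal.Quotient.field I.asIdeal
  have hfinQ : ∀ I, Finite (Q I) := fun I => Quotient.finite _
  have hd : ∀ I, ∃ d : ℕ, 1 ≤ d ∧ Nat.card (Q I)ˣ + 1 = 2 ^ d := by
    intro I
    have hQ2 : (2 : Q I) = 0 := by
      have := congrArg (Ideal.Quotient.mk I.asIdeal) h2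
      rw [map_zero, map_ofNat] at this
      exact this
    have : CharP (Q I) 2 := CharTwo.of_one_ne_zero_of_two_eq_zero one_ne_zero hQ2
    let _ : Fintype (Q I) := Fintype.ofFinite _
    obtain ⟨n, -, hn⟩ := FiniteField.card (Q I) 2
    refine ⟨n, n.2, ?_⟩
    rw [Nat.card_units, Nat.card_eq_fintype_card, hn]
    have : 0 < 2 ^ (n : ℕ) := by positivity
    omega
  choose d hd1 hd using hd
  let φ : Bˣ ≃* ∀ I, (Q I)ˣ :=
    (Units.mapEquiv (IsArtinianRing.equivPi B).toRingEquiv.toMulEquiv).trans MulEquiv.piUnits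
  have hcard : Nat.card Bˣ = ∏ I, Nat.card (Q I)ˣ := by
    rw [Nat.card_congr φ.toEquiv, Nat.card_pi]
  have hinj : ∀ I J, I ≠ J → (Nat.card (Q I)ˣ).Coprime (Nat.card (Q J)ˣ) := by
    intro I J hIJ
    let ψ : Bˣ →* (Q I)ˣ × (Q J)ˣ :=
      ((Pi.evalMonoidHom _ I).comp φ.toMonoidHom).prod ((Pi.evalMonoidHom _ J).comp φ.toMonoidHom)
    have hs : Function.Surjective ψ := by
      rintro ⟨x, y⟩
      refine ⟨φ.symm (Function.update (Function.update 1 I x) J y), ?_⟩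
      simp [ψ, Function.update_of_ne hIJ]
    have := isCyclic_of_surjective ψ hs
    exact coprime_card_of_isCyclic_prod _ _
  have h4 : 4 ∣ 2 ^ f := by
    obtain ⟨k, rfl⟩ := Nat.exists_eq_add_of_le hf
    exact ⟨2 ^ k, by rw [pow_add]; norm_num⟩
  have h4' : 4 ∣ 2 ^ (f + 1) := h4.trans ⟨2, by rw [pow_succ]⟩
  have hN4 : Nat.card Bˣ % 4 = 1 := by
    have : Nat.card Bˣ ≡ 1 + 2 ^ f [MOD 4] := hN.of_dvd h4'
    rw [Nat.ModEq] at this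
    omega
  have hex : ∃ I, 2 ≤ d I := by
    by_contra hno
    push Not at hno
    have : Nat.card Bˣ = 1 := by
      rw [hcard]
      refine Finset.prod_eq_one fun I _ => ?_
      have h1 := hd I
      have : d I = 1 := by have := hno I; have := hd1 I; omega
      rw [this] at h1; omega
    rw [this] at hN
    have h3 : (0 : ℕ) ≡ 2 ^ f [MOD 2 ^ (f + 1)] := Nat.ModEq.add_left_cancel' 1 hN
    have := (Nat.modEq_zero_iff_dvd.1 h3.symm)
    have := (Nat.pow_dvd_pow_iff_le_right (x := 2) (by norm_num)).1 this
    omega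
  obtain ⟨I0, hI0, hmin⟩ := Finset.exists_min_image (Finset.univ.filter fun I => 2 ≤ d I) d
    (by obtain ⟨I, hI⟩ := hex; exact ⟨I, by simpa using hI⟩)
  have hI2 : 2 ≤ d I0 := by simpa using hI0
  have hcast : ∀ I, ∀ n : ℕ, ((Nat.card (Q I)ˣ : ℕ) : ZMod n) = 2 ^ d I - 1 := by
    intro I n
    rw [eq_sub_iff_add_eq]; exact_mod_cast congrArg (Nat.cast (R := ZMod n)) (hd I)
  -- other factors are plus or minus one
  have hother : ∀ I, I ≠ I0 → ((Nat.card (Q I)ˣ : ℕ) : ZMod (2 ^ (d I0 + 1))) = 1 ∨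
      ((Nat.card (Q I)ˣ : ℕ) : ZMod (2 ^ (d I0 + 1))) = -1 := by
    intro I hI
    by_cases h : 2 ≤ d I
    · right
      have hle := hmin I (by simpa using h)
      have hne : d I ≠ d I0 := by
        intro he
        have hc := hinj I I0 hI
        have e1 := hd I
        have e2 := hd I0
        rw [he] at e1
        have : Nat.card (Q I)ˣ = Nat.card (Q I0)ˣ := by omega
        rw [this, Nat.coprime_self] at hc
        rw [hc] at e2
        have : 2 ^ 2 ≤ 2 ^ d I0 := Nat.pow_le_pow_right (by norm_num) hI2
        omega
      rw [hcast]
      have : (2 : ZMod (2 ^ (d I0 + 1))) ^ d I = 0 := by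
        have h1 : 2 ^ (d I0 + 1) ∣ 2 ^ d I := pow_dvd_pow 2 (by omega)
        have := (ZMod.natCast_eq_zero_iff _ _).2 h1
        exact_mod_cast this
      rw [this]; simp
    · left
      have h1 : d I = 1 := by have := hd1 I; omega
      rw [hcast, h1]; norm_num
  have hprod : ((∏ I ∈ Finset.univ.erase I0, Nat.card (Q I)ˣ : ℕ) : ZMod (2 ^ (d I0 + 1))) = 1 ∨
      ((∏ I ∈ Finset.univ.erase I0, Nat.card (Q I)ˣ : ℕ) : ZMod (2 ^ (d I0 + 1))) = -1 := by
    rw [Nat.cast_prod]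
    refine Finset.prod_induction _ (fun x => x = 1 ∨ x = -1) ?_ (Or.inl rfl) ?_
    · rintro a b (rfl | rfl) (rfl | rfl) <;> simp
    · intro I hI
      exact hother I (Finset.ne_of_mem_erase hI)
  have hfac : Nat.card Bˣ = Nat.card (Q I0)ˣ * ∏ I ∈ Finset.univ.erase I0, Nat.card (Q I)ˣ := by
    rw [hcard]
    exact (Finset.mul_prod_erase Finset.univ (fun I => Nat.card (Q I)ˣ) (Finset.mem_univ I0)).symm
  have h40 : 4 ∣ 2 ^ d I0 := by
    obtain ⟨k, hk⟩ := Nat.exists_eq_add_of_le hI2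
    exact ⟨2 ^ k, by rw [hk, pow_add]; norm_num⟩
  have hZ : (2 ^ (d I0 + 1) : ℤ) ∣ (Nat.card Bˣ : ℤ) - (1 + 2 ^ d I0) := by
    have hcN : ((Nat.card Bˣ : ℕ) : ZMod (2 ^ (d I0 + 1))) =
      (2 ^ d I0 - 1) * ((∏ I ∈ Finset.univ.erase I0, Nat.card (Q I)ˣ : ℕ) : ZMod (2 ^ (d I0 + 1))) := by
      rw [hfac, Nat.cast_mul, hcast]
    have h20 : (2 : ZMod (2 ^ (d I0 + 1))) ^ (d I0 + 1) = 0 := by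
      have := ZMod.natCast_self (2 ^ (d I0 + 1))
      exact_mod_cast this
    rcases hprod with h | h
    · exfalso
      rw [h, mul_one] at hcN
      have : ((Nat.card Bˣ + 1 : ℕ) : ZMod (2 ^ (d I0 + 1))) = ((2 ^ d I0 : ℕ) : ZMod _) := by
        push_cast; rw [hcN]; ring
      rw [ZMod.natCast_eq_natCast_iff] at this
      have h5 : Nat.card Bˣ + 1 ≡ 2 ^ d I0 [MOD 4] := this.of_dvd (h40.trans ⟨2, by rw [pow_succ]⟩)
      rw [Nat.ModEq] at h5
      omega
    · rw [h] at hcN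
      have : (((Nat.card Bˣ : ℤ) - (1 + 2 ^ d I0) : ℤ) : ZMod (2 ^ (d I0 + 1))) = 0 := by
        have aux : ∀ {S : Type} [CommRing S] (x N : S), x * 2 = 0 → N = (x - 1) * (-1) →
            N - (1 + x) = 0 := by
          intro S _ x N h1 h2
          rw [h2]; linear_combination - h1
        push_cast
        exact aux _ _ ((pow_succ _ _).symm.trans h20) hcN
      have := (ZMod.intCast_zmod_eq_zero_iff_dvd _ _).1 this
      exact_mod_cast this
  have hZf : (2 ^ (f + 1) : ℤ) ∣ (Nat.card Bˣ : ℤ) - (1 + 2 ^ f) := by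
    have := (Nat.modEq_iff_dvd.1 hN.symm)
    exact_mod_cast this
  have hdf : d I0 = f := by
    have aux : ∀ a b : ℕ, ∀ N : ℤ, (2 ^ (a + 1) : ℤ) ∣ N - (1 + 2 ^ a) →
        (2 ^ (b + 1) : ℤ) ∣ N - (1 + 2 ^ b) → ¬ a < b := by
      intro a b N ha hb hab
      have h1 : (2 ^ (a + 1) : ℤ) ∣ 2 ^ b := pow_dvd_pow 2 hab
      have h2 : (2 ^ (a + 1) : ℤ) ∣ 2 ^ (b + 1) := pow_dvd_pow 2 (by omega)
      have h3 : (2 ^ (a + 1) : ℤ) ∣ 2 ^ a := by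
        have := dvd_sub (dvd_add (h2.trans hb) h1) ha
        ring_nf at this ⊢
        exact this
      have h4 : (2 ^ (a + 1) : ℕ) ∣ 2 ^ a := by exact_mod_cast h3
      have := (Nat.pow_dvd_pow_iff_le_right (x := 2) (by norm_num)).1 h4
      omega
    have := aux _ _ _ hZ hZf
    have := aux _ _ _ hZf hZ
    omega
  have hdiv : 2 ^ f - 1 ∣ Nat.card Bˣ := by
    have e := hd I0
    rw [hdf] at e
    rw [← e, Nat.add_sub_cancel, hfac]
    exact dvd_mul_right _ _
  have h1 := Nat.eq_one_of_dvd_coprimes hcop hdiv dvd_rfl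
  have : 2 ^ 2 ≤ 2 ^ f := Nat.pow_le_pow_right (by norm_num) hf
  omega

theorem even_core {R : Type*} [Ring R] (A : Subgroup Rˣ) [Finite A] (hcyc : IsCyclic A)
    (hodd : Odd (Nat.card A))
    (hcent : ∀ c : Rˣ, (∀ a ∈ A, a * c = c * a) → c ∈ A)
    (f : ℕ) (hf : 2 ≤ f) (hN : Nat.card A ≡ 1 + 2 ^ f [MOD 2 ^ (f + 1)])
    (hcop : (Nat.card A).Coprime (2 ^ f - 1)) : False := by
  have h2 : (-1 : R) = 1 := by
    have h1 : (-1 : Rˣ) ∈ A := hcent _ (by intro a _; simp)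
    have h := pow_card_eq_one' (x := (⟨-1, h1⟩ : A))
    have h := congrArg Subtype.val h
    simp only [SubmonoidClass.mk_pow, hodd.neg_one_pow] at h
    simpa using congrArg Units.val h
  have h20 : (2 : R) = 0 := by rw [← one_add_one_eq_two]; nth_rewrite 1 [← h2]; simp
  let _ : CommGroup A := IsCyclic.commGroup
  have hcR : (2 : ℕ) = (0 : R) := by exact_mod_cast h20
  by_cases hR : Nontrivial R
  swap
  · have : Subsingleton R := not_nontrivial_iff_subsingleton.1 hR
    have h1 : Nat.card A = 1 := Nat.card_unique
    rw [h1] at hN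
    have h3 : (0 : ℕ) ≡ 2 ^ f [MOD 2 ^ (f + 1)] := Nat.ModEq.add_left_cancel' 1 hN
    have := (Nat.modEq_zero_iff_dvd.1 h3.symm)
    have := (Nat.pow_dvd_pow_iff_le_right (x := 2) (by norm_num)).1 this
    omega
  have : CharP R 2 := CharTwo.of_one_ne_zero_of_two_eq_zero one_ne_zero h20
  let _ : Algebra (ZMod 2) R := ZMod.algebra R 2
  let φ : MonoidAlgebra (ZMod 2) A →ₐ[ZMod 2] R :=
    MonoidAlgebra.lift (ZMod 2) R A ((Units.coeHom R).comp A.subtype)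
  have hφ : ∀ a : A, φ (MonoidAlgebra.single a 1) = ((a : Rˣ) : R) := by
    intro a; simp [φ]
  let B := MonoidAlgebra (ZMod 2) A ⧸ RingHom.ker φ.toRingHom
  have : Finite (MonoidAlgebra (ZMod 2) A) := by
    have : Finite (A →₀ ZMod 2) :=
      Finite.of_injective (fun g => (g : A → ZMod 2)) DFunLike.coe_injective
    exact Finite.of_injective (fun g => g.coeff) MonoidAlgebra.coeff_injective
  have : Finite B := Quotient.finite _
  let κ : B →+* R := RingHom.kerLift φ.toRingHom
  have hκ : Function.Injective κ := RingHom.kerLift_injective _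
  have hκa : ∀ a : A, κ (Ideal.Quotient.mk _ (MonoidAlgebra.single a 1)) = ((a : Rˣ) : R) := hφ
  have hB2 : (2 : B) = 0 := hκ (by rw [map_ofNat, map_zero, h20])
  let ψ : Bˣ →* Rˣ := Units.map κ.toMonoidHom
  have hψ : Function.Injective ψ := Units.map_injective hκ
  have hrange : ψ.range = A := by
    apply le_antisymm
    · rintro _ ⟨u, rfl⟩
      apply hcent
      intro a ha
      apply Units.ext
      rw [Units.val_mul, Units.val_mul, ← hκa ⟨a, ha⟩]
      change κ _ * κ u = κ u * κ _
      rw [← map_mul, ← map_mul, mul_comm]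
    · intro a ha
      let j : A →* B := (Ideal.Quotient.mk (RingHom.ker φ.toRingHom)).toMonoidHom.comp
        (MonoidAlgebra.of (ZMod 2) A)
      refine ⟨j.toHomUnits ⟨a, ha⟩, ?_⟩
      apply Units.ext
      exact hκa ⟨a, ha⟩
  let e : Bˣ ≃* A := (MonoidHom.ofInjective hψ).trans (MulEquiv.subgroupCongr hrange)
  have hc : Nat.card Bˣ = Nat.card A := Nat.card_congr e.toEquiv
  exact units_core B hB2 (e.isCyclic.2 hcyc) (hc ▸ hodd) f hf (hc ▸ hN) (hc ▸ hcop)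

theorem sl_ext {F : Type*} [Field F] {m : ℕ} {M N : Matrix.SpecialLinearGroup (Fin m) F}
    (h : (M : Matrix (Fin m) (Fin m) F) = (N : Matrix (Fin m) (Fin m) F)) : M = N := Subtype.ext h

theorem sl_coe {F : Type*} [Field F] {m : ℕ} {M N : Matrix.SpecialLinearGroup (Fin m) F}
    (h : M = N) : (M : Matrix (Fin m) (Fin m) F) = (N : Matrix (Fin m) (Fin m) F) := by rw [h]

theorem sl_mul {F : Type*} [Field F] {m : ℕ} (M N : Matrix.SpecialLinearGroup (Fin m) F) :
    ((M * N : Matrix.SpecialLinearGroup (Fin m) F) : Matrix (Fin m) (Fin m) F) =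
      (M : Matrix (Fin m) (Fin m) F) * (N : Matrix (Fin m) (Fin m) F) := rfl

theorem sl_one {F : Type*} [Field F] {m : ℕ} :
    ((1 : Matrix.SpecialLinearGroup (Fin m) F) : Matrix (Fin m) (Fin m) F) = 1 := rfl

theorem exists_root {F : Type*} [Field F] [Fintype F] {m : ℕ}
    (hgcd : Nat.gcd (Fintype.card F - 1) m = 1) (c : F) (hc : c ≠ 0) : ∃ z : F, z ^ m = c := by
  have h : (Nat.card Fˣ).Coprime m := by
    rw [Nat.card_units, Nat.card_eq_fintype_card]; exact hgcd
  refine ⟨((powCoprime h).symm (Units.mk0 c hc) : Fˣ), ?_⟩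
  have := (powCoprime h).apply_symm_apply (Units.mk0 c hc)
  rw [powCoprime_apply] at this
  simpa using congrArg Units.val this

theorem root_unique {F : Type*} [Field F] [Fintype F] {m : ℕ} (hm : m ≠ 0)
    (hgcd : Nat.gcd (Fintype.card F - 1) m = 1) (z : F) (hz : z ^ m = 1) : z = 1 := by
  have h : (Nat.card Fˣ).Coprime m := by
    rw [Nat.card_units, Nat.card_eq_fintype_card]; exact hgcd
  have hz0 : z ≠ 0 := by
    rintro rfl
    rw [zero_pow hm] at hz
    exact zero_ne_one hz
  have := (powCoprime h).injective (a₁ := Units.mk0 z hz0) (a₂ := 1) (by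
    rw [powCoprime_apply, powCoprime_apply]; ext; simpa using hz)
  simpa using congrArg Units.val this

open Matrix in
theorem odd_case {R F : Type*} [Ring R] [Field F] [Fintype F] (n : ℕ)
    (hgcd : Nat.gcd (Fintype.card F - 1) (n + 3) = 1) (p : ℕ) [CharP F p] (hp : p.Prime)
    (hodd : Odd p) (e : Rˣ ≃* SpecialLinearGroup (Fin (n + 3)) F) : False := by
  classical
  let ε : Fin (n + 3) → F := Pi.single 0 1
  have hε : ∀ v : Fin (n + 3) → F, v ⬝ᵥ ε = v 0 := fun v => by simp [ε]
  have hmul : ∀ v w : Fin (n + 3) → F, v 0 = 0 →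
      (1 + vecMulVec ε v) * (1 + vecMulVec ε w) = 1 + vecMulVec ε (v + w) := by
    intro v w hv
    rw [add_mul, mul_add, mul_add, vecMulVec_mul_vecMulVec, hε, hv, vecMulVec_add]
    simp only [one_mul, mul_one, zero_smul, vecMulVec_zero]; abel
  have hdet : ∀ x v : Fin (n + 3) → F, (1 + vecMulVec x v).det = 1 + v ⬝ᵥ x := by
    intro x v
    rw [vecMulVec_eq Unit, det_one_add_replicateCol_mul_replicateRow]
  let V := {v : Fin (n + 3) → F // v 0 = 0}
  let t : V → SpecialLinearGroup (Fin (n + 3)) F := fun v =>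
    ⟨1 + vecMulVec ε v.1, by rw [hdet, hε, v.2, add_zero]⟩
  have htv : ∀ v : V, ((t v : SpecialLinearGroup (Fin (n + 3)) F) : Matrix _ _ F) = 1 + vecMulVec ε v.1 :=
    fun _ => rfl
  have ht0 : ∀ h, t ⟨0, h⟩ = 1 := by
    intro h; apply sl_ext; rw [htv]; simp
  have htmul : ∀ v w : V, t v * t w = t ⟨v.1 + w.1, by simp [v.2, w.2]⟩ := by
    intro v w
    apply sl_ext
    rw [sl_mul, htv, htv, hmul _ _ v.2]
  have htpow : ∀ (v : V) (j : ℕ), t v ^ j = t ⟨j • v.1, by simp [v.2]⟩ := by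
    intro v j
    induction j with
    | zero => simp only [pow_zero, zero_smul]; exact (ht0 _).symm
    | succ k ih => rw [pow_succ, ih, htmul]; congr 1; apply Subtype.ext; exact (succ_nsmul v.1 k).symm
  let A : Subgroup (SpecialLinearGroup (Fin (n + 3)) F) :=
    { carrier := Set.range t
      mul_mem' := by
        rintro _ _ ⟨v, rfl⟩ ⟨w, rfl⟩
        exact ⟨_, (htmul v w).symm⟩
      one_mem' := ⟨⟨0, rfl⟩, ht0 _⟩
      inv_mem' := by
        rintro _ ⟨v, rfl⟩
        refine ⟨⟨-v.1, by simp [v.2]⟩, ?_⟩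
        rw [eq_inv_iff_mul_eq_one, htmul]
        simp only [neg_add_cancel]; exact ht0 _ }
  have hAm : ∀ v, t v ∈ A := fun v => ⟨v, rfl⟩
  have hcomm : ∀ a ∈ A, ∀ b ∈ A, a * b = b * a := by
    rintro _ ⟨v, rfl⟩ _ ⟨w, rfl⟩
    rw [htmul, htmul]; congr 1; apply Subtype.ext; simp [add_comm]
  have hexp : ∀ a ∈ A, a ^ p = 1 := by
    rintro _ ⟨v, rfl⟩
    rw [htpow]
    rw [← ht0 rfl]; congr 1; apply Subtype.ext
    funext i; simp
  have hcent : ∀ c, (∀ a ∈ A, a * c = c * a) → c ∈ A := by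
    intro c hc
    have key : ∀ k : Fin (n + 3), k ≠ 0 → ∀ i j, ε i * c.1 k j = c.1 i 0 * (Pi.single k 1 : Fin (n + 3) → F) j := by
      intro k hk i j
      have h := sl_coe (hc _ (hAm ⟨Pi.single k 1, by simp [hk.symm]⟩))
      rw [sl_mul, sl_mul, htv] at h
      rw [add_mul, mul_add, one_mul, mul_one, add_right_inj, vecMulVec_mul, mul_vecMulVec] at h
      have h := congrFun (congrFun h i) j
      simpa [vecMulVec_apply, ε] using h
    have hrow : ∀ k : Fin (n + 3), k ≠ 0 → ∀ j, c.1 k j = c.1 0 0 * (Pi.single k 1 : Fin (n + 3) → F) j := by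
      intro k hk j
      simpa [ε] using key k hk 0 j
    have hd : c.1.det = c.1 0 0 ^ (n + 3) := by
      rw [det_of_isUpperTriangular]
      · rw [Finset.prod_congr rfl (g := fun _ => c.1 0 0)]
        · simp
        · intro i _
          by_cases hi : i = 0
          · rw [hi]
          · rw [hrow i hi]; simp
      · intro i j hij
        have hij : j < i := hij
        have hi : i ≠ 0 := by rintro rfl; exact absurd hij (by simp)
        rw [hrow i hi]; simp [hij.ne]
    have h1 : c.1 0 0 = 1 := root_unique (by omega) hgcd _ (hd ▸ c.2)
    refine ⟨⟨fun j => if j = 0 then 0 else c.1 0 j, by simp⟩, ?_⟩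
    apply sl_ext
    rw [htv]
    ext i j
    by_cases hi : i = 0
    · subst hi
      by_cases hj : j = 0
      · subst hj; simp [vecMulVec_apply, h1]
      · simp [vecMulVec_apply, hj, ε, Ne.symm hj]
    · rw [hrow i hi, h1]
      simp [vecMulVec_apply, ε, hi, Matrix.one_apply, Pi.single_apply, eq_comm]
  have hconj : ∀ a ∈ A, ∀ b ∈ A, a ≠ 1 → b ≠ 1 → ∃ g, g * a * g⁻¹ = b := by
    rintro _ ⟨v, rfl⟩ _ ⟨w, rfl⟩ hv hw
    have hv' : v.1 ≠ 0 := by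
      intro h; apply hv; rw [← ht0 rfl]; congr 1; exact Subtype.ext h
    have hw' : w.1 ≠ 0 := by
      intro h; apply hw; rw [← ht0 rfl]; congr 1; exact Subtype.ext h
    obtain ⟨i, hi⟩ := Function.ne_iff.1 hw'
    obtain ⟨j, hj⟩ := Function.ne_iff.1 hv'
    have hx : ∃ x : Fin (n + 3) → F, w.1 ⬝ᵥ x ≠ 0 ∧ v.1 ⬝ᵥ x ≠ 0 := by
      by_cases h1 : v.1 i = 0
      · by_cases h2 : w.1 j = 0
        · refine ⟨Pi.single i 1 + Pi.single j 1, ?_, ?_⟩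
          · simpa [dotProduct_add, h2] using hi
          · simpa [dotProduct_add, h1] using hj
        · exact ⟨Pi.single j 1, by simpa using h2, by simpa using hj⟩
      · exact ⟨Pi.single i 1, by simpa using hi, by simpa using h1⟩
    obtain ⟨x0, hx1, hx2⟩ := hx
    obtain ⟨x, hx1, hx2⟩ : ∃ x : Fin (n + 3) → F, w.1 ⬝ᵥ x = 1 ∧ v.1 ⬝ᵥ x ≠ 0 :=
      ⟨(w.1 ⬝ᵥ x0)⁻¹ • x0, by simp [hx1], by simp [hx1, hx2]⟩
    let P : Matrix (Fin (n + 3)) (Fin (n + 3)) F := 1 + vecMulVec x (v.1 - w.1)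
    have hP : P.det = v.1 ⬝ᵥ x := by
      simp only [P]; rw [hdet, sub_dotProduct, hx1]; ring
    obtain ⟨z, hz⟩ := exists_root hgcd (P.det)⁻¹ (inv_ne_zero (hP ▸ hx2))
    let g : SpecialLinearGroup (Fin (n + 3)) F := ⟨z • P, by
      rw [det_smul, Fintype.card_fin, hz, inv_mul_cancel₀ (hP ▸ hx2)]⟩
    refine ⟨g, ?_⟩
    rw [mul_inv_eq_iff_eq_mul]
    apply sl_ext
    rw [sl_mul, sl_mul, htv, htv]
    change z • P * _ = _ * (z • P)
    rw [smul_mul_assoc, mul_smul_comm]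
    congr 1
    have q1 : P * vecMulVec ε v.1 = vecMulVec ε v.1 := by
      simp only [P]
      rw [add_mul, one_mul, vecMulVec_mul_vecMulVec, hε]
      simp [v.2, w.2]
    have q2 : vecMulVec ε w.1 * P = vecMulVec ε v.1 := by
      simp only [P]
      rw [mul_add, mul_one, vecMulVec_mul_vecMulVec, hx1, one_smul, ← vecMulVec_add]
      simp
    rw [mul_add P, add_mul 1 (vecMulVec ε w.1) P, q1, q2, mul_one, one_mul]
  have hentry : ∀ v : V, t v = 1 → v.1 = 0 := by
    intro v h
    funext k
    have h := congrFun (congrFun (sl_coe h) 0) k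
    rw [htv, sl_one, Matrix.add_apply, vecMulVec_apply] at h
    simpa [ε] using h
  have hrank : ∃ a ∈ A, ∃ b ∈ A, b ≠ 1 ∧ ∀ j : ℕ, a * b ^ j ≠ 1 := by
    have h10 : (1 : Fin (n + 3)) ≠ 0 := by simp [Fin.ext_iff]
    have h20 : (2 : Fin (n + 3)) ≠ 0 := by
      intro h
      have := congrArg Fin.val h
      simp [Nat.mod_eq_of_lt] at this
    have h12 : (1 : Fin (n + 3)) ≠ 2 := by
      intro h
      have := congrArg Fin.val h
      simp [Fin.val_one, Nat.mod_eq_of_lt] at this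
    refine ⟨_, hAm ⟨Pi.single 1 1, by simp [h10.symm]⟩, _, hAm ⟨Pi.single 2 1, by simp [h20.symm]⟩,
      ?_, ?_⟩
    · intro h
      have := congrFun (hentry _ h) 2
      simp at this
    · intro j h
      rw [htpow, htmul] at h
      have := congrFun (hentry _ h) 1
      simp [h12] at this
  have hfin : Finite Rˣ := Finite.of_equiv _ e.symm.toEquiv
  refine odd_core hfin (A.comap e.toMonoidHom) p hp hodd ?_ ?_ ?_ ?_ ?_
  · intro a ha b hb
    apply e.injective
    rw [map_mul, map_mul]; exact hcomm _ ha _ hb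
  · intro c hc
    refine hcent (e c) fun a ha => ?_
    have := congrArg e (hc (e.symm a) (by simpa using ha))
    simpa using this
  · intro a ha
    apply e.injective
    rw [map_pow, map_one]; exact hexp _ ha
  · intro a ha b hb ha1 hb1
    obtain ⟨g, hg⟩ := hconj _ ha _ hb (by simpa using ha1) (by simpa using hb1)
    refine ⟨e.symm g, e.injective ?_⟩
    simpa using hg
  · obtain ⟨a, ha, b, hb, hb1, hab⟩ := hrank
    refine ⟨e.symm a, by simpa using ha, e.symm b, by simpa using hb, by simpa using hb1, ?_⟩
    intro j h
    apply hab j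
    have := congrArg e h
    simpa using this

open Matrix in
theorem even_case {R F : Type*} [Ring R] [Field F] [Fintype F] (m : ℕ) (hm : 2 ≤ m)
    (hgcd : Nat.gcd (Fintype.card F - 1) m = 1) [CharP F 2] (f : ℕ) (hf : 2 ≤ f)
    (hF : Fintype.card F = 2 ^ f) (e : Rˣ ≃* SpecialLinearGroup (Fin m) F) : False := by
  classical
  have : NeZero m := ⟨by omega⟩
  have : Fact (Nat.Prime 2) := ⟨Nat.prime_two⟩
  let K := FiniteField.Extension F 2 m
  let _ : Field K := inferInstanceAs (Field (FiniteField.Extension F 2 m))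
  let _ : Algebra F K := inferInstanceAs (Algebra F (FiniteField.Extension F 2 m))
  have hKfin : Finite K := inferInstanceAs (Finite (FiniteField.Extension F 2 m))
  have : Module.Finite F K := inferInstanceAs (Module.Finite F (FiniteField.Extension F 2 m))
  have hrk : Module.finrank F K = m := FiniteField.finrank_extension F 2 m
  have hcK : Nat.card K = Fintype.card F ^ m := by
    rw [← Nat.card_eq_fintype_card]; exact FiniteField.natCard_extension F 2 m
  let b : Module.Basis (Fin m) F K := Module.finBasisOfFinrankEq F K hrk
  let ν : Kˣ →* Fˣ := Units.map (Algebra.norm F (S := K))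
  let L : ν.ker →* SpecialLinearGroup (Fin m) F :=
    { toFun := fun x => ⟨Algebra.leftMulMatrix b ((x : Kˣ) : K), by
        rw [← Algebra.norm_eq_matrix_det]
        have := congrArg Units.val (MonoidHom.mem_ker.1 x.2)
        simpa [ν] using this⟩
      map_one' := by apply sl_ext; simp
      map_mul' := by
        intro x y; apply sl_ext
        exact map_mul (Algebra.leftMulMatrix b) _ _ }
  have hLv : ∀ x, (L x).1 = Algebra.leftMulMatrix b ((x : Kˣ) : K) := fun _ => rfl
  have hLinj : Function.Injective L := by
    intro x y h
    apply Subtype.ext; apply Units.ext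
    exact Algebra.leftMulMatrix_injective b (congrArg Subtype.val h)
  have hdec : ∀ k : K, k ≠ 0 → ∃ (x : ν.ker) (z : F), k = z • ((x : Kˣ) : K) := by
    intro k hk
    have hnk : Algebra.norm F k ≠ 0 := Algebra.norm_ne_zero_iff.2 hk
    obtain ⟨z, hz⟩ := exists_root hgcd _ hnk
    have hz0 : z ≠ 0 := by
      rintro rfl
      rw [zero_pow (by omega)] at hz
      exact hnk hz.symm
    have hx0 : z⁻¹ • k ≠ 0 := smul_ne_zero (inv_ne_zero hz0) hk
    refine ⟨⟨Units.mk0 (z⁻¹ • k) hx0, ?_⟩, z, ?_⟩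
    · rw [MonoidHom.mem_ker]
      apply Units.ext
      simp only [ν, Units.coe_map, Units.val_mk0, Units.val_one]
      rw [Algebra.smul_def, map_mul, Algebra.norm_algebraMap, hrk, inv_pow, hz,
        inv_mul_cancel₀ hnk]
    · simp [hz0]
  have hcent : ∀ c, (∀ a ∈ L.range, a * c = c * a) → c ∈ L.range := by
    intro c hc
    let g : K →ₗ[F] K := Matrix.toLin b b c.1
    have hg : LinearMap.toMatrix b b g = c.1 := LinearMap.toMatrix_toLin b b c.1
    have hx : ∀ (x : ν.ker) (y : K), g (((x : Kˣ) : K) * y) = ((x : Kˣ) : K) * g y := by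
      intro x y
      have h := sl_coe (hc _ ⟨x, rfl⟩)
      rw [sl_mul, sl_mul, hLv, ← hg,
        Algebra.leftMulMatrix_apply, ← LinearMap.toMatrix_mul, ← LinearMap.toMatrix_mul] at h
      have h := (LinearMap.toMatrix b b).injective h
      have h := LinearMap.congr_fun h y
      simpa using h.symm
    have hk : ∀ k : K, g k = g 1 * k := by
      intro k
      by_cases hk0 : k = 0
      · simp [hk0]
      obtain ⟨x, z, rfl⟩ := hdec k hk0
      have := hx x 1
      rw [mul_one] at this
      rw [map_smul, this, mul_smul_comm, mul_comm]
    have hM : Algebra.leftMulMatrix b (g 1) = c.1 := by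
      rw [Algebra.leftMulMatrix_apply, ← hg]
      congr 1
      ext k
      simp [hk k]
    have hn : Algebra.norm F (g 1) = 1 := by
      rw [Algebra.norm_eq_matrix_det b, hM]; exact c.2
    have h10 : g 1 ≠ 0 := by
      intro h; rw [h, Algebra.norm_zero] at hn; exact zero_ne_one hn
    refine ⟨⟨Units.mk0 (g 1) h10, ?_⟩, ?_⟩
    · rw [MonoidHom.mem_ker]
      apply Units.ext
      simpa [ν] using hn
    · apply sl_ext
      rw [hLv]; exact hM
  have hq : 1 < Fintype.card F := Fintype.one_lt_card
  set q := Fintype.card F with hqdef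
  have hcardL : Nat.card L.range = ∑ i ∈ Finset.range m, q ^ i := by
    have h1 : Nat.card L.range = Nat.card ν.ker :=
      Nat.card_congr (MonoidHom.ofInjective hLinj).symm.toEquiv
    have h2 : Nat.card ν.ker * ν.ker.index = Nat.card Kˣ := Subgroup.card_mul_index _
    rw [Subgroup.index_ker, MonoidHom.range_eq_top.2 (FiniteField.unitsMap_norm_surjective F K),
      Subgroup.card_top, Nat.card_units, Nat.card_units, hcK, Nat.card_eq_fintype_card (α := F)] at h2
    rw [h1, Nat.geomSum_eq hq]
    exact (Nat.div_eq_of_eq_mul_left (by omega) h2.symm).symm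
  have hcyc : IsCyclic L.range := by
    have : IsCyclic ν.ker := inferInstance
    exact (MonoidHom.ofInjective hLinj).isCyclic.1 this
  obtain ⟨r, hr⟩ : ∃ r, ∑ i ∈ Finset.range m, q ^ i = 1 + q + q ^ 2 * r := by
    obtain ⟨k, rfl⟩ := Nat.exists_eq_add_of_le hm
    refine ⟨∑ i ∈ Finset.range k, q ^ i, ?_⟩
    rw [Finset.sum_range_add, Finset.mul_sum]
    simp [Finset.sum_range_succ, pow_add]
  have hodd : Odd (Nat.card L.range) := by
    rw [hcardL, hr]
    have : Even q := by rw [hF]; exact (Nat.even_pow.2 ⟨even_two, by omega⟩)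
    obtain ⟨k, hk⟩ := this
    exact ⟨k + k * q * r, by rw [pow_two]; nth_rewrite 1 2 [hk]; ring⟩
  have hN : Nat.card L.range ≡ 1 + 2 ^ f [MOD 2 ^ (f + 1)] := by
    rw [hcardL, hr]
    have h : q ^ 2 * r ≡ 0 [MOD 2 ^ (f + 1)] := by
      rw [Nat.modEq_zero_iff_dvd, hF, ← pow_mul]
      exact Dvd.dvd.mul_right (pow_dvd_pow 2 (by omega)) _
    have := h.add_left (1 + q)
    rw [← hF]; exact this
  have hcop : (Nat.card L.range).Coprime (2 ^ f - 1) := by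
    rw [hcardL, ← hF]
    have h : ∑ i ∈ Finset.range m, q ^ i ≡ m [MOD (q - 1)] := by
      have h1 : q ≡ 1 [MOD (q - 1)] := ((Nat.modEq_iff_dvd' hq.le).2 dvd_rfl).symm
      have h2 : ∑ i ∈ Finset.range m, q ^ i ≡ ∑ i ∈ Finset.range m, 1 [MOD (q - 1)] := by
        apply Nat.ModEq.sum
        intro i _
        simpa using h1.pow i
      simpa using h2
    rw [Nat.Coprime, h.gcd_eq, Nat.gcd_comm]; exact hgcd
  let e' : (L.range.comap e.toMonoidHom) ≃* L.range := 
    { toFun := fun x => ⟨e x.1, x.2⟩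
      invFun := fun y => ⟨e.symm y.1, by simp⟩
      left_inv := fun x => Subtype.ext (e.symm_apply_apply x.1)
      right_inv := fun y => Subtype.ext (e.apply_symm_apply y.1)
      map_mul' := fun x y => Subtype.ext (map_mul e x.1 y.1) }
  have hc : Nat.card (L.range.comap e.toMonoidHom) = Nat.card L.range := Nat.card_congr e'.toEquiv
  have : Finite (L.range.comap e.toMonoidHom) := Finite.of_equiv _ e'.symm.toEquiv
  refine even_core (L.range.comap e.toMonoidHom) (e'.isCyclic.2 hcyc) (hc ▸ hodd) ?_ f hf
    (hc ▸ hN) (hc ▸ hcop)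
  intro c hc
  refine hcent (e c) fun a ha => ?_
  have := congrArg e (hc (e.symm a) (by simpa using ha))
  simpa using this

universe u

/-- Let `F` be a finite field of cardinality `q` and let `m ≥ 2` satisfy
`gcd(q - 1, m) = 1`. Then `SL_m(F)` is realizable if and only if `q = 2`. -/
theorem slm_realizable_iff (F : Type*) [Field F] [Fintype F] (m : ℕ) (hm : 2 ≤ m)
    (hgcd : Nat.gcd (Fintype.card F - 1) m = 1) :
    (∃ (R : Type u) (_ : Ring R),
        Nonempty (Rˣ ≃* Matrix.SpecialLinearGroup (Fin m) F)) ↔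
      Fintype.card F = 2 := by
  constructor
  · rintro ⟨R, _, ⟨e⟩⟩
    by_contra hne
    obtain ⟨p, hchar⟩ := CharP.exists F
    obtain ⟨f, hp, hF⟩ := FiniteField.card F p
    rcases hp.eq_two_or_odd' with rfl | hodd
    · refine even_case (R := R) m hm hgcd f ?_ hF e
      have : 0 < (f : ℕ) := f.2
      by_contra h
      have h1 : (f : ℕ) = 1 := by omega
      rw [h1] at hF
      exact hne (by simpa using hF)
    · have hq : Odd (Fintype.card F) := by rw [hF]; exact hodd.pow
      have hmo : m ≠ 2 := by
        rintro rfl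
        obtain ⟨k, hk⟩ := hq
        rw [hk, Nat.add_sub_cancel] at hgcd
        simp at hgcd
      obtain ⟨n, rfl⟩ : ∃ n, m = n + 3 := ⟨m - 3, by omega⟩
      exact odd_case n hgcd p hp hodd e
  · intro h2
    classical
    let k := ULift.{u} (ZMod 2)
    have hk : Fintype.card F = Fintype.card (ZMod 2) := by rw [h2, ZMod.card]
    have : Fact (Nat.Prime 2) := ⟨Nat.prime_two⟩
    let φ : F ≃+* ZMod 2 := FiniteField.ringEquivOfCardEq hk
    let ψ : k ≃+* F := ULift.ringEquiv.trans φ.symm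
    let σ : (Matrix (Fin m) (Fin m) k)ˣ ≃* (Matrix (Fin m) (Fin m) F)ˣ :=
      Units.mapEquiv ψ.mapMatrix.toMulEquiv
    have h1 : ∀ x : F, x ≠ 0 → x = 1 := by
      intro x hx
      have := FiniteField.pow_card_sub_one_eq_one x hx
      rw [h2] at this
      simpa using this
    have hdet : ∀ M : (Matrix (Fin m) (Fin m) F)ˣ, M.1.det = 1 := fun M =>
      h1 _ ((Matrix.isUnit_iff_isUnit_det _).1 M.isUnit).ne_zero
    let τ : (Matrix (Fin m) (Fin m) F)ˣ ≃* Matrix.SpecialLinearGroup (Fin m) F :=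
      { toFun := fun M => ⟨M.1, hdet M⟩
        invFun := fun M => ⟨M.1, (M⁻¹).1,
          by rw [← Matrix.SpecialLinearGroup.coe_mul]; simp,
          by rw [← Matrix.SpecialLinearGroup.coe_mul]; simp⟩
        left_inv := fun M => Units.ext rfl
        right_inv := fun M => rfl
        map_mul' := fun M N => rfl }
    exact ⟨Matrix (Fin m) (Fin m) k, inferInstance, ⟨σ.trans τ⟩⟩
end

section
/- Let F be a finite field of characteristic 2 and cardinality 2^k, and let c be a nonnegative integer. There exists a unital ring R of characteristic c with R^× isomorphic to SL_2(F) if and only if k = 1 and c = 2. -/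
universe u

theorem aux_commRing {B : Type*} [CommRing B] [CharP B 2] (k : ℕ) (hk : 2 ≤ k) (t : B)
    (ht : t ^ (2 ^ k + 1) = 1) (hc : ∀ v : Bˣ, v ^ (2 ^ k + 1) = 1) : t ^ 6 = 1 := by
  have : Fact (Nat.Prime 2) := ⟨Nat.prime_two⟩
  have h2 : (2 : B) = 0 := CharTwo.two_eq_zero
  have hfrob : ∀ (x y : B) (n : ℕ), (x + y) ^ (2 ^ n) = x ^ (2 ^ n) + y ^ (2 ^ n) :=
    fun x y n => add_pow_char_pow x y 2 n
  obtain ⟨s, hs⟩ : ∃ s, t ^ (2 ^ k) = s := ⟨_, rfl⟩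
  have hts : s * t = 1 := by rw [← hs, ← pow_succ, ht]
  have hsq : s ^ (2 ^ k) = t := by
    have : s ^ (2 ^ k) * s = 1 := by
      rw [← pow_succ, ← hs, ← pow_mul, mul_comm, pow_mul, ht, one_pow]
    calc s ^ (2 ^ k) = s ^ (2 ^ k) * s * t := by rw [mul_assoc, hts, mul_one]
      _ = t := by rw [this, one_mul]
  obtain ⟨N, hN⟩ : ∃ N, (2 ^ k) * (2 ^ k) = N + 2 := by
    have h4 : 2 ^ 2 ≤ 2 ^ k := Nat.pow_le_pow_right (by norm_num) hk
    exact ⟨2 ^ k * 2 ^ k - 2, by have : 2 * 2 ≤ 2 ^ k * 2 ^ k := by nlinarith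
                                 omega⟩
  obtain ⟨x, hx⟩ : ∃ x, x = 1 + t := ⟨_, rfl⟩
  have hxq : x ^ (2 ^ k) = 1 + s := by rw [hx, hfrob, hs, one_pow]
  have hxN : x ^ N * x * x = x := by
    rw [mul_assoc, ← sq, ← pow_add, ← hN, pow_mul, hxq, hfrob, hsq, one_pow, hx]
  obtain ⟨y, hy⟩ : ∃ y, x ^ N = y := ⟨_, rfl⟩
  rw [hy] at hxN
  have hyx : y * x * y = y := by
    have hN2 : 2 ≤ 2 ^ k * 2 ^ k - 2 := by
      have h4 : 2 ^ 2 ≤ 2 ^ k := Nat.pow_le_pow_right (by norm_num) hk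
      have : 4 * 4 ≤ 2 ^ k * 2 ^ k := Nat.mul_le_mul h4 h4
      omega
    obtain ⟨M, rfl⟩ : ∃ M, N = M + 1 := ⟨N - 1, by omega⟩
    have : y = x ^ M * x := by rw [← hy, pow_succ]
    calc y * x * y = x ^ M * (y * x * x) := by rw [this]; ring
      _ = y := by rw [hxN, this]
  obtain ⟨e, he⟩ : ∃ e, e = y * x := ⟨_, rfl⟩
  have hee : e * e = e := by rw [he]; linear_combination x * hyx
  have hex : e * x = x := by rw [he, hxN]
  have hey : e * y = y := by rw [he, hyx]
  have hen : ∀ n, e ^ (n + 1) = e := by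
    intro n
    induction n with
    | zero => simp
    | succ n ih => rw [pow_succ, ih, hee]
  have heq : e ^ (2 ^ k) = e := by
    obtain ⟨m, hm⟩ := Nat.exists_eq_succ_of_ne_zero (show (2 ^ k : ℕ) ≠ 0 by positivity)
    rw [hm]; exact hen m
  have hv : (x + 1 + e) * (y + 1 + e) = 1 := by
    linear_combination hex + hey + hee - he + (x + y + 2 * e) * h2
  have hvq := congrArg Units.val (hc ⟨x + 1 + e, y + 1 + e, hv, by rw [mul_comm, hv]⟩)
  simp only [Units.val_pow_eq_pow_val, Units.val_one] at hvq
  rw [pow_succ, hfrob, hfrob, hxq, heq, one_pow] at hvq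
  have hes : e * (1 + s) = 1 + s := by
    rw [← hxq, ← heq, ← mul_pow, hex]
  have h1 : e * (1 + s + 1 + e) = 1 + s := by linear_combination hes + hee + e * h2
  have h3 : (1 + s) * (x + 1 + e) = e := by
    calc (1 + s) * (x + 1 + e) = e * ((1 + s + 1 + e) * (x + 1 + e)) := by
          rw [← mul_assoc, h1]
      _ = e := by rw [hvq, mul_one]
  have key : (1 + s) * x = e := by linear_combination h3 - hes - (1 + s) * h2
  have he' : e = s + t := by
    rw [← key, hx]; linear_combination hts + h2
  rw [he'] at hee
  have h5 : t ^ 4 + 1 = t + t ^ 3 := by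
    linear_combination t ^ 2 * hee - (s * t + 1) * hts + t * hts - t ^ 3 * s * h2
  linear_combination (t ^ 2 + t + 1) * h5 + (t ^ 3 - 1) * h2

open scoped IsMulCommutative in
theorem aux_ring_s8 {R : Type*} [Ring R] [CharP R 2] (k : ℕ) (hk : 2 ≤ k) (t : Rˣ)
    (ht : t ^ (2 ^ k + 1) = 1) (hc : ∀ v : Rˣ, v * t = t * v → v ^ (2 ^ k + 1) = 1) :
    t ^ 3 = 1 := by
  have hcomm : ∀ a ∈ ({(t : R)} : Set R), ∀ b ∈ ({(t : R)} : Set R), a * b = b * a := by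
    rintro a rfl b rfl; rfl
  let B := Subring.closure {(t : R)}
  have : IsMulCommutative B := Subring.isMulCommutative_closure hcomm
  let t' : B := ⟨t, Subring.subset_closure rfl⟩
  have htt : t' ^ (2 ^ k + 1) = 1 := by
    apply Subtype.ext
    simpa [t'] using congrArg Units.val ht
  have h6 : t' ^ 6 = 1 := by
    refine aux_commRing k hk t' htt ?_
    intro v
    have h := hc (Units.map B.subtype.toMonoidHom v) (by
      ext
      exact congrArg Subtype.val (mul_comm (v : B) t'))
    ext
    simpa using congrArg Units.val h
  have h6' : t ^ 6 = 1 := by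
    ext
    simpa [t'] using congrArg Subtype.val h6
  have hd := Nat.dvd_gcd (orderOf_dvd_of_pow_eq_one h6') (orderOf_dvd_of_pow_eq_one ht)
  have hco : Nat.Coprime 2 (2 ^ k + 1) := by
    rw [Nat.coprime_two_left, Nat.odd_add_one, Nat.not_odd_iff_even]
    exact (Nat.even_pow.2 ⟨even_two, by omega⟩)
  apply orderOf_dvd_iff_pow_eq_one.1
  have h3 : Nat.gcd 6 (2 ^ k + 1) ∣ 3 := by
    have : (6 : ℕ) = 2 * 3 := rfl
    rw [this, Nat.Coprime.gcd_mul_left_cancel _ hco]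
    exact Nat.gcd_dvd_left _ _
  exact hd.trans h3

/-- the choice of the trace -/
theorem aux_trace (F : Type*) [Field F] [Fintype F] [CharP F 2] (hq : 2 < Fintype.card F) :
    ∃ a : F, a ≠ 0 ∧ a ≠ 1 ∧ ∀ r : F, r ^ 2 + a * r + 1 ≠ 0 := by
  have h2 : (2 : F) = 0 := CharTwo.two_eq_zero
  have hns : ¬ Function.Surjective (fun x : F => x ^ 2 + x) := by
    intro h
    have hi := Finite.injective_iff_surjective.2 h
    have := @hi 0 1 (by simp only; linear_combination -h2)
    exact zero_ne_one this
  have hex : ∃ c : F, c ≠ 1 ∧ ∀ x : F, x ^ 2 + x ≠ c := by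
    simp only [Function.Surjective, not_forall, not_exists] at hns
    obtain ⟨c, hc⟩ := hns
    by_cases h1 : c = 1
    · obtain ⟨w, hw0, hw1⟩ : ∃ w : F, w ≠ 0 ∧ w ≠ 1 := by
        classical
        obtain ⟨w, hw⟩ := Finset.exists_mem_notMem_of_card_lt_card
          (s := ({0, 1} : Finset F)) (t := Finset.univ)
          (lt_of_le_of_lt Finset.card_le_two (by simpa using hq))
        simp at hw
        exact ⟨w, hw⟩
      refine ⟨c + (w ^ 2 + w), ?_, ?_⟩
      · intro h
        have : w * (w - 1) = 0 := by linear_combination h - h1 - w * h2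
        rcases mul_eq_zero.1 this with h | h
        · exact hw0 h
        · exact hw1 (sub_eq_zero.1 h)
      · intro x h
        exact hc (x + w) (by linear_combination h + (x * w + w + w ^ 2) * h2)
    · exact ⟨c, h1, hc⟩
  obtain ⟨c, hc1, hc⟩ := hex
  have hc0 : c ≠ 0 := fun h => hc 0 (by rw [h]; ring)
  have hsq : Function.Surjective (fun x : F => x ^ 2) := by
    apply Finite.injective_iff_surjective.1
    intro x y h
    simp only at h
    have : (x - y) ^ 2 = 0 := by linear_combination h + (y ^ 2 - x * y) * h2
    exact sub_eq_zero.1 (pow_eq_zero_iff (two_ne_zero) |>.1 this)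
  obtain ⟨b, hb⟩ := hsq c
  simp only at hb
  have hb0 : b ≠ 0 := by rintro rfl; apply hc0; rw [← hb]; ring
  refine ⟨b⁻¹, inv_ne_zero hb0, ?_, ?_⟩
  · intro h
    apply hc1
    rw [← hb, inv_eq_one.1 h, one_pow]
  · intro r h
    apply hc (r * b)
    field_simp at h
    rw [← hb]
    linear_combination b * h - b ^ 2 * h2

open Matrix in
theorem aux_matrix (F : Type*) [Field F] [Fintype F] [CharP F 2] (k : ℕ)
    (hk : Fintype.card F = 2 ^ k) (hk2 : 2 ≤ k) :
    ∃ t : SpecialLinearGroup (Fin 2) F, t ^ (2 ^ k + 1) = 1 ∧ t ^ 3 ≠ 1 ∧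
      ∀ v, v * t = t * v → v ^ (2 ^ k + 1) = 1 := by
  have : Fact (Nat.Prime 2) := ⟨Nat.prime_two⟩
  have h2 : (2 : F) = 0 := CharTwo.two_eq_zero
  obtain ⟨a, ha0, ha1, har⟩ := aux_trace F (by
    rw [hk]
    exact lt_of_lt_of_le (by norm_num) (Nat.pow_le_pow_right (n := 2) (by norm_num) hk2))
  let T : Matrix (Fin 2) (Fin 2) F := !![0, 1; 1, a]
  have hdet : T.det = 1 := by
    simp only [T, det_fin_two_of]; linear_combination -h2
  have hT2 : T * T = a • T + 1 := by
    ext i j; fin_cases i <;> fin_cases j <;> simp [T] ; ring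
  have hfrob : ∀ (X Y : Matrix (Fin 2) (Fin 2) F) (n : ℕ), Commute X Y →
      (X + Y) ^ (2 ^ n) = X ^ (2 ^ n) + Y ^ (2 ^ n) :=
    fun X Y n h => add_pow_char_pow_of_commute _ _ h
  have hpow : ∀ n, ∃ b : F, T ^ (2 ^ n) = a ^ (2 ^ n - 1) • T + b • 1 := by
    intro n
    induction n with
    | zero => exact ⟨0, by simp⟩
    | succ n ih =>
      obtain ⟨b, hb⟩ := ih
      refine ⟨a ^ (2 ^ n - 1) * a ^ (2 ^ n - 1) + b ^ 2, ?_⟩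
      have hcm : Commute (a ^ (2 ^ n - 1) • T) (b • (1 : Matrix (Fin 2) (Fin 2) F)) :=
        ((Commute.one_right T).smul_left _).smul_right _
      have := hfrob _ _ 1 hcm
      rw [pow_one] at this
      rw [pow_succ 2 n, pow_mul, hb, this, sq, smul_mul_smul_comm, hT2, sq,
        smul_mul_smul_comm, one_mul, smul_add, smul_smul, add_assoc, ← add_smul]
      congr 2
      · rw [← pow_add, ← pow_succ]; congr 1
        have : 0 < 2 ^ n := by positivity
        omega
      · ring
  obtain ⟨b, hb⟩ := hpow k
  rw [← hk, FiniteField.pow_card_sub_one_eq_one a ha0, one_smul] at hb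
  have hTq : T ^ Fintype.card F ≠ T := by
    intro h
    have hprod : (Polynomial.X ^ Fintype.card F - Polynomial.X : Polynomial F) =
        ∏ c : F, (Polynomial.X - Polynomial.C c) := by
      have h1 := Polynomial.prod_multiset_X_sub_C_of_monic_of_roots_card_eq
        (p := (Polynomial.X ^ Fintype.card F - Polynomial.X : Polynomial F))
        (Polynomial.monic_X_pow_sub (by
          rw [Polynomial.degree_X]; exact_mod_cast Fintype.one_lt_card))
        (by rw [FiniteField.roots_X_pow_card_sub_X,
              FiniteField.X_pow_card_sub_X_natDegree_eq F Fintype.one_lt_card]; simp)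
      rw [FiniteField.roots_X_pow_card_sub_X] at h1
      exact h1.symm
    let f : Polynomial F →* F := detMonoidHom.comp (Polynomial.aeval T : _ →ₐ[F] _).toMonoidHom
    have h0 := congrArg f hprod
    rw [map_prod] at h0
    have hl : f (Polynomial.X ^ Fintype.card F - Polynomial.X) = 0 := by
      simp [f, h]
    rw [hl] at h0
    obtain ⟨c, -, hc⟩ := Finset.prod_eq_zero_iff.1 h0.symm
    apply har c
    simp [f, T, det_fin_two, algebraMap_matrix_apply] at hc
    linear_combination hc + (a * c + 1) * h2
  have hbb : b * b = a * b := by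
    have h1 : (T ^ Fintype.card F) * (T ^ Fintype.card F) = a • T ^ Fintype.card F + 1 := by
      rw [← (Commute.refl T).mul_pow, hT2, hk, hfrob _ _ _ (Commute.one_right _), smul_pow, ← hk,
        FiniteField.pow_card, one_pow]
    rw [hb] at h1
    have := congrFun (congrFun h1 0) 0
    simp [-mul_eq_mul_left_iff, -mul_eq_mul_right_iff, T, mul_apply, Fin.sum_univ_two] at this
    linear_combination this
  have hba : b = a := by
    have : b * (b - a) = 0 := by linear_combination hbb
    rcases mul_eq_zero.1 this with h | h
    · exact absurd (by rw [hb, h]; simp) hTq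
    · exact sub_eq_zero.1 h
  subst hba
  have hmain : ∀ v : SpecialLinearGroup (Fin 2) F, (v : Matrix (Fin 2) (Fin 2) F) * T = T * v →
      v ^ (2 ^ k + 1) = 1 := by
    intro v hv
    obtain ⟨p, hp⟩ : ∃ p, p = v.1 0 0 := ⟨_, rfl⟩
    obtain ⟨r, hr⟩ : ∃ r, r = v.1 0 1 := ⟨_, rfl⟩
    have hv' : v.1 = p • 1 + r • T := by
      have e1 := congrFun (congrFun hv 0) 0
      have e2 := congrFun (congrFun hv 0) 1
      simp [T, mul_apply, Fin.sum_univ_two] at e1 e2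
      ext i j
      fin_cases i <;> fin_cases j <;> simp [T, hp, hr]
      · exact e1.symm
      · linear_combination -e2
    have hd := v.2
    rw [hv'] at hd
    simp [T, det_fin_two] at hd
    have hcm : Commute (p • (1 : Matrix (Fin 2) (Fin 2) F)) (r • T) :=
        ((Commute.one_left T).smul_left _).smul_right _
    refine Subtype.ext ((Matrix.SpecialLinearGroup.coe_pow v (2 ^ k + 1)).trans ?_)
    change v.1 ^ (2 ^ k + 1) = 1
    rw [hv', pow_succ, hfrob _ _ _ hcm, smul_pow, smul_pow, ← hk,
        FiniteField.pow_card, FiniteField.pow_card, one_pow, hb]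
    ext i j
    fin_cases i <;> fin_cases j <;> simp [T, mul_apply, Fin.sum_univ_two]
    · linear_combination hd + r * r * h2
    · linear_combination (p + r * b) * r * h2
    · linear_combination (r * p + r * b * r) * h2
    · linear_combination hd + (r * r + r * b * p + r * b * r * b) * h2
  refine ⟨⟨T, hdet⟩, hmain _ rfl, ?_, fun v hv => hmain v (congrArg Subtype.val hv)⟩
  intro h
  have h3 : T ^ 3 = 1 := congrArg Subtype.val h
  have := congrFun (congrFun h3 0) 1
  simp [pow_succ, T, mul_apply, Fin.sum_univ_two] at this
  have h4 : (b - 1) ^ 2 = 0 := by linear_combination this - b * h2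
  exact ha1 (sub_eq_zero.1 (pow_eq_zero_iff (two_ne_zero) |>.1 h4))

theorem aux_char {F : Type*} [Field F] [CharP F 2] {R : Type*} [Ring R]
    (φ : Rˣ ≃* Matrix.SpecialLinearGroup (Fin 2) F) : CharP R 2 := by
  have h2 : (2 : F) = 0 := CharTwo.two_eq_zero
  have hR : Nontrivial R := by
    by_contra h
    rw [not_nontrivial_iff_subsingleton] at h
    have h1 := φ.symm.injective (Subsingleton.elim (φ.symm
      ⟨!![1, 1; 0, 1], by simp⟩) (φ.symm 1))
    have := congrFun (congrFun (congrArg Subtype.val h1) 0) 1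
    simp at this
  have hm : φ (-1) ∈ Subgroup.center (Matrix.SpecialLinearGroup (Fin 2) F) := by
    rw [Subgroup.mem_center_iff]
    intro g
    obtain ⟨u, rfl⟩ := φ.surjective g
    rw [← map_mul, ← map_mul]; simp
  rw [Matrix.SpecialLinearGroup.mem_center_iff] at hm
  obtain ⟨r, hr, hrs⟩ := hm
  have hr1 : r = 1 := by
    have : (r - 1) ^ 2 = 0 := by
      rw [Fintype.card_fin] at hr
      linear_combination hr + (1 - r) * h2
    exact sub_eq_zero.1 (pow_eq_zero_iff (two_ne_zero) |>.1 this)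
  have h1 : φ (-1) = φ 1 := by
    apply Subtype.ext
    rw [← hrs, hr1]; simp
  have h3 := congrArg Units.val (φ.injective h1)
  simp only [Units.val_neg, Units.val_one] at h3
  have h4 : (2 : R) = 0 := by
    rw [← one_add_one_eq_two]
    nth_rewrite 1 [← h3]
    exact neg_add_cancel 1
  have h5 : ringChar R = 2 := by
    have hd : ringChar R ∣ 2 := (ringChar.spec R 2).1 (by exact_mod_cast h4)
    rcases (Nat.dvd_prime Nat.prime_two).1 hd with h | h
    · exact absurd h CharP.ringChar_ne_one
    · exact h
  rw [← h5]
  infer_instance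

/-- Let `F` be a finite field of characteristic 2 and cardinality `2 ^ k`, and
let `c` be a nonnegative integer. There is a unital ring `R` of characteristic
`c` with `Rˣ ≅ SL₂(F)` if and only if `k = 1` and `c = 2`. -/
theorem sl2_char_two_realizable_iff (F : Type*) [Field F] [Fintype F] [CharP F 2]
    (k : ℕ) (hk : Fintype.card F = 2 ^ k) (c : ℕ) :
    (∃ (R : Type u) (_ : Ring R), ringChar R = c ∧
        Nonempty (Rˣ ≃* Matrix.SpecialLinearGroup (Fin 2) F)) ↔
      k = 1 ∧ c = 2 := by
  constructor
  · rintro ⟨R, _, hc, ⟨φ⟩⟩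
    have := aux_char φ
    refine ⟨?_, by rw [← hc]; exact ringChar.eq R 2⟩
    by_contra h1
    have hk0 : k ≠ 0 := by
      rintro rfl
      have := Fintype.one_lt_card (α := F)
      omega
    have hk2 : 2 ≤ k := by omega
    obtain ⟨t, ht, ht3, hcent⟩ := aux_matrix F k hk hk2
    apply ht3
    have := aux_ring_s8 k hk2 (φ.symm t) (by rw [← map_pow, ht, map_one]) (by
      intro v hv
      apply φ.injective
      rw [map_pow, map_one]
      apply hcent
      simpa using congrArg φ hv)
    apply φ.symm.injective
    rw [map_pow, this, map_one]
  · rintro ⟨rfl, rfl⟩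
    have : Fact (Nat.Prime 2) := ⟨Nat.prime_two⟩
    let σ : ZMod 2 ≃+* F := ZMod.ringEquivOfPrime F Nat.prime_two (by rw [hk, pow_one])
    let R := ULift.{u} (Matrix (Fin 2) (Fin 2) (ZMod 2))
    let e : R ≃+* Matrix (Fin 2) (Fin 2) F := ULift.ringEquiv.trans σ.mapMatrix
    have hb : Function.Bijective (Matrix.SpecialLinearGroup.toGL :
        Matrix.SpecialLinearGroup (Fin 2) F →* Matrix.GeneralLinearGroup (Fin 2) F) := by
      refine ⟨Matrix.SpecialLinearGroup.toGL_injective, fun g => ?_⟩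
      have hd : (g : Matrix (Fin 2) (Fin 2) F).det = 1 := by
        have h0 : (g : Matrix (Fin 2) (Fin 2) F).det ≠ 0 := by
          have := (Matrix.GeneralLinearGroup.det g).ne_zero
          simpa using this
        have := FiniteField.pow_card_sub_one_eq_one _ h0
        simpa [hk] using this
      exact ⟨⟨g, hd⟩, by ext; rfl⟩
    exact ⟨R, inferInstance, ringChar.eq R 2,
      ⟨(Units.mapEquiv e.toMulEquiv).trans (MulEquiv.ofBijective _ hb).symm⟩⟩
end

section
/- Let F be a finite field of odd cardinality q. If there exists a finite unital ring R whose group of units R^× is isomorphic to SL_2(F), then q = 3 and the characteristic of R is 2 or 4. -/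
/-- In a finite monoid some positive power of each element is idempotent. -/
lemma sl2aux_exists_idem {M : Type*} [Monoid M] [Finite M] (a : M) :
    ∃ k : ℕ, 0 < k ∧ a ^ k * a ^ k = a ^ k := by
  obtain ⟨i, j, hij, h⟩ : ∃ i j : ℕ, i < j ∧ a ^ i = a ^ j := by
    obtain ⟨x, y, hne, he⟩ := Finite.exists_ne_map_eq_of_infinite (fun n : ℕ => a ^ n)
    rcases lt_or_gt_of_ne hne with h | h
    · exact ⟨x, y, h, he⟩
    · exact ⟨y, x, h, he.symm⟩
  obtain ⟨d, rfl⟩ := Nat.exists_eq_add_of_lt hij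
  have key : ∀ t m : ℕ, a ^ (i + m + (d + 1) * t) = a ^ (i + m) := by
    intro t
    induction t with
    | zero => intro m; simp
    | succ t ih =>
      intro m
      have : i + m + (d + 1) * (t + 1) = (i + d + 1) + (m + (d + 1) * t) := by ring
      rw [this, pow_add, ← h, ← pow_add, ← add_assoc, ih]
  refine ⟨(d + 1) * (i + 1), by positivity, ?_⟩
  rw [← pow_add]
  have h2 : (d + 1) * (i + 1) = i + (d * i + d + 1) := by ring
  have := key (i + 1) (d * i + d + 1)
  rw [← h2] at this
  exact this

lemma sl2aux_nil_comm {R : Type*} [Ring R] {a b : R} (h : IsNilpotent (a * b)) :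
    IsNilpotent (b * a) := by
  obtain ⟨n, hn⟩ := h
  refine ⟨n + 1, ?_⟩
  have : ∀ n : ℕ, (b * a) ^ (n + 1) = b * (a * b) ^ n * a := by
    intro n
    induction n with
    | zero => simp
    | succ n ih => rw [pow_succ, ih, pow_succ (a * b)]; simp only [mul_assoc]
  rw [this, hn]; simp

lemma sl2aux_inv {R : Type*} [Ring R] [Finite R] {g : R}
    (hg : g * g = g) (hmin : ∀ e, e * e = e → e * g = e → e = 0 ∨ e = g)
    {r : R} (hr : ¬ IsNilpotent (r * g)) : ∃ t, t * r * g = g := by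
  obtain ⟨k, hk, he⟩ := sl2aux_exists_idem (r * g)
  obtain ⟨k, rfl⟩ := Nat.exists_eq_succ_of_ne_zero hk.ne'
  rcases hmin _ he (by rw [pow_succ]; simp only [mul_assoc, hg]) with h | h
  · exact absurd ⟨_, h⟩ hr
  · exact ⟨(r * g) ^ k, by rw [mul_assoc, ← pow_succ, h]⟩

lemma sl2aux_not_inv {R : Type*} [Ring R] {g : R}
    (hg : g * g = g) (hc : ∀ r, g * r = r * g) (h0 : g ≠ 0)
    {r t : R} (hr : IsNilpotent (r * g)) : t * r * g ≠ g := by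
  intro h
  obtain ⟨n, hn⟩ := hr
  have : ∀ m : ℕ, t ^ m * g * (r * g) ^ m = g := by
    intro m
    induction m with
    | zero => simp
    | succ m ih =>
      calc t ^ (m+1) * g * (r * g) ^ (m+1)
          = t ^ m * (t * (g * r) * g) * (r * g) ^ m := by
            rw [pow_succ, pow_succ' (r * g)]; simp only [mul_assoc]
        _ = t ^ m * (t * r * g * g) * (r * g) ^ m := by rw [hc r]; simp only [mul_assoc]
        _ = g := by rw [h, hg, ih]
  have h1 := this n
  rw [hn, mul_zero] at h1
  exact h0 h1.symm

lemma sl2aux_absorb {R : Type*} [Ring R] [Finite R] {g : R}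
    (hg : g * g = g) (hc : ∀ r, g * r = r * g) (h0 : g ≠ 0) (hmin : ∀ e, e * e = e → e * g = e → e = 0 ∨ e = g)
    {r : R} (s : R) (hr : IsNilpotent (r * g)) : IsNilpotent (s * r * g) := by
  by_contra hn
  obtain ⟨t, ht⟩ := sl2aux_inv hg hmin hn
  exact sl2aux_not_inv hg hc h0 hr (t := t * s) (by rw [mul_assoc t, ht])

lemma sl2aux_add {R : Type*} [Ring R] [Finite R] {g : R}
    (hg : g * g = g) (hc : ∀ r, g * r = r * g) (h0 : g ≠ 0) (hmin : ∀ e, e * e = e → e * g = e → e = 0 ∨ e = g)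
    {r s : R} (hr : IsNilpotent (r * g)) (hs : IsNilpotent (s * g)) :
    IsNilpotent ((r + s) * g) := by
  by_contra hn
  obtain ⟨t, ht⟩ := sl2aux_inv hg hmin hn
  obtain ⟨v, hv⟩ := (sl2aux_absorb hg hc h0 hmin t hs).isUnit_one_sub
  have h1 : (v : R) * g = t * r * g := by
    have h2 : t * r * g = g - t * s * g := by
      rw [eq_sub_iff_add_eq, ← add_mul, ← mul_add, ht]
    rw [hv, h2, sub_mul, one_mul, mul_assoc (t * s), hg]
  refine sl2aux_not_inv hg hc h0 hr (t := (v⁻¹ : Rˣ) * t) ?_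
  rw [mul_assoc, mul_assoc, ← mul_assoc t, ← h1, Units.inv_mul_cancel_left]

lemma sl2aux_key {R : Type*} [Ring R] [Finite R] {g : R}
    (hg : g * g = g) (hc : ∀ r, g * r = r * g) (h0 : g ≠ 0) (hmin : ∀ e, e * e = e → e * g = e → e = 0 ∨ e = g)
    {c u d : R} (hu : IsUnit u) (hd : IsUnit d) (h : d * u = c * (u * d)) :
    IsNilpotent ((c - 1) * g) := by
  let M : Ideal R :=
    { carrier := {r | IsNilpotent (r * g)}
      add_mem' := fun hr hs => sl2aux_add hg hc h0 hmin hr hs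
      zero_mem' := by simp
      smul_mem' := fun s r hr => sl2aux_absorb hg hc h0 hmin s hr }
  have hM : ∀ r, r ∈ M ↔ IsNilpotent (r * g) := fun r => Iff.rfl
  have hMr : ∀ {r : R} (s : R), r ∈ M → r * s ∈ M := by
    intro r s hr
    rw [hM, mul_assoc]
    apply sl2aux_nil_comm
    rw [mul_assoc, hc r, ← mul_assoc]
    exact sl2aux_absorb hg hc h0 hmin s hr
  have : M.IsTwoSided := ⟨fun s hr => hMr s hr⟩
  have : Nontrivial (R ⧸ M) := by
    refine Ideal.Quotient.nontrivial_iff.2 ?_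
    rw [Ne, Ideal.eq_top_iff_one, hM, one_mul]
    rintro ⟨n, hn⟩
    exact sl2aux_not_inv hg hc h0 (r := 1) (t := 1) ⟨n, by simpa using hn⟩ (by simp)
  have : NoZeroDivisors (R ⧸ M) := by
    refine ⟨fun {a b} hab => ?_⟩
    obtain ⟨r, rfl⟩ := Ideal.Quotient.mk_surjective a
    obtain ⟨s, rfl⟩ := Ideal.Quotient.mk_surjective b
    rw [← map_mul, Ideal.Quotient.eq_zero_iff_mem] at hab
    rw [Ideal.Quotient.eq_zero_iff_mem, Ideal.Quotient.eq_zero_iff_mem]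
    by_contra! hcon
    obtain ⟨t, ht⟩ := sl2aux_inv hg hmin (r := r) hcon.1
    apply hcon.2
    have h1 := sl2aux_absorb hg hc h0 hmin t hab
    have h2 : t * (r * s) * g = s * g := by
      rw [mul_assoc, mul_assoc, ← hc s, ← mul_assoc r, ← mul_assoc t, ← mul_assoc t, ht]
    rw [h2] at h1
    exact h1
  have : IsDomain (R ⧸ M) := NoZeroDivisors.to_isDomain _
  have : Finite (R ⧸ M) := Finite.of_surjective _ (Ideal.Quotient.mk_surjective (I := M))
  have hF := Finite.isDomain_to_isField (R ⧸ M)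
  have h3 : (c - 1) * (u * d) ∈ M := by
    rw [← Ideal.Quotient.eq_zero_iff_mem]
    have : (c - 1) * (u * d) = d * u - u * d := by rw [sub_mul, one_mul, h]
    rw [this, map_sub, map_mul, map_mul, hF.mul_comm, sub_self]
  obtain ⟨w, hw⟩ := hu.mul hd
  have h4 := hMr (w⁻¹ : Rˣ) h3
  rw [← hw, Units.mul_inv_cancel_right] at h4
  exact h4


/-- With central idempotents, a group commutator is congruent to one modulo nilpotents. -/
lemma sl2aux_comm_nil {R : Type*} [Ring R] [Finite R]
    (hcen : ∀ e : R, e * e = e → ∀ r, e * r = r * e)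
    {c u d : R} (hu : IsUnit u) (hd : IsUnit d) (h : d * u = c * (u * d)) :
    IsNilpotent (c - 1) := by
  obtain ⟨k, hk, he⟩ := sl2aux_exists_idem (c - 1)
  by_contra hn
  set f := (c - 1) ^ k with hf
  have hf0 : f ≠ 0 := fun h => hn ⟨k, h⟩
  obtain ⟨g, ⟨hg0, hgg, hgf⟩, hgm⟩ := Set.exists_min_image {e : R | e ≠ 0 ∧ e * e = e ∧ e * f = e}
    (fun e => (Set.range (fun r => r * e)).ncard) (Set.toFinite _) ⟨f, hf0, he, he⟩
  have hnil := sl2aux_key hgg (hcen g hgg) hg0 (by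
    intro e hee heg
    by_contra! hcon
    have h1 := hgm e ⟨hcon.1, hee, by rw [← heg, mul_assoc, hgf]⟩
    have h2 : Set.range (fun r => r * e) ⊆ Set.range (fun r => r * g) := by
      rintro _ ⟨r, rfl⟩
      exact ⟨r * e, by simp only [mul_assoc, heg]⟩
    have h3 := Set.eq_of_subset_of_ncard_le h2 h1 (Set.toFinite _)
    have h4 : g ∈ Set.range (fun r => r * e) := by
      rw [h3]; exact ⟨g, hgg⟩
    obtain ⟨r, hr⟩ := h4
    apply hcon.2
    have h5 : g * e = g := by rw [← hr]; simp only [mul_assoc, hee]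
    rw [← heg, hcen e hee, h5]) hu hd h
  have hcm : Commute (c - 1) g := (hcen g hgg _).symm
  have h6 : IsNilpotent (((c - 1) * g) ^ k) := hnil.pow_of_pos hk.ne'
  have h7 : g ^ k = g := IsIdempotentElem.pow_eq hgg hk.ne'
  rw [hcm.mul_pow, ← hf, h7, ← hcen g hgg, hgf] at h6
  exact hg0 (IsIdempotentElem.eq_zero_of_isNilpotent hgg h6)

lemma sl2aux_unip {R : Type*} [Ring R] {c : R} {p : ℕ} (hp : IsUnit (p : R)) (hc : c ^ p = 1)
    (hn : IsNilpotent (c - 1)) : c = 1 := by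
  have h1 : (c - 1) * ∑ i ∈ Finset.range p, c ^ i = 0 := by
    rw [mul_geom_sum, hc, sub_self]
  have h2 : ∑ i ∈ Finset.range p, c ^ i
      = ∑ i ∈ Finset.range p, (c ^ i - 1) + (p : R) := by
    simp
  have h3 : IsNilpotent (∑ i ∈ Finset.range p, (c ^ i - 1)) := by
    apply Commute.isNilpotent_sum
    · intro i _
      rw [← mul_geom_sum]
      apply Commute.isNilpotent_mul_right _ hn
      exact Commute.sum_right _ _ _ fun j _ =>
        ((Commute.refl c).sub_left (Commute.one_left c)).pow_right j
    · intro i j _ _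
      exact ((Commute.pow_pow_self c i j).sub_left (Commute.one_left _)).sub_right
        (Commute.one_right _)
  have h4 : IsUnit (∑ i ∈ Finset.range p, c ^ i) := by
    rw [h2, add_comm]
    exact h3.isUnit_add_left_of_commute hp (Nat.cast_commute p _).symm
  exact sub_eq_zero.1 ((h4.mul_left_eq_zero).1 h1)

/-- Idempotents are central when there is a single involution and it is a square. -/
lemma sl2aux_cen {R : Type*} [Ring R] (z w : R) (hw : w * w = z)
    (huniq : ∀ u : R, u * u = 1 → u = 1 ∨ u = z)
    (h2 : ∀ e : R, e * e = e → 2 * e = 0 ∨ 2 * (1 - e) = 0)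
    (e : R) (he : e * e = e) (r : R) : e * r = r * e := by
  have hcompl : ∀ e : R, e * e = e → (1 - e) * (1 - e) = 1 - e := by
    intro e he
    rw [mul_sub, mul_one, sub_mul, one_mul, he]; simp
  have basic : ∀ e s : R, e * e = e → (e * s * (1 - e) + e * s * (1 - e) = 0) ∧
      (e * s * (1 - e) = 0 ∨ 1 + e * s * (1 - e) = z) := by
    intro e s he
    set n := e * s * (1 - e) with hn
    have hen : e * n = n := by rw [hn, ← mul_assoc, ← mul_assoc, he]
    have hne : n * e = 0 := by rw [hn, mul_assoc, sub_mul, one_mul, he, sub_self, mul_zero]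
    have hnn : n * n = 0 := by
      nth_rewrite 2 [← hen]
      rw [← mul_assoc, hne, zero_mul]
    have h2n : n + n = 0 := by
      have t2 : n + n = 2 * n := (two_mul n).symm
      rcases h2 e he with h | h
      · rw [t2, hn, ← mul_assoc, ← mul_assoc, h, zero_mul, zero_mul]
      · have h' : (1 - e) + (1 - e) = 0 := by rw [← two_mul, h]
        rw [hn, ← mul_add, h', mul_zero]
    have hsq : (1 + n) * (1 + n) = 1 := by
      rw [mul_add, mul_one, add_mul, one_mul, hnn, add_zero, add_assoc, h2n, add_zero]
    refine ⟨h2n, ?_⟩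
    rcases huniq _ hsq with h | h
    · left; simpa using h
    · right; exact h
  have main : ∀ e : R, e * e = e → e * r * (1 - e) = 0 := by
    intro e he
    obtain ⟨h2n, hz⟩ := basic e r he
    rcases hz with h | hz
    · exact h
    set n := e * r * (1 - e) with hn
    have hen : e * n = n := by rw [hn, ← mul_assoc, ← mul_assoc, he]
    have hne : n * e = 0 := by rw [hn, mul_assoc, sub_mul, one_mul, he, sub_self, mul_zero]
    have hwz : w * z = z * w := by rw [← hw, mul_assoc]
    have hwn : w * n = n * w := by
      rw [← hz, mul_add, add_mul] at hwz
      simpa using hwz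
    have e0 : e * (1 - e) = 0 := by rw [mul_sub, mul_one, he, sub_self]
    have hf : n * (1 - e) = n := by rw [mul_sub, mul_one, hne, sub_zero]
    have hsplit : n = e * w * (e * w * (1 - e)) + (e * w * (1 - e)) * (w * (1 - e)) := by
      have h1 : n = e * (w * w) * (1 - e) := by
        rw [hw, ← hz, mul_add, mul_one, hen, add_mul, e0, zero_add, hf]
      rw [h1]
      noncomm_ring
    rcases (basic e w he).2 with h | h
    · rw [h, mul_zero, zero_mul, add_zero] at hsplit
      exact hsplit
    · have hm : e * w * (1 - e) = n := add_left_cancel (h.trans hz.symm)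
      rw [hm, mul_assoc e, hwn, ← mul_assoc, hen, ← mul_assoc n, ← hwn, mul_assoc w, hf, ← mul_add,
        h2n, mul_zero] at hsplit
      exact hsplit
  have h3 := main e he
  have h4 := main (1 - e) (hcompl e he)
  rw [sub_sub_cancel] at h4
  rw [mul_sub, mul_one, sub_eq_zero] at h3
  rw [sub_mul, sub_mul, one_mul, sub_eq_zero] at h4
  rw [h3, h4]

lemma sl2aux_char {n : ℕ} (hn : 0 < n)
    (h : ∀ m : ℕ, m.Coprime n → (n : ℤ) ∣ m + 1 ∨ (n : ℤ) ∣ m - 1) :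
    n = 1 ∨ n = 2 ∨ n = 3 ∨ n = 4 ∨ n = 6 := by
  have key : ∀ a : ℕ, 0 < a → (n : ℤ) ∣ a → n ≤ a := fun a ha hd =>
    Nat.le_of_dvd ha (by exact_mod_cast hd)
  rcases Nat.even_or_odd' n with ⟨k, rfl | rfl⟩
  · rcases Nat.even_or_odd' k with ⟨l, rfl | rfl⟩
    · have hco : (2 * l + 1).Coprime (2 * (2 * l)) := by
        have h1 : (2 * l + 1).Coprime (2 * l) := by simp
        have h2 : (2 * l + 1).Coprime 2 := by simp
        exact h2.mul_right h1
      rcases h _ hco with h | h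
      · have := key (2 * l + 2) (by omega) (by push_cast at h ⊢; convert h using 1; ring)
        omega
      · have := key (2 * l) (by omega) (by push_cast at h ⊢; convert h using 1; ring)
        omega
    · have hco : (2 * l + 1 + 2).Coprime (2 * (2 * l + 1)) := by
        have h2 : (2 * l + 1).Coprime 2 := by simp
        have h3 : (2 * l + 1 + 2).Coprime 2 := by
          rw [Nat.coprime_two_right]; exact ⟨l + 1, by ring⟩
        have h1 : (2 * l + 1 + 2).Coprime (2 * l + 1) := by simp
        exact h3.mul_right h1
      rcases h _ hco with h | h
      · have := key (2 * l + 4) (by omega) (by push_cast at h ⊢; convert h using 1; ring)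
        omega
      · have := key (2 * l + 2) (by omega) (by push_cast at h ⊢; convert h using 1; ring)
        omega
  · have hco : Nat.Coprime 2 (2 * k + 1) := by simp
    rcases h _ hco with h | h
    · have := key 3 (by omega) (by push_cast at h ⊢; convert h using 1)
      omega
    · have := key 1 (by omega) (by push_cast at h ⊢; convert h using 1)
      omega

lemma sl2aux_isUnit {R : Type*} [Ring R] {m : ℕ} (h : m.Coprime (ringChar R)) :
    IsUnit (m : R) := by
  obtain ⟨a, b, hab⟩ := Nat.isCoprime_iff_coprime.2 h
  have h1 := congrArg (Int.cast : ℤ → R) hab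
  push_cast at h1
  rw [ringChar.Nat.cast_ringChar, mul_zero, add_zero] at h1
  exact ⟨⟨m, a, by rw [(Nat.cast_commute m (a : R)).eq, h1], h1⟩, rfl⟩

section sl
variable {F : Type*} [Field F]
open Matrix

lemma sl2aux_invol (h2 : (2 : F) ≠ 0) (A : Matrix.SpecialLinearGroup (Fin 2) F) (hA : A * A = 1) :
    A = 1 ∨ A = -1 := by
  have hd := A.det_coe
  rw [det_fin_two] at hd
  have e : ∀ i j, (A * A) i j = (1 : Matrix.SpecialLinearGroup (Fin 2) F) i j := fun i j => by rw [hA]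
  have e00 := e 0 0
  have e01 := e 0 1
  have e10 := e 1 0
  have e11 := e 1 1
  simp [Matrix.mul_apply, Fin.sum_univ_two] at e00 e01 e10 e11
  have ht : A 0 0 + A 1 1 ≠ 0 := by
    intro h
    apply h2
    linear_combination A 0 0 * h - e00 - hd
  have hb : A 0 1 = 0 := by
    have : A 0 1 * (A 0 0 + A 1 1) = 0 := by linear_combination e01
    simpa [ht] using this
  have hc : A 1 0 = 0 := by
    have : A 1 0 * (A 0 0 + A 1 1) = 0 := by linear_combination e10
    simpa [ht] using this
  rw [hb] at hd e00
  have ha : (A 0 0 - 1) * (A 0 0 + 1) = 0 := by linear_combination e00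
  rcases mul_eq_zero.1 ha with h | h
  · have h' : A 0 0 = 1 := by linear_combination h
    rw [h'] at hd
    left
    ext i j
    fin_cases i <;> fin_cases j <;> simp [hb, hc, h']
    linear_combination hd
  · have h' : A 0 0 = -1 := by linear_combination h
    rw [h'] at hd
    right
    ext i j
    fin_cases i <;> fin_cases j <;> simp [hb, hc, h']
    linear_combination -hd

lemma sl2aux_center (A : Matrix.SpecialLinearGroup (Fin 2) F) (hA : ∀ B, B * A = A * B) :
    A * A = 1 := by
  have := Matrix.SpecialLinearGroup.mem_center_iff.1 (Subgroup.mem_center_iff.2 hA)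
  obtain ⟨r, hr, h⟩ := this
  ext i j
  rw [Matrix.SpecialLinearGroup.coe_mul, ← h, ← map_mul]
  rw [Fintype.card_fin] at hr
  rw [← pow_two, hr]
  simp

lemma sl2aux_mk (M : Matrix (Fin 2) (Fin 2) F) (h : M.det = 1) :
    ∃ A : Matrix.SpecialLinearGroup (Fin 2) F, (A : Matrix (Fin 2) (Fin 2) F) = M := ⟨⟨M, h⟩, rfl⟩

lemma sl2aux_sq : ∃ w : Matrix.SpecialLinearGroup (Fin 2) F, w * w = -1 := by
  obtain ⟨a, ha⟩ := sl2aux_mk (!![0, 1; -1, 0] : Matrix (Fin 2) (Fin 2) F) (by simp)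
  refine ⟨a, ?_⟩
  ext i j
  rw [Matrix.SpecialLinearGroup.coe_mul, ha]
  fin_cases i <;> fin_cases j <;> simp

lemma sl2aux_neg_one [Fintype F] :
    ∃ a b : Matrix.SpecialLinearGroup (Fin 2) F, a * b = -1 * (b * a) := by
  obtain ⟨p, hp⟩ := CharP.exists F
  have : NeZero p := ⟨CharP.char_ne_zero_of_finite F p⟩
  obtain ⟨x, y, hxy⟩ := CharP.sq_add_sq F p (-1)
  push_cast at hxy
  obtain ⟨a, ha⟩ := sl2aux_mk (!![0, 1; -1, 0] : Matrix (Fin 2) (Fin 2) F) (by simp)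
  obtain ⟨b, hb⟩ := sl2aux_mk (!![(x : F), y; y, -x]) (by
    rw [det_fin_two]; simp
    linear_combination -hxy)
  refine ⟨a, b, ?_⟩
  ext i j
  rw [neg_mul, one_mul, Matrix.SpecialLinearGroup.coe_neg, Matrix.SpecialLinearGroup.coe_mul,
    Matrix.SpecialLinearGroup.coe_mul, ha, hb]
  fin_cases i <;> fin_cases j <;> simp

lemma sl2aux_trans (a : F) (h0 : a ≠ 0) (h1 : a ^ 2 ≠ 1) :
    ∃ c u d : Matrix.SpecialLinearGroup (Fin 2) F,
      d * u = c * (u * d) ∧ c ≠ 1 ∧ c ^ (ringChar F) = 1 := by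
  have h1' : a ^ 2 - 1 ≠ 0 := sub_ne_zero.2 h1
  obtain ⟨c, hc⟩ := sl2aux_mk (!![1, 1; 0, 1] : Matrix (Fin 2) (Fin 2) F) (by simp)
  obtain ⟨u, hu⟩ := sl2aux_mk (!![1, 1 / (a ^ 2 - 1); 0, 1]) (by simp)
  obtain ⟨d, hd⟩ := sl2aux_mk (!![a, 0; 0, a⁻¹]) (by simp [h0])
  refine ⟨c, u, d, ?_, ?_, ?_⟩
  · ext i j
    simp only [Matrix.SpecialLinearGroup.coe_mul, hc, hu, hd]
    fin_cases i <;> fin_cases j <;> simp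
    field_simp
    ring
  · intro h
    have h2 : (c : Matrix (Fin 2) (Fin 2) F) 0 1 = 0 := by rw [h]; simp
    rw [hc] at h2
    simp at h2
  · have hpow : ∀ n : ℕ, (!![1, 1; 0, 1] : Matrix (Fin 2) (Fin 2) F) ^ n = !![1, (n : F); 0, 1] := by
      intro n
      induction n with
      | zero => simp [Matrix.one_fin_two]
      | succ n ih => rw [pow_succ, ih]; simp [add_comm]
    ext i j
    rw [Matrix.SpecialLinearGroup.coe_pow, hc, hpow]
    simp [Matrix.one_fin_two]

end sl

/-- Let `F` be a finite field of odd cardinality `q`. If a finite unital ring `R`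
has unit group isomorphic to `SL₂(F)`, then `q = 3` and the characteristic of `R`
is 2 or 4. -/
theorem sl2_odd_finite_ring (F : Type*) [Field F] [Fintype F]
    (hodd : Odd (Fintype.card F)) (R : Type*) [Ring R] [Finite R]
    (h : Nonempty (Rˣ ≃* Matrix.SpecialLinearGroup (Fin 2) F)) :
    Fintype.card F = 3 ∧ (ringChar R = 2 ∨ ringChar R = 4) := by
  obtain ⟨φ⟩ := h
  have hpne : ringChar F ≠ 2 := by
    intro h2
    have := FiniteField.even_card_of_char_two h2
    rw [Nat.odd_iff] at hodd
    omega
  have hF2 : (2 : F) ≠ 0 := Ring.two_ne_zero hpne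
  set Z : Rˣ := φ.symm (-1) with hZ
  have hm1 : (-1 : Matrix.SpecialLinearGroup (Fin 2) F) ≠ 1 := by
    intro h
    have h2 : ((-1 : Matrix.SpecialLinearGroup (Fin 2) F) : Matrix (Fin 2) (Fin 2) F) 0 0 = 1 := by
      rw [h]; simp
    simp at h2
    apply hF2
    linear_combination -h2
  have hZ1 : Z ≠ 1 := by
    intro h
    apply hm1
    rw [hZ, MulEquiv.symm_apply_eq, map_one] at h
    exact h
  have huniqU : ∀ u : Rˣ, u * u = 1 → u = 1 ∨ u = Z := by
    intro u hu
    rcases sl2aux_invol hF2 (φ u) (by rw [← map_mul, hu, map_one]) with h | h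
    · left; exact φ.map_eq_one_iff.1 h
    · right; rw [hZ, ← h, MulEquiv.symm_apply_apply]
  have huniq : ∀ u : R, u * u = 1 → u = 1 ∨ u = Z := by
    intro u hu
    rcases huniqU ⟨u, u, hu, hu⟩ (by ext; exact hu) with h | h
    · left; simpa using congrArg Units.val h
    · right; simpa using congrArg Units.val h
  have hnt : Nontrivial R := by
    by_contra hn
    rw [not_nontrivial_iff_subsingleton] at hn
    exact hZ1 (Subsingleton.elim _ _)
  have hcast : ∀ m : ℕ, (m : R) = 0 ↔ ringChar R ∣ m := ringChar.spec R
  have hcasti : ∀ m : ℤ, (m : R) = 0 ↔ (ringChar R : ℤ) ∣ m := CharP.intCast_eq_zero_iff R _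
  have hn0 : 0 < ringChar R := Nat.pos_of_ne_zero (CharP.char_ne_zero_of_finite R _)
  have hn1 : ringChar R ≠ 1 := CharP.ringChar_ne_one
  have hneg : ringChar R ≠ 2 → (Z : R) = -1 := by
    intro hr
    rcases huniq (-1) (by simp) with h | h
    · exfalso
      have h2 : ((2 : ℕ) : R) = 0 := by
        push_cast
        rw [← one_add_one_eq_two]
        nth_rewrite 1 [← h]
        simp
      rw [hcast, Nat.dvd_prime Nat.prime_two] at h2
      omega
    · exact h.symm
  have hchar : ringChar R = 2 ∨ ringChar R = 3 ∨ ringChar R = 4 ∨ ringChar R = 6 := by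
    by_cases hr : ringChar R = 2
    · exact Or.inl hr
    have := sl2aux_char hn0 (by
      intro m hm
      obtain ⟨u, hu⟩ := sl2aux_isUnit hm
      have hsq : u * u = 1 := by
        apply φ.injective
        rw [map_mul, map_one]
        apply sl2aux_center
        intro B
        obtain ⟨b, rfl⟩ := φ.surjective B
        rw [← map_mul, ← map_mul]
        congr 1
        ext
        rw [Units.val_mul, Units.val_mul, hu, (Nat.cast_commute m (b : R)).eq]
      rcases huniqU u hsq with h | h
      · right
        rw [← hcasti]
        rw [h] at hu
        push_cast
        rw [← hu]; simp
      · left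
        rw [← hcasti]
        rw [h, hneg hr] at hu
        push_cast
        rw [← hu]; simp)
    omega
  -- transport from `SL₂(F)` to `R`
  have hrel : ∀ c u d : Matrix.SpecialLinearGroup (Fin 2) F, d * u = c * (u * d) →
      ((φ.symm d : Rˣ) : R) * (φ.symm u : Rˣ)
        = (φ.symm c : Rˣ) * ((φ.symm u : Rˣ) * (φ.symm d : Rˣ)) := by
    intro c u d h
    have := congrArg (fun x => ((φ.symm x : Rˣ) : R)) h
    simpa using this
  have hchar' : ringChar R = 2 ∨ ringChar R = 4 := by
    by_contra hcon
    have h36 : ringChar R = 3 ∨ ringChar R = 6 := by omega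
    have h6 : (6 : R) = 0 := by
      have := (hcast 6).2 (by rcases h36 with h | h <;> rw [h] <;> norm_num)
      exact_mod_cast this
    have hnil2 : ¬ IsNilpotent (2 : R) := by
      rintro ⟨k, hk⟩
      have h2 : ((2 ^ k : ℕ) : R) = 0 := by push_cast; exact hk
      rw [hcast] at h2
      have h3 : 3 ∣ 2 ^ k := dvd_trans (by rcases h36 with h | h <;> rw [h]; norm_num) h2
      have := Nat.prime_three.dvd_of_dvd_pow h3
      omega
    have hZn := hneg (by omega)
    obtain ⟨a, b, hab⟩ := sl2aux_neg_one (F := F)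
    have hab' := hrel _ _ _ hab
    rw [← hZ, hZn] at hab'
    have h4e : ∀ e : R, e + e = 0 → 4 * e = 0 := by
      intro e he
      have : 4 * e = (e + e) + (e + e) := by noncomm_ring
      rw [this, he, add_zero]
    have hnil := sl2aux_key (g := (4 : R)) (by
        have : (4 : R) * 4 = 6 + 6 + 4 := by norm_num
        rw [this, h6]; simp)
      (fun r => ((Nat.cast_commute 4 r).eq : ((4 : ℕ) : R) * r = r * (4 : ℕ)))
      (fun h4 => hnil2 ⟨2, by rw [← h4]; norm_num⟩)
      (by
        intro e he heg
        have heg' : 4 * e = e := by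
          have h5 : 4 * e = e * 4 := (Nat.cast_commute 4 e).eq
          rw [h5, heg]
        have hsq : (1 - 2 * e) * (1 - 2 * e) = 1 := by
          have : (1 - 2 * e) * (1 - 2 * e) = 1 - 4 * e + 4 * (e * e) := by noncomm_ring
          rw [this, he]; simp
        rcases huniq _ hsq with h | h
        · left
          rw [← heg']
          apply h4e
          rw [← two_mul]
          simpa using h
        · right
          rw [hZn] at h
          have h7 : 2 * e = 2 := by
            have : 2 * e = 1 - (1 - 2 * e) := by abel
            rw [this, h]; norm_num
          have h8 : 4 * e = 2 * e + 2 * e := by noncomm_ring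
          rw [← heg', h8, h7]; norm_num)
      (Units.isUnit _) (Units.isUnit _) hab'
    apply hnil2
    have h9 : ((-1 - 1) * 4 : R) = -2 := by
      have : ((-1 - 1) * 4 : R) = -6 - 2 := by norm_num
      rw [this, h6]; simp
    rw [h9] at hnil
    simpa using hnil
  refine ⟨?_, hchar'⟩
  by_contra hq3
  have hq : 3 < Fintype.card F := by
    have : 1 < Fintype.card F := Fintype.one_lt_card
    rw [Nat.odd_iff] at hodd
    omega
  obtain ⟨a, ha0, ha1⟩ : ∃ a : F, a ≠ 0 ∧ a ^ 2 ≠ 1 := by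
    classical
    by_contra! hcon
    have hsub : (Finset.univ : Finset F) ⊆ {0, 1, -1} := by
      intro a _
      by_cases h : a = 0
      · simp [h]
      · have := sq_eq_one_iff.1 (hcon a h)
        simp [this]
    have := Finset.card_le_card hsub
    have h3 := Finset.card_le_three (a := (0 : F)) (b := 1) (c := -1)
    rw [Finset.card_univ] at this
    omega
  obtain ⟨c, u, d, hcud, hc1, hcp⟩ := sl2aux_trans a ha0 ha1
  have hcud' := hrel _ _ _ hcud
  obtain ⟨w, hw⟩ := sl2aux_sq (F := F)
  have hw' : ((φ.symm w : Rˣ) : R) * (φ.symm w : Rˣ) = Z := by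
    rw [← Units.val_mul, ← map_mul, hw]
  have hcen := sl2aux_cen (Z : R) _ hw' huniq (by
    intro e he
    by_cases hr : ringChar R = 2
    · left
      have : ((2 : ℕ) : R) = 0 := (hcast 2).2 (by rw [hr])
      push_cast at this
      rw [this, zero_mul]
    · have hsq : (1 - 2 * e) * (1 - 2 * e) = 1 := by
        have : (1 - 2 * e) * (1 - 2 * e) = 1 - 4 * e + 4 * (e * e) := by noncomm_ring
        rw [this, he]; simp
      rcases huniq _ hsq with h | h
      · left; simpa using h
      · right
        rw [hneg hr] at h
        have : 2 * (1 - e) = 1 + (1 - 2 * e) := by noncomm_ring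
        rw [this, h]; simp)
  have hnil := sl2aux_comm_nil hcen (Units.isUnit _) (Units.isUnit _) hcud'
  have hp : IsUnit ((ringChar F : ℕ) : R) := by
    apply sl2aux_isUnit
    have hpp : (ringChar F).Prime := CharP.char_is_prime F _
    have h2 : (ringChar F).Coprime 2 := (Nat.coprime_primes hpp Nat.prime_two).2 hpne
    rcases hchar' with h | h <;> rw [h]
    · exact h2
    · exact h2.mul_right h2
  have := sl2aux_unip hp (by
    rw [← Units.val_pow_eq_pow_val, ← map_pow, hcp]; simp) hnil
  apply hc1
  have h5 : φ.symm c = 1 := Units.ext this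
  rw [MulEquiv.symm_apply_eq, map_one] at h5
  exact h5
end

section
/- Let F be a finite field of odd cardinality q with q ≡ 1 (mod 4), and let H be the subgroup of SL_2(F) whose underlying set is UC(F) = { [[x, y], [-y, x]] : x, y ∈ F, x² + y² = 1 }. Then H is cyclic of order q - 1. -/
/-- Let `F` be a finite field of odd cardinality `q` with `q ≡ 1 (mod 4)`, and let
`H` be the subgroup of `SL₂(F)` whose underlying set is the unit circle
`UC(F) = { [[x, y], [-y, x]] : x² + y² = 1 }`. Then `H` is cyclic of order `q - 1`. -/
theorem unitCircle_cyclic_card_q_sub_one (F : Type*) [Field F] [Fintype F]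
    (hodd : Odd (Fintype.card F)) (h4 : Fintype.card F % 4 = 1)
    (H : Subgroup (Matrix.SpecialLinearGroup (Fin 2) F))
    (hH : ∀ A : Matrix.SpecialLinearGroup (Fin 2) F,
      A ∈ H ↔ ∃ x y : F, x ^ 2 + y ^ 2 = 1 ∧
        (A : Matrix (Fin 2) (Fin 2) F) = !![x, y; -y, x]) :
    IsCyclic H ∧ Nat.card H = Fintype.card F - 1 := by
  classical
  have h2 : (2 : F) ≠ 0 := by
    apply Ring.two_ne_zero
    intro h
    have := FiniteField.even_card_of_char_two h
    rw [Nat.odd_iff] at hodd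
    omega
  obtain ⟨i, hi⟩ := (FiniteField.isSquare_neg_one_iff (F := F)).2 (by omega)
  have hi0 : i ≠ 0 := by
    rintro rfl
    simp at hi
  have key : ∀ A : H, A.1.1 1 0 = - A.1.1 0 1 ∧ A.1.1 1 1 = A.1.1 0 0 ∧
      A.1.1 0 0 ^ 2 + A.1.1 0 1 ^ 2 = 1 := by
    intro A
    obtain ⟨x, y, h, hA⟩ := (hH A.1).1 A.2
    rw [hA]
    simpa using h
  let f : H →* F :=
    { toFun := fun A => A.1.1 0 0 + i * A.1.1 0 1
      map_one' := by simp
      map_mul' := by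
        intro A B
        obtain ⟨a1, a2, -⟩ := key A
        obtain ⟨b1, b2, -⟩ := key B
        have e0 : (A * B).1.1 0 0 = A.1.1 0 0 * B.1.1 0 0 + A.1.1 0 1 * B.1.1 1 0 := by
          simp [Matrix.mul_apply, Fin.sum_univ_two]
        have e1 : (A * B).1.1 0 1 = A.1.1 0 0 * B.1.1 0 1 + A.1.1 0 1 * B.1.1 1 1 := by
          simp [Matrix.mul_apply, Fin.sum_univ_two]
        rw [e0, e1, b1, b2]
        linear_combination (A.1.1 0 1 * B.1.1 0 1) * hi }
  have hf : ∀ A, f A = A.1.1 0 0 + i * A.1.1 0 1 := fun A => rfl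
  have hinj : Function.Injective f := by
    intro A B hAB
    rw [hf, hf] at hAB
    obtain ⟨a1, a2, a3⟩ := key A
    obtain ⟨b1, b2, b3⟩ := key B
    have ha : (A.1.1 0 0 + i * A.1.1 0 1) * (A.1.1 0 0 - i * A.1.1 0 1) = 1 := by
      linear_combination a3 + A.1.1 0 1 ^ 2 * hi
    have hb : (B.1.1 0 0 + i * B.1.1 0 1) * (B.1.1 0 0 - i * B.1.1 0 1) = 1 := by
      linear_combination b3 + B.1.1 0 1 ^ 2 * hi
    have hc : A.1.1 0 0 - i * A.1.1 0 1 = B.1.1 0 0 - i * B.1.1 0 1 := by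
      apply mul_left_cancel₀ (left_ne_zero_of_mul_eq_one ha)
      rw [ha, hAB, hb]
    have h00 : A.1.1 0 0 = B.1.1 0 0 := by
      apply mul_left_cancel₀ h2
      linear_combination hAB + hc
    have h01 : A.1.1 0 1 = B.1.1 0 1 := by
      apply mul_left_cancel₀ (mul_ne_zero h2 hi0)
      linear_combination hAB - hc
    apply Subtype.ext
    apply Subtype.ext
    ext j k
    fin_cases j <;> fin_cases k
    · exact h00
    · exact h01
    · change A.1.1 1 0 = B.1.1 1 0
      rw [a1, b1, h01]
    · change A.1.1 1 1 = B.1.1 1 1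
      rw [a2, b2, h00]
  refine ⟨isCyclic_of_subgroup_isDomain f hinj, ?_⟩
  have hbij : Function.Bijective f.toHomUnits := by
    constructor
    · intro A B h
      apply hinj
      simpa using congrArg Units.val h
    · intro u
      have hu : (u : F) ≠ 0 := u.ne_zero
      set x : F := (u + (u : F)⁻¹) / 2 with hx
      set y : F := (u - (u : F)⁻¹) / (2 * i) with hy
      have hxy : x ^ 2 + y ^ 2 = 1 := by
        have hii : i ^ 2 = -1 := by rw [hi]; ring
        rw [hx, hy, div_pow, div_pow, mul_pow, hii]
        field_simp
        ring
      let A : Matrix.SpecialLinearGroup (Fin 2) F := ⟨!![x, y; -y, x], by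
        rw [Matrix.det_fin_two_of]; linear_combination hxy⟩
      refine ⟨⟨A, (hH A).2 ⟨x, y, hxy, rfl⟩⟩, ?_⟩
      apply Units.ext
      change x + i * y = u
      rw [hx, hy]
      field_simp
      ring
  rw [Nat.card_congr (Equiv.ofBijective _ hbij), Nat.card_units, Nat.card_eq_fintype_card]
end
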